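/- Let r ≥ 1 be an integer and 0 < a ≤ 1, and set σ = r − 1/2. Then, as T → ∞, ∫_1^T |ζ_r(r−1/2+it, a, 𝟏)|² dt = (1/((r−1)!)²) · T log T + { Σ_{0 ≤ k,l ≤ r−1, (k,l) ≠ (r−1,r−1)} p_{r,k}(a) p_{r,l}(a) ζ_H(2r−1−k−l, a) + (γ(a) + γ − 1 − log(2π))/((r−1)!)² } · T + O(T^{1/2} log T). -/

import Mathlib

open Complex Filter Finset MeasureTheory

/-- The Hurwitz zeta function `ζ_H(s,a)` (meromorphic continuation of
`∑ m, (m+a)^{-s}`). -/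
noncomputable def hzeta (a : ℝ) (s : ℂ) : ℂ := HurwitzZeta.hurwitzZeta (a : UnitAddCircle) s

/-- `p_{r,j}(a)`: the coefficient of `X^j` in `(1/(r-1)!) ∏_{i=1}^{r-1} (X + i - a)`. -/
noncomputable def pCoeff (r : ℕ) (a : ℝ) (j : ℕ) : ℝ :=
  ((Nat.factorial (r - 1) : ℝ)⁻¹ •
    ∏ i ∈ Finset.range (r - 1), (Polynomial.X + Polynomial.C ((i : ℝ) + 1 - a))).coeff j

/-- The Hurwitz multiple zeta function `ζ_r(s,a,𝟏) = ∑_{j=0}^{r-1} p_{r,j}(a) ζ_H(s-j,a)`. -/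
noncomputable def zetaR (r : ℕ) (a : ℝ) (s : ℂ) : ℂ :=
  ∑ j ∈ Finset.range r, (pCoeff r a j : ℂ) * hzeta a (s - j)

/-- The generalized Euler constant `γ(a) = lim_{M→∞} (∑_{m=0}^M 1/(m+a) - log(M+a))`. -/
noncomputable def gammaGen (a : ℝ) : ℝ :=
  limUnder atTop
    (fun M : ℕ => (∑ m ∈ Finset.range (M + 1), 1 / ((m : ℝ) + a)) - Real.log ((M : ℝ) + a))

/-- A nonnegative kernel `κ` of rapid decay whose Fourier transform `η` is smooth, normalised by
`η 0 = 1`, and supported in `[-1/2, 1/2]`. -/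
structure SmoothingKernel (η : ℝ → ℂ) (κ : ℝ → ℝ) : Prop where
  contDiff : ContDiff ℝ (⊤ : ℕ∞) η
  eq_zero : ∀ u : ℝ, 1 / 2 ≤ |u| → η u = 0
  map_zero : η 0 = 1
  nonneg : ∀ y, 0 ≤ κ y
  continuous : Continuous κ
  pos : 0 < κ 0
  decay : ∃ C, ∀ y, κ y ≤ C * ((1 + |y|) ^ 12)⁻¹
  fourier : ∀ u : ℝ, ∫ y, (κ y : ℂ) * cexp (-(y * u : ℝ) * I) = η u

open scoped FourierTransform in
lemma conj_fourier_of_real_even {f : ℝ → ℝ} (hf : ∀ x, f (-x) = f x) (y : ℝ) :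
    (starRingEnd ℂ) (𝓕 (fun x => (f x : ℂ)) y) = 𝓕 (fun x => (f x : ℂ)) y := by
  rw [Real.fourier_eq', ← integral_conj, ← integral_neg_eq_self]
  refine integral_congr_ae (.of_forall fun x => ?_)
  simp [← Complex.exp_conj, hf, map_ofNat (starRingEnd ℂ) 2]

open scoped FourierTransform Convolution in
lemma exists_smoothingKernel : ∃ η κ, SmoothingKernel η κ := by
  let B : ContDiffBump (0 : ℝ) := ⟨1 / 60, 1 / 30, by norm_num, by norm_num⟩
  have hsupp : HasCompactSupport (fun x => (B x : ℂ)) :=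
    B.hasCompactSupport.comp_left (g := fun x : ℝ => (x : ℂ)) (by simp)
  have hsm : ContDiff ℝ (⊤ : ℕ∞) (fun x => (B x : ℂ)) :=
    Complex.ofRealCLM.contDiff.comp B.contDiff
  let f : SchwartzMap ℝ ℂ := hsupp.toSchwartzMap hsm
  have hf : ∀ x, f x = (B x : ℂ) := fun x => rfl
  have hfr : (f : ℝ → ℂ) = fun x => (B x : ℂ) := rfl
  let L := ContinuousLinearMap.mul ℂ ℂ
  let b : SchwartzMap ℝ ℂ := SchwartzMap.convolution L f f
  have hb : ∀ x, b x = ∫ t, f t * f (x - t) := fun x => by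
    simp only [b, SchwartzMap.convolution_apply, convolution_def]; rfl
  set φ : SchwartzMap ℝ ℂ := 𝓕 f with hφ
  have hφ' : ∀ y, φ y = 𝓕 (fun x => (B x : ℂ)) y := fun y => by
    rw [hφ, SchwartzMap.fourier_coe, hfr]
  have hreal : ∀ y, ((φ y).re : ℂ) = φ y := fun y => by
    rw [← Complex.conj_eq_iff_re, hφ']
    exact conj_fourier_of_real_even (fun x => B.neg x) y
  have hFb : ∀ y, 𝓕 (b : ℝ → ℂ) y = φ y * φ y := fun y => by
    rw [← SchwartzMap.fourier_coe]
    simp [b, SchwartzMap.fourier_convolution, hφ, L]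
  have hb0 : ∃ c : ℝ, 0 < c ∧ b 0 = c := by
    refine ⟨∫ t, B t * B t, ?_, ?_⟩
    · refine (Continuous.integral_pos_of_hasCompactSupport_nonneg_nonzero (x := 0)
        (B.continuous.mul B.continuous) ?_ (fun x => mul_nonneg B.nonneg B.nonneg) ?_)
      · exact B.hasCompactSupport.mul_right
      · have := B.pos_of_mem_ball (x := 0) (Metric.mem_ball_self B.rOut_pos)
        positivity
    · rw [hb, ← integral_complex_ofReal]
      refine integral_congr_ae (.of_forall fun x => ?_)
      simp [hf, B.neg]
  obtain ⟨c, hc, hbc⟩ := hb0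
  have hcne : (c : ℂ) ≠ 0 := by exact_mod_cast hc.ne'
  refine ⟨fun u => b (-(u / (2 * Real.pi))) / c, fun y => (φ y).re ^ 2 / c, ?_, ?_, ?_, ?_, ?_,
    ?_, ?_, ?_⟩
  · exact ((b.smooth ⊤).comp (by fun_prop)).div_const _
  · intro u hu
    have : b (-(u / (2 * Real.pi))) = 0 := by
      rw [hb]
      refine integral_eq_zero_of_ae (.of_forall fun t => ?_)
      by_contra h
      have h1 : f t ≠ 0 := fun h' => h (by simp [h'])
      have h2 : f (-(u / (2 * Real.pi)) - t) ≠ 0 := fun h' => h (by simp [h'])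
      have key : ∀ x, f x ≠ 0 → |x| < 1 / 30 := fun x hx => by
        by_contra h'
        exact hx (by rw [hf, B.zero_of_le_dist (by show (1 / 30 : ℝ) ≤ dist x 0; simpa using h')]; simp)
      have h3 := key _ h1
      have h4 := key _ h2
      have h5 : |u / (2 * Real.pi)| < 1 / 15 := by
        have := abs_sub (-(u / (2 * Real.pi)) - t) (-t)
        rw [abs_lt] at h3 h4 ⊢
        constructor <;> linarith [h3.1, h3.2, h4.1, h4.2]
      rw [abs_div, abs_of_pos Real.two_pi_pos, div_lt_iff₀ Real.two_pi_pos] at h5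
      linarith [Real.pi_lt_d2]
    simp [this]
  · simp [hbc, hcne]
  · intro y; positivity
  · exact ((Complex.continuous_re.comp φ.continuous).pow 2).div_const _
  · have : φ 0 = ((∫ t, B t : ℝ) : ℂ) := by
      rw [hφ', Real.fourier_eq', ← integral_complex_ofReal]
      simp
    have h2 : 0 < ∫ t, B t := B.integral_pos
    simp only [this, ofReal_re]
    positivity
  · obtain ⟨C, hC⟩ : ∃ C, ∀ y, (1 + |y|) ^ 6 * ‖φ y‖ ≤ C :=
      ⟨_, fun y => by
        simpa using! SchwartzMap.one_add_le_sup_seminorm_apply (𝕜 := ℝ) (m := (6, 0)) (k := 6)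
          (n := 0) le_rfl le_rfl φ y⟩
    refine ⟨C ^ 2 / c, fun y => ?_⟩
    have h1 : 0 < 1 + |y| := by positivity
    rw [← div_eq_mul_inv, div_right_comm]
    gcongr
    rw [le_div_iff₀ (by positivity)]
    calc (φ y).re ^ 2 * (1 + |y|) ^ 12 ≤ ‖φ y‖ ^ 2 * (1 + |y|) ^ 12 := by
          gcongr ?_ * _
          rw [← sq_abs]
          gcongr
          exact Complex.abs_re_le_norm _
      _ = ((1 + |y|) ^ 6 * ‖φ y‖) ^ 2 := by ring
      _ ≤ C ^ 2 := by gcongr; exact hC y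
  · intro u
    have h := congrFun (Continuous.fourierInv_fourier_eq b.continuous b.integrable
      (by simpa [SchwartzMap.fourier_coe] using (𝓕 b).integrable)) (-(u / (2 * Real.pi)))
    rw [Real.fourierInv_eq'] at h
    rw [← h, ← integral_div]
    refine integral_congr_ae (.of_forall fun y => ?_)
    simp only [hFb, smul_eq_mul]
    rw [← hreal y]
    push_cast
    have : ((2 * Real.pi * inner ℝ y (-(u / (2 * Real.pi))) : ℝ) : ℂ) = -(y * u : ℝ) := by
      rw [← ofReal_neg]
      congr 1
      have := Real.pi_ne_zero
      simp [field]
    push_cast at this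
    rw [this]
    simp only [ofReal_re]
    ring

/-- The functions `F i` have `k` derivatives on `(-1, 1)`, bounded uniformly in `i`. -/
def BddDerivs {ι : Type*} : ℕ → (ι → ℝ → ℂ) → Prop
  | 0, F => (∃ C, ∀ i, ∀ z ∈ Set.Ioo (-1 : ℝ) 1, ‖F i z‖ ≤ C) ∧
      ∀ i, ContinuousOn (F i) (Set.Ioo (-1) 1)
  | k + 1, F => (∃ C, ∀ i, ∀ z ∈ Set.Ioo (-1 : ℝ) 1, ‖F i z‖ ≤ C) ∧
      ∃ F' : ι → ℝ → ℂ, BddDerivs k F' ∧ ∀ i, ∀ z ∈ Set.Ioo (-1 : ℝ) 1, HasDerivAt (F i) (F' i z) z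

namespace BddDerivs

variable {ι : Type*} {k : ℕ} {F H : ι → ℝ → ℂ}

lemma bound (h : BddDerivs k F) : ∃ C, ∀ i, ∀ z ∈ Set.Ioo (-1 : ℝ) 1, ‖F i z‖ ≤ C := by
  cases k <;> exact h.1

lemma continuousOn (h : BddDerivs k F) (i : ι) : ContinuousOn (F i) (Set.Ioo (-1) 1) := by
  cases k with
  | zero => exact h.2 i
  | succ k =>
    obtain ⟨-, F', -, hd⟩ := h
    exact fun z hz => (hd i z hz).continuousAt.continuousWithinAt

lemma of_succ (h : BddDerivs (k + 1) F) : BddDerivs k F := by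
  induction k generalizing F with
  | zero => exact ⟨h.bound, h.continuousOn⟩
  | succ k ih =>
    obtain ⟨hb, F', hF', hd⟩ := h
    exact ⟨hb, F', ih hF', hd⟩

lemma const {c : ι → ℂ} {C : ℝ} (hc : ∀ i, ‖c i‖ ≤ C) : BddDerivs k (fun i _ => c i) := by
  induction k generalizing c C with
  | zero => exact ⟨⟨C, fun i _ _ => hc i⟩, fun i => continuousOn_const⟩
  | succ k ih =>
    exact ⟨⟨C, fun i _ _ => hc i⟩, fun _ _ => 0, ih (c := fun _ => 0) (C := 0) (by simp),
      fun i z _ => hasDerivAt_const z (c i)⟩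

lemma add (hF : BddDerivs k F) (hH : BddDerivs k H) : BddDerivs k (fun i z => F i z + H i z) := by
  have hb : ∃ C, ∀ i, ∀ z ∈ Set.Ioo (-1 : ℝ) 1, ‖F i z + H i z‖ ≤ C := by
    obtain ⟨C, hC⟩ := hF.bound
    obtain ⟨D, hD⟩ := hH.bound
    exact ⟨C + D, fun i z hz => norm_add_le_of_le (hC i z hz) (hD i z hz)⟩
  induction k generalizing F H with
  | zero => exact ⟨hb, fun i => (hF.2 i).add (hH.2 i)⟩
  | succ k ih =>
    obtain ⟨-, F', hF', hFd⟩ := hF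
    obtain ⟨-, H', hH', hHd⟩ := hH
    obtain ⟨C, hC⟩ := hF'.bound
    obtain ⟨D, hD⟩ := hH'.bound
    exact ⟨hb, _, ih hF' hH' ⟨C + D, fun i z hz => norm_add_le_of_le (hC i z hz) (hD i z hz)⟩,
      fun i z hz => (hFd i z hz).add (hHd i z hz)⟩

lemma mul (hF : BddDerivs k F) (hH : BddDerivs k H) : BddDerivs k (fun i z => F i z * H i z) := by
  induction k generalizing F H with
  | zero =>
    obtain ⟨C, hC⟩ := hF.bound
    obtain ⟨D, hD⟩ := hH.bound
    exact ⟨⟨C * D, fun i z hz => norm_mul_le_of_le (hC i z hz) (hD i z hz)⟩,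
      fun i => (hF.2 i).mul (hH.2 i)⟩
  | succ k ih =>
    have hF0 := hF.of_succ
    have hH0 := hH.of_succ
    refine ⟨(ih hF0 hH0).bound, ?_⟩
    obtain ⟨-, F', hF', hFd⟩ := hF
    obtain ⟨-, H', hH', hHd⟩ := hH
    exact ⟨_, (ih hF' hH0).add (ih hF0 hH'), fun i z hz => (hFd i z hz).mul (hHd i z hz)⟩

lemma exp {F' : ι → ℝ → ℂ} (hF' : BddDerivs k F')
    (hd : ∀ i, ∀ z ∈ Set.Ioo (-1 : ℝ) 1, HasDerivAt (F i) (F' i z) z)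
    (hb : ∃ C, ∀ i, ∀ z ∈ Set.Ioo (-1 : ℝ) 1, ‖cexp (F i z)‖ ≤ C) :
    BddDerivs (k + 1) (fun i z => cexp (F i z)) := by
  have hd' : ∀ i, ∀ z ∈ Set.Ioo (-1 : ℝ) 1,
      HasDerivAt (fun z => cexp (F i z)) (cexp (F i z) * F' i z) z :=
    fun i z hz => (hd i z hz).cexp
  induction k with
  | zero =>
    refine ⟨hb, _, mul ⟨hb, fun i z hz => ?_⟩ hF', hd'⟩
    exact (hd' i z hz).continuousAt.continuousWithinAt
  | succ k ih => exact ⟨hb, _, (ih hF'.of_succ).mul hF', hd'⟩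

lemma comp {g : ℝ → ℂ} (hg : ContDiff ℝ (⊤ : ℕ∞) g) {L L' : ι → ℝ → ℝ} {B : ℝ}
    (hL : ∀ i, ∀ z ∈ Set.Ioo (-1 : ℝ) 1, |L i z| ≤ B)
    (hd : ∀ i, ∀ z ∈ Set.Ioo (-1 : ℝ) 1, HasDerivAt (L i) (L' i z) z)
    (hL' : BddDerivs k (fun i z => (L' i z : ℂ))) : BddDerivs k (fun i z => g (L i z)) := by
  have hb : ∀ g : ℝ → ℂ, ContDiff ℝ (⊤ : ℕ∞) g →
      ∃ C, ∀ i, ∀ z ∈ Set.Ioo (-1 : ℝ) 1, ‖g (L i z)‖ ≤ C := fun g hg => by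
    obtain ⟨C, hC⟩ := (isCompact_Icc (a := -B) (b := B)).exists_bound_of_continuousOn
      hg.continuous.continuousOn
    exact ⟨C, fun i z hz => hC _ (abs_le.1 (hL i z hz))⟩
  induction k generalizing g with
  | zero =>
    exact ⟨hb g hg, fun i z hz =>
      (hg.continuous.continuousAt.comp (hd i z hz).continuousAt).continuousWithinAt⟩
  | succ k ih =>
    have hg' : ContDiff ℝ (⊤ : ℕ∞) (deriv g) := ((contDiff_infty_iff_deriv).1 hg).2
    refine ⟨hb g hg, _, hL'.of_succ.mul (ih hg' hL'.of_succ), fun i z hz => ?_⟩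
    have := (hg.differentiable (by simp) (L i z)).hasDerivAt.scomp z (hd i z hz)
    simpa [Function.comp_def] using this

/-- Repeated integration by parts. -/
lemma norm_integral_mul_exp_le {b : ℝ} (hb0 : 0 < b) (hb : b < 1) (hF : BddDerivs k F)
    (hz : ∀ i, ∀ z ∈ Set.Ioo (-1 : ℝ) 1, b ≤ |z| → F i z = 0) :
    ∃ C, ∀ i w, |w| ^ k * ‖∫ z in (-b)..b, F i z * cexp (-(w * z : ℝ) * I)‖ ≤ C := by
  have hsub : Set.uIcc (-b) b ⊆ Set.Ioo (-1 : ℝ) 1 := by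
    rw [Set.uIcc_of_le (by linarith)]
    exact fun z hz => ⟨by linarith [hz.1], by linarith [hz.2]⟩
  have hnorm : ∀ w z : ℝ, ‖cexp (-(w * z : ℝ) * I)‖ = 1 := fun w z => by
    rw [← ofReal_neg, norm_exp_ofReal_mul_I]
  induction k generalizing F with
  | zero =>
    obtain ⟨C, hC⟩ := hF.bound
    refine ⟨C * |b - -b|, fun i w => ?_⟩
    rw [pow_zero, one_mul]
    refine intervalIntegral.norm_integral_le_of_norm_le_const fun z hz => ?_
    rw [norm_mul, hnorm, mul_one]
    exact hC i z (hsub (Set.uIoc_subset_uIcc hz))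
  | succ k ih =>
    obtain ⟨-, F', hF', hd⟩ := hF
    have hz' : ∀ i, ∀ z ∈ Set.Ioo (-1 : ℝ) 1, b ≤ |z| → F' i z = 0 := by
      intro i z hz1 hbz
      have h1 : HasDerivWithinAt (F i) (F' i z) (Set.Ioo (-1 : ℝ) 1 ∩ {z | b ≤ |z|}) z :=
        (hd i z hz1).hasDerivWithinAt
      have h2 : HasDerivWithinAt (F i) 0 (Set.Ioo (-1 : ℝ) 1 ∩ {z | b ≤ |z|}) z :=
        (hasDerivWithinAt_const z _ (0 : ℂ)).congr (fun y hy => hz i y hy.1 hy.2)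
          (hz i z hz1 hbz)
      refine UniqueDiffWithinAt.eq_deriv _ ?_ h1 h2
      rcases le_abs.1 hbz with h | h
      · refine UniqueDiffWithinAt.mono (s := Set.Ico b 1) ?_ ?_
        · exact uniqueDiffOn_Ico b 1 z ⟨h, hz1.2⟩
        · exact fun y hy => ⟨⟨by linarith [hy.1], hy.2⟩, hy.1.trans (le_abs_self y)⟩
      · refine UniqueDiffWithinAt.mono (s := Set.Ioc (-1) (-b)) ?_ ?_
        · exact uniqueDiffOn_Ioc (-1) (-b) z ⟨hz1.1, by linarith⟩
        · exact fun y hy => ⟨⟨hy.1, by linarith [hy.2]⟩,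
            (by linarith [hy.2] : b ≤ -y).trans (neg_le_abs y)⟩
    obtain ⟨C, hC⟩ := ih hF' hz'
    refine ⟨C, fun i w => ?_⟩
    rcases eq_or_ne w 0 with rfl | hw
    · have := (mul_nonneg (by positivity) (norm_nonneg _)).trans (hC i 0)
      simpa using this
    have hw' : (-(w : ℂ) * I) ≠ 0 := by simp [hw]
    have hv : ∀ z ∈ Set.uIcc (-b) b, HasDerivAt
        (fun z : ℝ => cexp (-(w * z : ℝ) * I) / (-(w : ℂ) * I)) (cexp (-(w * z : ℝ) * I)) z := by
      intro z _
      have h1 : HasDerivAt (fun z : ℝ => (-(w * z : ℝ) * I : ℂ)) (-(w : ℂ) * I) z := by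
        have := ((hasDerivAt_id z).ofReal_comp.const_mul (-(w : ℂ) * I))
        simp only [id, ofReal_one, mul_one] at this
        refine this.congr_of_eventuallyEq (.of_forall fun y => ?_)
        push_cast; ring
      have := h1.cexp.div_const (-(w : ℂ) * I)
      rwa [mul_div_cancel_right₀ _ hw'] at this
    have hibp := intervalIntegral.integral_mul_deriv_eq_deriv_mul
      (fun z hz => hd i z (hsub hz)) hv
      ((hF'.continuousOn i).mono hsub).intervalIntegrable
      (Continuous.intervalIntegrable (by fun_prop) _ _)
    have hb1 : F i b = 0 := hz i b ⟨by linarith, hb⟩ (le_abs_self b)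
    have hb2 : F i (-b) = 0 := hz i (-b) ⟨by linarith, by linarith⟩ (by simp [le_abs_self])
    rw [hb1, hb2, zero_mul, zero_mul, sub_zero, zero_sub] at hibp
    simp only [← mul_div_assoc] at hibp
    rw [intervalIntegral.integral_div] at hibp
    rw [hibp, norm_neg, norm_div, norm_mul, norm_neg, norm_I, mul_one, norm_real, Real.norm_eq_abs]
    have hw0 : |w| ≠ 0 := by simpa
    refine le_of_eq_of_le ?_ (hC i w)
    generalize ‖∫ z in (-b)..b, F' i z * cexp (-(w * z : ℝ) * I)‖ = X
    field_simp
    ring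

lemma norm_integral_mul_exp_le' {b : ℝ} (hb0 : 0 < b) (hb : b < 1) (hF : BddDerivs 3 F)
    (hz : ∀ i, ∀ z ∈ Set.Ioo (-1 : ℝ) 1, b ≤ |z| → F i z = 0) :
    ∃ C, 0 < C ∧ ∀ i w, ‖∫ z in (-b)..b, F i z * cexp (-(w * z : ℝ) * I)‖
      ≤ C * ((1 + |w|) ^ 3)⁻¹ := by
  obtain ⟨C, hC⟩ := norm_integral_mul_exp_le hb0 hb hF hz
  obtain ⟨D, hD⟩ := norm_integral_mul_exp_le (k := 0) hb0 hb hF.of_succ.of_succ.of_succ hz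
  refine ⟨max 1 (4 * (C + D)), by positivity, fun i w => ?_⟩
  refine le_trans ?_ (mul_le_mul_of_nonneg_right (le_max_right 1 (4 * (C + D))) (by positivity))
  rw [← div_eq_mul_inv, le_div_iff₀ (by positivity)]
  have h1 := hC i w
  have h2 := hD i w
  rw [pow_zero, one_mul] at h2
  set x := ‖∫ z in (-b)..b, F i z * cexp (-(w * z : ℝ) * I)‖
  have hx : 0 ≤ x := norm_nonneg _
  have hw := abs_nonneg w
  have : (1 + |w|) ^ 3 ≤ 4 * (1 + |w| ^ 3) := by nlinarith [sq_nonneg (|w| - 1)]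
  calc x * (1 + |w|) ^ 3 ≤ x * (4 * (1 + |w| ^ 3)) := by gcongr
    _ = 4 * (|w| ^ 3 * x + x) := by ring
    _ ≤ 4 * (C + D) := by gcongr

end BddDerivs

/-- The function `v ↦ (1 + v) ^ (-1/2 - iτ) * η (G * log (1 + v))`, extended by `0`. -/
noncomputable def logBump (η : ℝ → ℂ) (G τ v : ℝ) : ℂ :=
  if -1 < v then cexp (-(1 / 2 + τ * I) * Real.log (1 + v)) * η (G * Real.log (1 + v)) else 0

/-- The Fourier integral of `logBump`. -/
noncomputable def oscInt (η : ℝ → ℂ) (G τ ξ : ℝ) : ℂ :=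
  ∫ v, logBump η G τ v * cexp (-(ξ * v : ℝ) * I)

section

variable {η : ℝ → ℂ} {κ : ℝ → ℝ}

lemma logBump_of_le {G τ v : ℝ} (hv : v ≤ -1) : logBump η G τ v = 0 := if_neg (by linarith)

lemma logBump_eq_zero (hη : SmoothingKernel η κ) {G τ v : ℝ} (hG : 4 ≤ G) (hv : 3 / 4 ≤ |G * v|) :
    logBump η G τ v = 0 := by
  unfold logBump
  split_ifs with h
  · have h1 : 0 < 1 + v := by linarith
    rw [hη.eq_zero, mul_zero]
    rw [abs_mul, abs_of_pos (by linarith : 0 < G)] at hv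
    rcases le_total 0 v with hv0 | hv0
    · rw [abs_of_nonneg hv0] at hv
      refine le_trans ?_ (le_abs_self _)
      have h2 := Real.one_sub_inv_le_log_of_pos h1
      have h3 : 1 / 2 ≤ G * (1 - (1 + v)⁻¹) := by
        have : G * (1 - (1 + v)⁻¹) = G * v / (1 + v) := by field_simp; ring
        rw [this, div_le_div_iff₀ (by norm_num) h1]
        nlinarith
      exact h3.trans (by gcongr)
    · rw [abs_of_nonpos hv0] at hv
      refine le_trans ?_ (neg_le_abs _)
      have h2 := Real.log_le_sub_one_of_pos h1
      nlinarith
  · rfl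

lemma continuous_logBump (hη : SmoothingKernel η κ) {G : ℝ} (hG : 4 ≤ G) (τ : ℝ) :
    Continuous (logBump η G τ) := by
  rw [continuous_iff_continuousAt]
  intro v
  rcases lt_or_ge (-1 / 2) v with hv | hv
  · have h1 : (1 + v) ≠ 0 := by linarith
    have hη0 := hη.contDiff.continuous
    have : ContinuousAt (fun v : ℝ => cexp (-(1 / 2 + τ * I) * Real.log (1 + v)) *
        η (G * Real.log (1 + v))) v := by
      have hl : ContinuousAt (fun v : ℝ => Real.log (1 + v)) v :=
        (Real.continuousAt_log h1).comp (f := fun v : ℝ => 1 + v) (by fun_prop)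
      refine ContinuousAt.mul ?_ ?_
      · exact (continuousAt_const.mul (continuous_ofReal.continuousAt.comp hl)).cexp
      · exact (hη0.continuousAt).comp (continuousAt_const.mul hl)
    refine this.congr ?_
    filter_upwards [lt_mem_nhds hv] with w hw
    rw [logBump, if_pos (by linarith)]
  · refine (continuousAt_const (y := (0 : ℂ))).congr ?_
    filter_upwards [gt_mem_nhds (show v < -1 / 4 by linarith)] with w hw
    refine (logBump_eq_zero hη hG ?_).symm
    refine le_trans ?_ (neg_le_abs _)
    nlinarith

lemma integral_eq_intervalIntegral_of_eq_zero {f : ℝ → ℂ} {b : ℝ} (hb : 0 < b)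
    (hf : ∀ z, b ≤ |z| → f z = 0) : ∫ z, f z = ∫ z in (-b)..b, f z := by
  rw [intervalIntegral.integral_of_le (by linarith),
    setIntegral_eq_integral_of_forall_compl_eq_zero]
  intro z hz
  refine hf z ?_
  by_contra! h
  rw [abs_lt] at h
  exact hz ⟨h.1, h.2.le⟩

lemma abs_log_one_add_le {x : ℝ} (hx : |x| ≤ 1 / 4) : |Real.log (1 + x)| ≤ 4 / 3 * |x| := by
  have h := abs_le.1 hx
  have h1 : 0 < 1 + x := by linarith [h.1]
  have h2 := Real.one_sub_inv_le_log_of_pos h1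
  have h3 := Real.log_le_sub_one_of_pos h1
  rw [abs_le]
  constructor
  · refine le_trans ?_ h2
    have : 1 - (1 + x)⁻¹ = x / (1 + x) := by field_simp; ring
    rw [this, neg_le, ← neg_div, div_le_iff₀ h1]
    rcases abs_cases x with h' | h' <;> nlinarith
  · linarith [le_abs_self x, abs_nonneg x]

lemma abs_div_le_of_mem_Ioo {G z : ℝ} (hG : 4 ≤ G) (hz : z ∈ Set.Ioo (-1 : ℝ) 1) :
    |z / G| ≤ 1 / 4 := by
  rw [abs_div, abs_of_pos (by linarith : 0 < G), div_le_iff₀ (by linarith)]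
  have := (abs_lt.2 hz)
  linarith

lemma exists_oscInt_bound (hη : SmoothingKernel η κ) : ∃ C, 0 < C ∧ ∀ G τ ξ : ℝ, 4 ≤ G →
    |τ| ≤ 2 * G ^ 2 → ‖oscInt η G τ ξ‖ ≤ C / G * ((1 + |τ + ξ| / G) ^ 3)⁻¹ := by
  let ι := {p : ℝ × ℝ // 4 ≤ p.1 ∧ |p.2| ≤ 2 * p.1 ^ 2}
  have hpos : ∀ i : ι, ∀ z ∈ Set.Ioo (-1 : ℝ) 1, 3 / 4 ≤ 1 + z / i.1.1 := fun i z hz => by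
    linarith [(abs_le.1 (abs_div_le_of_mem_Ioo i.2.1 hz)).1]
  let R : ι → ℝ → ℝ := fun i z => (1 + z / i.1.1)⁻¹
  have hR : ∀ k, BddDerivs k (fun i z => (R i z : ℂ)) := by
    have hd : ∀ i : ι, ∀ z ∈ Set.Ioo (-1 : ℝ) 1, HasDerivAt (fun z => (R i z : ℂ))
        (-(1 / i.1.1 : ℝ) * (R i z * R i z : ℂ)) z := fun i z hz => by
      have h0 := hpos i z hz
      have h1 : HasDerivAt (fun z : ℝ => 1 + z / i.1.1) (1 / i.1.1) z :=
        ((hasDerivAt_id z).div_const _).const_add 1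
      have h2 := (h1.inv (by linarith)).ofReal_comp
      convert! h2 using 1
      simp only [R]
      push_cast
      field_simp
    have hb : ∃ C, ∀ i, ∀ z ∈ Set.Ioo (-1 : ℝ) 1, ‖(R i z : ℂ)‖ ≤ C := ⟨4 / 3, fun i z hz => by
      have h0 := hpos i z hz
      rw [norm_real, Real.norm_eq_abs, abs_of_pos (inv_pos.2 (by linarith)),
        inv_le_comm₀ (by linarith) (by norm_num)]
      linarith⟩
    intro k
    induction k with
    | zero => exact ⟨hb, fun i z hz => (hd i z hz).continuousAt.continuousWithinAt⟩
    | succ k ih =>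
      refine ⟨hb, _, (BddDerivs.const (C := 1) fun i => ?_).mul (ih.mul ih), hd⟩
      have := i.2.1
      rw [norm_neg, norm_real, Real.norm_eq_abs, abs_of_pos (by positivity),
        div_le_one (by linarith)]
      linarith
  let L : ι → ℝ → ℝ := fun i z => i.1.1 * Real.log (1 + z / i.1.1)
  have hl : ∀ i : ι, ∀ z ∈ Set.Ioo (-1 : ℝ) 1,
      HasDerivAt (fun z => Real.log (1 + z / i.1.1)) (1 / i.1.1 * R i z) z := fun i z hz => by
    have h0 := hpos i z hz
    have h1 : HasDerivAt (fun z : ℝ => 1 + z / i.1.1) (1 / i.1.1) z :=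
      ((hasDerivAt_id z).div_const _).const_add 1
    exact h1.log (by linarith)
  have hL : ∀ i, ∀ z ∈ Set.Ioo (-1 : ℝ) 1, HasDerivAt (L i) (R i z) z := fun i z hz => by
    have := (hl i z hz).const_mul i.1.1
    rwa [← mul_assoc, mul_one_div_cancel (by linarith [i.2.1]), one_mul] at this
  have hLb : ∀ i, ∀ z ∈ Set.Ioo (-1 : ℝ) 1, |L i z| ≤ 2 := fun i z hz => by
    have hG := i.2.1
    have h1 := abs_log_one_add_le (abs_div_le_of_mem_Ioo hG hz)
    have h2 := abs_lt.2 hz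
    simp only [L]
    rw [abs_mul, abs_of_pos (by linarith)]
    rw [abs_div, abs_of_pos (by linarith : 0 < i.1.1)] at h1
    calc _ ≤ i.1.1 * (4 / 3 * (|z| / i.1.1)) := by gcongr
      _ = 4 / 3 * |z| := by field_simp
      _ ≤ 2 := by linarith
  let P : ι → ℝ → ℂ := fun i z => -(1 / 2 : ℂ) * Real.log (1 + z / i.1.1) +
    -(i.1.2 * I) * ((Real.log (1 + z / i.1.1) : ℝ) - (z / i.1.1 : ℝ))
  let F : ι → ℝ → ℂ := fun i z => cexp (P i z) * η (L i z)
  have hPd : ∀ i, ∀ z ∈ Set.Ioo (-1 : ℝ) 1, HasDerivAt (P i)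
      ((-(1 / (2 * i.1.1) : ℝ)) * R i z + ((i.1.2 / i.1.1 ^ 2 : ℝ) * I) * (z * R i z)) z := by
    intro i z hz
    have h1 := (hl i z hz).ofReal_comp
    have h2 : HasDerivAt (fun z : ℝ => ((z / i.1.1 : ℝ) : ℂ)) ((1 / i.1.1 : ℝ) : ℂ) z :=
      ((hasDerivAt_id z).div_const _).ofReal_comp
    have h3 := (h1.const_mul (-(1 / 2 : ℂ))).add ((h1.sub h2).const_mul (-(i.1.2 * I : ℂ)))
    refine h3.congr_deriv ?_
    have hR : (R i z : ℂ) = (1 + z / i.1.1 : ℂ)⁻¹ := by simp [R]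
    have h0 : (1 + z / i.1.1 : ℂ) ≠ 0 := by
      have := hpos i z hz
      exact_mod_cast (by linarith : (1 + z / i.1.1) ≠ 0)
    have hG : (i.1.1 : ℂ) ≠ 0 := by exact_mod_cast (by linarith [i.2.1] : i.1.1 ≠ 0)
    have h0' : (i.1.1 + z : ℂ) ≠ 0 := by
      intro h; apply h0; field_simp; rw [h, mul_zero]
    push_cast
    rw [hR]
    field_simp
    ring
  have hP' : ∀ k, BddDerivs k (fun (i : ι) z => (-(1 / (2 * i.1.1) : ℝ) : ℂ) * R i z +
      ((i.1.2 / i.1.1 ^ 2 : ℝ) * I) * (z * R i z)) := by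
    intro k
    refine ((BddDerivs.const (C := 1) fun i => ?_).mul (hR k)).add
      ((BddDerivs.const (C := 2) fun i => ?_).mul (BddDerivs.mul ?_ (hR k)))
    · have := i.2.1
      rw [norm_neg, norm_real, Real.norm_eq_abs, abs_of_pos (by positivity),
        div_le_one (by linarith)]
      linarith
    · have := i.2.1
      rw [norm_mul, norm_I, mul_one, norm_real, Real.norm_eq_abs, abs_div,
        abs_of_pos (by positivity : 0 < i.1.1 ^ 2), div_le_iff₀ (by positivity)]
      exact i.2.2
    · have hb : ∃ C, ∀ (_ : ι), ∀ z ∈ Set.Ioo (-1 : ℝ) 1, ‖(z : ℂ)‖ ≤ C := ⟨1, fun i z hz => by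
        rw [norm_real, Real.norm_eq_abs]; exact (abs_lt.2 hz).le⟩
      cases k with
      | zero => exact ⟨hb, fun i => continuous_ofReal.continuousOn⟩
      | succ k => exact ⟨hb, fun _ _ => 1, BddDerivs.const (c := fun _ => 1) (C := 1) (by simp),
          fun i z _ => by simpa using (hasDerivAt_id z).ofReal_comp⟩
  have hF : BddDerivs 3 F := by
    refine BddDerivs.mul (BddDerivs.exp (hP' 2) hPd ⟨Real.exp 1, fun i z hz => ?_⟩)
      (BddDerivs.comp hη.contDiff hLb hL (hR 3))
    rw [norm_exp]
    gcongr
    have h1 := abs_div_le_of_mem_Ioo i.2.1 hz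
    have h2 := (abs_le.1 (abs_log_one_add_le h1)).1
    simp [P]
    linarith
  have hz : ∀ i, ∀ z ∈ Set.Ioo (-1 : ℝ) 1, 3 / 4 ≤ |z| → F i z = 0 := by
    intro i z hz1 hz
    have hG : 0 < i.1.1 := by linarith [i.2.1]
    have := logBump_eq_zero hη (v := z / i.1.1) (τ := i.1.2) i.2.1
      (by rwa [mul_div_cancel₀ _ hG.ne'])
    rw [logBump, if_pos (by linarith [hpos i z hz1])] at this
    have := (mul_eq_zero.1 this).resolve_left (exp_ne_zero _)
    simp only [F, L, this, mul_zero]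
  obtain ⟨C, hC0, hC⟩ := BddDerivs.norm_integral_mul_exp_le' (by norm_num) (by norm_num) hF hz
  refine ⟨C, hC0, fun G τ ξ hG hτ => ?_⟩
  have hG0 : 0 < G := by linarith
  have h1 : oscInt η G τ ξ = (1 / G : ℝ) *
      ∫ z in (-(3 / 4 : ℝ))..(3 / 4), logBump η G τ (z / G) * cexp (-(ξ * (z / G) : ℝ) * I) := by
    rw [← integral_eq_intervalIntegral_of_eq_zero (by norm_num)
        (fun z hz => by rw [logBump_eq_zero hη hG (by rwa [mul_div_cancel₀ _ hG0.ne']), zero_mul]),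
      Measure.integral_comp_div (fun v => logBump η G τ v * cexp (-(ξ * v : ℝ) * I)),
      abs_of_pos hG0, real_smul, ← mul_assoc, ← ofReal_mul, one_div_mul_cancel hG0.ne', ofReal_one,
      one_mul, oscInt]
  have h2 : ∫ z in (-(3 / 4 : ℝ))..(3 / 4), logBump η G τ (z / G) * cexp (-(ξ * (z / G) : ℝ) * I) =
      ∫ z in (-(3 / 4 : ℝ))..(3 / 4), F ⟨(G, τ), hG, hτ⟩ z *
        cexp (-((τ + ξ) / G * z : ℝ) * I) := by
    refine intervalIntegral.integral_congr fun z hz => ?_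
    rw [Set.uIcc_of_le (by norm_num)] at hz
    have hz1 : z ∈ Set.Ioo (-1 : ℝ) 1 := ⟨by linarith [hz.1], by linarith [hz.2]⟩
    have h3 := hpos ⟨(G, τ), hG, hτ⟩ z hz1
    simp only at h3 ⊢
    rw [logBump, if_pos (by linarith)]
    simp only [F, P, L]
    rw [mul_right_comm, ← Complex.exp_add, mul_right_comm, ← Complex.exp_add]
    congr 2
    push_cast
    ring
  rw [h1, h2, norm_mul, norm_real, Real.norm_eq_abs, abs_of_pos (by positivity)]
  have := hC ⟨(G, τ), hG, hτ⟩ ((τ + ξ) / G)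
  rw [abs_div, abs_of_pos hG0] at this
  calc _ ≤ 1 / G * (C * ((1 + |τ + ξ| / G) ^ 3)⁻¹) := by gcongr
    _ = _ := by ring

end

section

variable {η : ℝ → ℂ} {κ : ℝ → ℝ}

lemma oscInt_eq_integral_exp (G τ ξ : ℝ) : oscInt η G τ ξ =
    ∫ u : ℝ, cexp (u / 2) * η (G * u) * cexp (-(ξ * (Real.exp u - 1) : ℝ) * I) *
      cexp (-(τ * u : ℝ) * I) := by
  have hinj : Set.InjOn (fun u => Real.exp u - 1) (Set.univ : Set ℝ) := fun x _ y _ h =>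
    Real.exp_injective (by simpa using h)
  have himg : (fun u => Real.exp u - 1) '' (Set.univ : Set ℝ) = Set.Ioi (-1) := by
    ext v
    simp only [Set.image_univ, Set.mem_range, Set.mem_Ioi]
    constructor
    · rintro ⟨u, rfl⟩
      linarith [Real.exp_pos u]
    · intro h
      exact ⟨Real.log (1 + v), by rw [Real.exp_log (by linarith)]; ring⟩
  have h := integral_image_eq_integral_abs_deriv_smul (s := Set.univ) (f' := Real.exp)
    MeasurableSet.univ (fun u _ => ((Real.hasDerivAt_exp u).sub_const 1).hasDerivWithinAt)
    hinj (fun v => logBump η G τ v * cexp (-(ξ * v : ℝ) * I))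
  rw [himg, setIntegral_eq_integral_of_forall_compl_eq_zero
    (fun v hv => by rw [logBump_of_le (by simpa using hv), zero_mul])] at h
  rw [oscInt, h, Measure.restrict_univ]
  refine integral_congr_ae (.of_forall fun u => ?_)
  have h1 : (-1 : ℝ) < Real.exp u - 1 := by linarith [Real.exp_pos u]
  simp only [logBump, if_pos h1, add_sub_cancel, Real.log_exp, abs_of_pos (Real.exp_pos u),
    real_smul, ofReal_exp]
  rw [mul_right_comm, ← mul_assoc, ← mul_assoc, ← Complex.exp_add, ← Complex.exp_add,
    mul_right_comm, mul_right_comm (cexp (u / 2 : ℂ)), ← Complex.exp_add, mul_right_comm,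
    ← Complex.exp_add]
  congr 2
  push_cast
  ring

lemma exists_oscInt_bound' (hη : SmoothingKernel η κ) : ∃ C, 0 < C ∧ ∀ G τ ξ : ℝ, 4 ≤ G →
    |ξ| ≤ 4 * G ^ 2 → ‖oscInt η G τ ξ‖ ≤ C / G * ((1 + |τ + ξ| / G) ^ 3)⁻¹ := by
  let ι := {p : ℝ × ℝ // 4 ≤ p.1 ∧ |p.2| ≤ 4 * p.1 ^ 2}
  let D : ι → ℝ → ℝ := fun i z => i.1.1 * (Real.exp (z / i.1.1) - 1)
  have hdiv : ∀ i : ι, ∀ z, HasDerivAt (fun z : ℝ => z / i.1.1) (1 / i.1.1) z := fun i z =>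
    (hasDerivAt_id z).div_const _
  have hle : ∀ i : ι, ‖((1 / i.1.1 : ℝ) : ℂ)‖ ≤ 1 := fun i => by
    have := i.2.1
    rw [norm_real, Real.norm_eq_abs, abs_of_pos (by positivity), div_le_one (by linarith)]
    linarith
  have hE : ∀ k, BddDerivs k (fun (i : ι) z => cexp (z / i.1.1 : ℝ)) := by
    have hb : ∃ C, ∀ i : ι, ∀ z ∈ Set.Ioo (-1 : ℝ) 1, ‖cexp (z / i.1.1 : ℝ)‖ ≤ C :=
      ⟨Real.exp 1, fun i z hz => by
        rw [norm_exp, ofReal_re]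
        gcongr
        linarith [le_abs_self (z / i.1.1), abs_div_le_of_mem_Ioo i.2.1 hz]⟩
    intro k
    cases k with
    | zero => exact ⟨hb, fun i => by fun_prop⟩
    | succ k =>
      exact BddDerivs.exp (BddDerivs.const (C := 1) hle)
        (fun i z _ => (hdiv i z).ofReal_comp) hb
  have hD : ∀ k, BddDerivs k (fun i z => (D i z : ℂ)) := by
    have hb : ∃ C, ∀ i : ι, ∀ z ∈ Set.Ioo (-1 : ℝ) 1, ‖(D i z : ℂ)‖ ≤ C := ⟨2, fun i z hz => by
      have h1 := abs_div_le_of_mem_Ioo i.2.1 hz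
      have h2 := Real.abs_exp_sub_one_le (h1.trans (by norm_num))
      have hG := i.2.1
      rw [norm_real, Real.norm_eq_abs, abs_mul, abs_of_pos (by linarith)]
      rw [abs_div, abs_of_pos (by linarith : 0 < i.1.1)] at h2
      calc _ ≤ i.1.1 * (2 * (|z| / i.1.1)) := by gcongr
        _ = 2 * |z| := by field_simp
        _ ≤ 2 := by linarith [abs_lt.2 hz]⟩
    intro k
    cases k with
    | zero => exact ⟨hb, fun i => by fun_prop⟩
    | succ k =>
      refine ⟨hb, _, hE k, fun i z _ => ?_⟩
      have h1 := (((hdiv i z).exp.sub_const 1).const_mul i.1.1).ofReal_comp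
      refine h1.congr_deriv ?_
      have hG : (i.1.1 : ℂ) ≠ 0 := by exact_mod_cast (by linarith [i.2.1] : i.1.1 ≠ 0)
      push_cast
      field_simp
  let P : ι → ℝ → ℂ := fun i z => (1 / 2 : ℂ) * (z / i.1.1 : ℝ) +
    -(i.1.2 * I) * ((Real.exp (z / i.1.1) - 1 : ℝ) - (z / i.1.1 : ℝ))
  let F : ι → ℝ → ℂ := fun i z => cexp (P i z) * η z
  have hPd : ∀ i, ∀ z ∈ Set.Ioo (-1 : ℝ) 1, HasDerivAt (P i)
      ((1 / 2 : ℂ) * (1 / i.1.1 : ℝ) + (-((i.1.2 / i.1.1 ^ 2 : ℝ) * I)) * D i z) z := by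
    intro i z hz
    have h1 := ((hdiv i z).exp.sub_const 1).ofReal_comp
    have h2 := (hdiv i z).ofReal_comp
    have h3 := (h2.const_mul (1 / 2 : ℂ)).add ((h1.sub h2).const_mul (-(i.1.2 * I : ℂ)))
    refine h3.congr_deriv ?_
    have hG : (i.1.1 : ℂ) ≠ 0 := by exact_mod_cast (by linarith [i.2.1] : i.1.1 ≠ 0)
    simp only [D]
    push_cast
    field_simp
  have hP' : ∀ k, BddDerivs k (fun (i : ι) z =>
      ((1 / 2 : ℂ) * (1 / i.1.1 : ℝ) + (-((i.1.2 / i.1.1 ^ 2 : ℝ) * I)) * D i z)) := by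
    intro k
    refine (BddDerivs.const (C := 1) fun i => ?_).add
      ((BddDerivs.const (C := 4) fun i => ?_).mul (hD k))
    · have := hle i
      rw [norm_mul]
      norm_num at this ⊢
      linarith
    · have := i.2.1
      rw [norm_neg, norm_mul, norm_I, mul_one, norm_real, Real.norm_eq_abs, abs_div,
        abs_of_pos (by positivity : 0 < i.1.1 ^ 2), div_le_iff₀ (by positivity)]
      exact i.2.2
  have hF : BddDerivs 3 F := by
    refine BddDerivs.mul (BddDerivs.exp (hP' 2) hPd ⟨Real.exp 1, fun i z hz => ?_⟩)
      (BddDerivs.comp (L := fun _ z => z) (L' := fun _ _ => 1) (B := 1) hη.contDiff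
      (fun i z hz => (abs_lt.2 hz).le) (fun i z _ => hasDerivAt_id z)
      (BddDerivs.const (c := fun _ => ((1 : ℝ) : ℂ)) (C := 1) (by simp)))
    rw [norm_exp]
    gcongr
    have h1 := (abs_le.1 (abs_div_le_of_mem_Ioo i.2.1 hz)).2
    simp [P, -ofReal_exp]
    linarith
  have hz : ∀ i, ∀ z ∈ Set.Ioo (-1 : ℝ) 1, 3 / 4 ≤ |z| → F i z = 0 := by
    intro i z hz1 hz
    simp only [F, hη.eq_zero z (by linarith), mul_zero]
  obtain ⟨C, hC0, hC⟩ := BddDerivs.norm_integral_mul_exp_le' (by norm_num) (by norm_num) hF hz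
  refine ⟨C, hC0, fun G τ ξ hG hξ => ?_⟩
  have hG0 : 0 < G := by linarith
  have h1 : oscInt η G τ ξ = (1 / G : ℝ) * ∫ z in (-(3 / 4 : ℝ))..(3 / 4),
      cexp ((z / G : ℝ) / 2) * η (G * (z / G)) * cexp (-(ξ * (Real.exp (z / G) - 1) : ℝ) * I) *
      cexp (-(τ * (z / G) : ℝ) * I) := by
    rw [← integral_eq_intervalIntegral_of_eq_zero (by norm_num)
        (fun z hz => by
          rw [hη.eq_zero (G * (z / G)) (by rw [mul_div_cancel₀ _ hG0.ne']; linarith),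
            mul_zero, zero_mul, zero_mul]),
      Measure.integral_comp_div (fun u : ℝ => cexp (u / 2) * η (G * u) *
        cexp (-(ξ * (Real.exp u - 1) : ℝ) * I) * cexp (-(τ * u : ℝ) * I)),
      abs_of_pos hG0, real_smul, ← mul_assoc, ← ofReal_mul, one_div_mul_cancel hG0.ne', ofReal_one,
      one_mul, oscInt_eq_integral_exp]
  have h2 : ∫ z in (-(3 / 4 : ℝ))..(3 / 4),
      cexp ((z / G : ℝ) / 2) * η (G * (z / G)) * cexp (-(ξ * (Real.exp (z / G) - 1) : ℝ) * I) *
      cexp (-(τ * (z / G) : ℝ) * I) =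
      ∫ z in (-(3 / 4 : ℝ))..(3 / 4), F ⟨(G, ξ), hG, hξ⟩ z *
        cexp (-((τ + ξ) / G * z : ℝ) * I) := by
    refine intervalIntegral.integral_congr fun z hz => ?_
    simp only [F, P]
    rw [mul_div_cancel₀ _ hG0.ne']
    have key : ∀ a b c p q e : ℂ, a + b + c = p + q →
        cexp a * e * cexp b * cexp c = cexp p * e * cexp q := fun a b c p q e h => by
      rw [mul_right_comm _ e, mul_right_comm _ e, mul_right_comm _ e, ← Complex.exp_add,
        ← Complex.exp_add, ← Complex.exp_add, h]
    refine key _ _ _ _ _ _ ?_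
    push_cast
    ring
  rw [h1, h2, norm_mul, norm_real, Real.norm_eq_abs, abs_of_pos (by positivity)]
  have := hC ⟨(G, ξ), hG, hξ⟩ ((τ + ξ) / G)
  rw [abs_div, abs_of_pos hG0] at this
  calc _ ≤ 1 / G * (C * ((1 + |τ + ξ| / G) ^ 3)⁻¹) := by gcongr
    _ = _ := by ring

open scoped FourierTransform in
lemma oscInt_eq_fourier (G τ ξ : ℝ) : oscInt η G τ ξ = 𝓕 (fun u : ℝ => cexp (u / 2) * η (G * u) *
    cexp (-(ξ * (Real.exp u - 1) : ℝ) * I)) (τ / (2 * Real.pi)) := by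
  rw [oscInt_eq_integral_exp, Real.fourier_eq']
  refine integral_congr_ae (.of_forall fun u => ?_)
  simp only [smul_eq_mul]
  rw [mul_comm]
  congr 3
  rw [← ofReal_neg]
  congr 1
  have := Real.pi_ne_zero
  simp [field]

lemma continuous_expBump (hη : SmoothingKernel η κ) (G ξ : ℝ) : Continuous
    (fun u : ℝ => cexp (u / 2) * η (G * u) * cexp (-(ξ * (Real.exp u - 1) : ℝ) * I)) := by
  have := hη.contDiff.continuous
  fun_prop

lemma integrable_expBump (hη : SmoothingKernel η κ) {G : ℝ} (hG : 4 ≤ G) (ξ : ℝ) : Integrable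
    (fun u : ℝ => cexp (u / 2) * η (G * u) * cexp (-(ξ * (Real.exp u - 1) : ℝ) * I)) := by
  refine (continuous_expBump hη G ξ).integrable_of_hasCompactSupport ?_
  refine HasCompactSupport.intro (isCompact_Icc (a := -1) (b := 1)) fun u hu => ?_
  rw [hη.eq_zero, mul_zero, zero_mul]
  have : 1 ≤ |u| := by
    by_contra! h
    exact hu (abs_le.1 h.le)
  rw [abs_mul, abs_of_pos (by linarith)]
  nlinarith

lemma continuous_oscInt (hη : SmoothingKernel η κ) {G : ℝ} (hG : 4 ≤ G) (ξ : ℝ) :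
    Continuous (fun τ => oscInt η G τ ξ) := by
  simp only [oscInt_eq_integral_exp]
  refine continuous_of_dominated (fun τ => ?_) (fun τ => .of_forall fun u => ?_)
    (integrable_expBump hη hG ξ).norm (.of_forall fun u => by fun_prop)
  · exact ((continuous_expBump hη G ξ).mul (by fun_prop)).aestronglyMeasurable
  · rw [norm_mul _ (cexp (-(τ * u : ℝ) * I)), ← ofReal_neg (τ * u), norm_exp_ofReal_mul_I, mul_one]

lemma integrableOn_inv_cube_Ioi {G a ξ : ℝ} (hG : 0 < G) (ha : 0 ≤ a + ξ) :
    IntegrableOn (fun τ => ((1 + |τ + ξ| / G) ^ 3)⁻¹) (Set.Ioi a) ∧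
    ∫ τ in Set.Ioi a, ((1 + |τ + ξ| / G) ^ 3)⁻¹ = G / 2 * ((1 + |a + ξ| / G) ^ 2)⁻¹ := by
  have hd : ∀ τ ∈ Set.Ici a, HasDerivAt (fun τ => -(G / 2) * ((1 + (τ + ξ) / G) ^ 2)⁻¹)
      ((1 + (τ + ξ) / G) ^ 3)⁻¹ τ := fun τ hτ => by
    have hp : 0 < 1 + (τ + ξ) / G := by
      have : 0 ≤ τ + ξ := by linarith [Set.mem_Ici.1 hτ]
      positivity
    have h1 : HasDerivAt (fun τ => 1 + (τ + ξ) / G) (1 / G) τ :=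
      (((hasDerivAt_id τ).add_const ξ).div_const G).const_add 1
    have h2 := ((h1.pow 2).inv (pow_ne_zero 2 hp.ne')).const_mul (-(G / 2))
    refine h2.congr_deriv ?_
    simp only [Pi.pow_apply]
    generalize 1 + (τ + ξ) / G = w at hp
    field_simp
    norm_num
  have ht : Tendsto (fun τ => -(G / 2) * ((1 + (τ + ξ) / G) ^ 2)⁻¹) atTop (nhds 0) := by
    rw [← mul_zero (-(G / 2))]
    refine Tendsto.const_mul _ (Tendsto.inv_tendsto_atTop ?_)
    refine (tendsto_pow_atTop (by norm_num)).comp ?_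
    exact tendsto_atTop_add_const_left _ _
      ((tendsto_atTop_add_const_right _ _ tendsto_id).atTop_div_const hG)
  have hpos : ∀ τ ∈ Set.Ioi a, 0 ≤ ((1 + (τ + ξ) / G) ^ 3)⁻¹ := fun τ hτ => by
    have : 0 ≤ τ + ξ := by linarith [Set.mem_Ioi.1 hτ]
    positivity
  have hcongr : ∀ τ ∈ Set.Ioi a, ((1 + (τ + ξ) / G) ^ 3)⁻¹ = ((1 + |τ + ξ| / G) ^ 3)⁻¹ :=
    fun τ hτ => by rw [abs_of_nonneg (by linarith [Set.mem_Ioi.1 hτ])]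
  constructor
  · refine IntegrableOn.congr_fun ?_ hcongr measurableSet_Ioi
    exact integrableOn_Ioi_deriv_of_nonneg' hd hpos ht
  · rw [← setIntegral_congr_fun measurableSet_Ioi hcongr,
      integral_Ioi_of_hasDerivAt_of_nonneg' hd hpos ht, abs_of_nonneg ha]
    ring

lemma integrableOn_inv_cube_Iic {G a ξ : ℝ} (hG : 0 < G) (ha : a + ξ ≤ 0) :
    IntegrableOn (fun τ => ((1 + |τ + ξ| / G) ^ 3)⁻¹) (Set.Iic a) ∧
    ∫ τ in Set.Iic a, ((1 + |τ + ξ| / G) ^ 3)⁻¹ = G / 2 * ((1 + |a + ξ| / G) ^ 2)⁻¹ := by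
  obtain ⟨h1, h2⟩ := integrableOn_inv_cube_Ioi (a := -a) (ξ := -ξ) hG (by linarith)
  have h3 : ∀ τ : ℝ, |-τ + -ξ| = |τ + ξ| := fun τ => by rw [← abs_neg]; ring_nf
  constructor
  · rw [← integrableOn_Ici_iff_integrableOn_Ioi] at h1
    simpa [h3] using h1.comp_neg_Iic
  · have := integral_comp_neg_Iic a (fun τ => ((1 + |τ + -ξ| / G) ^ 3)⁻¹)
    simp only [h3] at this
    rw [this, h2, h3]

end

section

variable {η : ℝ → ℂ} {κ : ℝ → ℝ}

lemma norm_setIntegral_le_of_le_inv_cube {f : ℝ → ℂ} {C G ξ a : ℝ} (hG : 0 < G) {S : Set ℝ}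
    (hS : S ⊆ Set.Ioi a ∧ 0 ≤ a + ξ ∨ S ⊆ Set.Iic a ∧ a + ξ ≤ 0) (hSm : MeasurableSet S)
    (hf : ∀ τ ∈ S, ‖f τ‖ ≤ C / G * ((1 + |τ + ξ| / G) ^ 3)⁻¹) (hC : 0 ≤ C) :
    ‖∫ τ in S, f τ‖ ≤ C * ((1 + |a + ξ| / G) ^ 2)⁻¹ := by
  have key : ∀ S' : Set ℝ, S ⊆ S' → MeasurableSet S' →
      IntegrableOn (fun τ => ((1 + |τ + ξ| / G) ^ 3)⁻¹) S' →
      ∫ τ in S', ((1 + |τ + ξ| / G) ^ 3)⁻¹ = G / 2 * ((1 + |a + ξ| / G) ^ 2)⁻¹ →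
      ‖∫ τ in S, f τ‖ ≤ C * ((1 + |a + ξ| / G) ^ 2)⁻¹ := by
    intro S' hSS hm hi he
    calc ‖∫ τ in S, f τ‖ ≤ ∫ τ in S, C / G * ((1 + |τ + ξ| / G) ^ 3)⁻¹ :=
          norm_integral_le_of_norm_le ((hi.mono_set hSS).const_mul _)
            ((ae_restrict_iff' hSm).2 (.of_forall hf))
      _ ≤ ∫ τ in S', C / G * ((1 + |τ + ξ| / G) ^ 3)⁻¹ :=
          setIntegral_mono_set (hi.const_mul _) (.of_forall fun τ => by positivity)
            (.of_forall hSS)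
      _ = C / 2 * ((1 + |a + ξ| / G) ^ 2)⁻¹ := by
          rw [integral_const_mul, he]
          field_simp
      _ ≤ C * ((1 + |a + ξ| / G) ^ 2)⁻¹ := by gcongr; linarith
  rcases hS with ⟨h1, h2⟩ | ⟨h1, h2⟩
  · obtain ⟨hi, he⟩ := integrableOn_inv_cube_Ioi hG h2
    exact key _ h1 measurableSet_Ioi hi he
  · obtain ⟨hi, he⟩ := integrableOn_inv_cube_Iic hG h2
    exact key _ h1 measurableSet_Iic hi he

lemma integrable_oscInt (hη : SmoothingKernel η κ) {G ξ : ℝ} (hG : 4 ≤ G) (hξ : |ξ| ≤ 4 * G ^ 2) :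
    Integrable (fun τ => oscInt η G τ ξ) := by
  obtain ⟨C, hC0, hC⟩ := exists_oscInt_bound' hη
  have hi : Integrable (fun τ => ((1 + |τ + ξ| / G) ^ 3)⁻¹) := by
    rw [← integrableOn_univ, ← Set.Iic_union_Ioi (a := -ξ)]
    exact (integrableOn_inv_cube_Iic (by linarith) (by simp)).1.union
      (integrableOn_inv_cube_Ioi (by linarith) (by simp)).1
  exact (hi.const_mul (C / G)).mono' (continuous_oscInt hη hG ξ).aestronglyMeasurable
    (.of_forall fun τ => hC G τ ξ hG hξ)

open scoped FourierTransform in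
lemma integral_oscInt (hη : SmoothingKernel η κ) {G ξ : ℝ} (hG : 4 ≤ G) (hξ : |ξ| ≤ 4 * G ^ 2) :
    ∫ τ, oscInt η G τ ξ = 2 * Real.pi := by
  set B := fun u : ℝ => cexp (u / 2) * η (G * u) * cexp (-(ξ * (Real.exp u - 1) : ℝ) * I) with hB
  have hF : ∀ y, 𝓕 B y = oscInt η G (y * (2 * Real.pi)) ξ := fun y => by
    rw [oscInt_eq_fourier, mul_div_cancel_right₀ _ Real.two_pi_pos.ne']
  have hi : Integrable (𝓕 B) := by
    rw [funext hF]
    exact (integrable_oscInt hη hG hξ).comp_mul_right' Real.two_pi_pos.ne'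
  have h := congrFun (Continuous.fourierInv_fourier_eq (continuous_expBump hη G ξ)
    (integrable_expBump hη hG ξ) hi) 0
  rw [Real.fourierInv_eq'] at h
  simp only [← hB, hF, inner_zero_right, mul_zero, ofReal_zero, zero_mul, Complex.exp_zero,
    one_smul] at h
  rw [Measure.integral_comp_mul_right (fun y => oscInt η G y ξ), abs_of_pos (by positivity)] at h
  simp [hη.map_zero] at h
  have hpi : (Real.pi : ℂ) ≠ 0 := by exact_mod_cast Real.pi_ne_zero
  field_simp at h
  rw [h, mul_comm]

lemma exists_integral_oscInt_bound (hη : SmoothingKernel η κ) : ∃ C, 0 < C ∧ ∀ G T ξ : ℝ, 4 ≤ G →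
    0 ≤ T → T ≤ 2 * G ^ 2 →
    ‖(∫ τ in (0 : ℝ)..T, oscInt η G τ ξ) - if 0 ≤ -ξ ∧ -ξ ≤ T then 2 * Real.pi else 0‖ ≤
      C * (((1 + |T + ξ| / G) ^ 2)⁻¹ + ((1 + |ξ| / G) ^ 2)⁻¹) := by
  obtain ⟨C₁, hC₁, h₁⟩ := exists_oscInt_bound hη
  obtain ⟨C₂, hC₂, h₂⟩ := exists_oscInt_bound' hη
  refine ⟨C₁ + C₂, by positivity, fun G T ξ hG hT hTG => ?_⟩
  have hG0 : 0 < G := by linarith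
  have hx : 0 ≤ ((1 + |T + ξ| / G) ^ 2)⁻¹ := by positivity
  have hy : 0 ≤ ((1 + |ξ| / G) ^ 2)⁻¹ := by positivity
  have hb : ∀ τ ∈ Set.Ioc 0 T, ‖oscInt η G τ ξ‖ ≤ C₁ / G * ((1 + |τ + ξ| / G) ^ 3)⁻¹ :=
    fun τ hτ => h₁ G τ ξ hG (by rw [abs_of_pos hτ.1]; linarith [hτ.2])
  rw [intervalIntegral.integral_of_le hT]
  split_ifs with h
  · have hξ : |ξ| ≤ 4 * G ^ 2 := by rw [abs_le]; constructor <;> nlinarith [h.1, h.2]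
    have hi := integrable_oscInt hη hG hξ
    have e1 := norm_setIntegral_le_of_le_inv_cube hG0 (S := Set.Iic 0) (a := 0)
      (Or.inr ⟨le_rfl, by linarith [h.1]⟩) measurableSet_Iic (fun τ _ => h₂ G τ ξ hG hξ) hC₂.le
    have e2 := norm_setIntegral_le_of_le_inv_cube hG0 (S := Set.Ioi T) (a := T)
      (Or.inl ⟨le_rfl, by linarith [h.2]⟩) measurableSet_Ioi (fun τ _ => h₂ G τ ξ hG hξ) hC₂.le
    have e3 : ∫ τ, oscInt η G τ ξ = (∫ τ in Set.Iic 0, oscInt η G τ ξ) +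
        ((∫ τ in Set.Ioc 0 T, oscInt η G τ ξ) + ∫ τ in Set.Ioi T, oscInt η G τ ξ) := by
      rw [← setIntegral_union (by simp) measurableSet_Ioi hi.integrableOn hi.integrableOn,
        Set.Ioc_union_Ioi_eq_Ioi hT, intervalIntegral.integral_Iic_add_Ioi hi.integrableOn
        hi.integrableOn]
    rw [integral_oscInt hη hG hξ] at e3
    have e4 : (∫ τ in Set.Ioc 0 T, oscInt η G τ ξ) - ((2 * Real.pi : ℝ) : ℂ) =
        -((∫ τ in Set.Iic 0, oscInt η G τ ξ) + ∫ τ in Set.Ioi T, oscInt η G τ ξ) := by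
      push_cast
      rw [e3]
      ring
    push_cast at e4 ⊢
    rw [e4, norm_neg]
    refine (norm_add_le _ _).trans ?_
    rw [zero_add] at e1
    nlinarith
  · rw [ofReal_zero, sub_zero]
    rw [not_and_or, not_le, not_le] at h
    rcases h with h | h
    · have := norm_setIntegral_le_of_le_inv_cube hG0 (S := Set.Ioc 0 T) (a := 0)
        (Or.inl ⟨fun τ hτ => hτ.1, by linarith⟩) measurableSet_Ioc hb hC₁.le
      rw [zero_add] at this
      nlinarith
    · have := norm_setIntegral_le_of_le_inv_cube hG0 (S := Set.Ioc 0 T) (a := T)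
        (Or.inr ⟨fun τ hτ => hτ.2, by linarith⟩) measurableSet_Ioc hb hC₁.le
      nlinarith

end

/-- The majorant `(1 + |x|)⁻²`. -/
noncomputable def invSq (x : ℝ) : ℝ := ((1 + |x|) ^ 2)⁻¹

lemma invSq_nonneg (x : ℝ) : 0 ≤ invSq x := by unfold invSq; positivity

lemma invSq_neg (x : ℝ) : invSq (-x) = invSq x := by simp [invSq]

lemma invSq_le_of_abs_le {x y : ℝ} (h : |y| ≤ |x|) : invSq x ≤ invSq y := by
  unfold invSq; gcongr

lemma sum_invSq_mul_le {δ : ℝ} (hδ : 0 < δ) (N : ℕ) :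
    ∑ k ∈ range N, invSq (δ * k) ≤ 1 + 1 / δ := by
  have h : ∀ N : ℕ, ∑ k ∈ range (N + 1), invSq (δ * k) ≤ 1 + 1 / δ - 1 / δ * (1 + δ * N)⁻¹ := by
    intro N
    induction N with
    | zero => simp [invSq]
    | succ N ih =>
      rw [sum_range_succ]
      have h1 : (0 : ℝ) ≤ N := N.cast_nonneg
      have : invSq (δ * (N + 1 : ℕ)) ≤ 1 / δ * (1 + δ * N)⁻¹ - 1 / δ * (1 + δ * (N + 1 : ℕ))⁻¹ := by
        have e : 1 / δ * (1 + δ * N)⁻¹ - 1 / δ * (1 + δ * (N + 1 : ℕ))⁻¹ =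
            ((1 + δ * N) * (1 + δ * (N + 1 : ℕ)))⁻¹ := by
          push_cast
          field_simp
          ring
        rw [e, invSq, abs_of_nonneg (by positivity), sq]
        push_cast
        gcongr
        linarith
      linarith
  cases N with
  | zero => simp; positivity
  | succ N =>
    refine (h N).trans ?_
    have : 0 ≤ 1 / δ * (1 + δ * N)⁻¹ := by positivity
    linarith

lemma tsum_ofReal_invSq_mul_le {δ : ℝ} (hδ : 0 < δ) :
    ∑' k : ℕ, ENNReal.ofReal (invSq (δ * k)) ≤ ENNReal.ofReal (1 + 1 / δ) := by
  refine ENNReal.tsum_le_of_sum_range_le fun N => ?_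
  rw [← ENNReal.ofReal_sum_of_nonneg fun i _ => invSq_nonneg _]
  exact ENNReal.ofReal_le_ofReal (sum_invSq_mul_le hδ N)

lemma tsum_int_ofReal_invSq_le {δ : ℝ} (hδ : 0 < δ) (y : ℝ) :
    ∑' k : ℤ, ENNReal.ofReal (invSq (y + δ * k)) ≤ ENNReal.ofReal (2 + 2 / δ) := by
  set m := ⌊y / δ⌋ with hm
  have h0 := Int.floor_le (y / δ)
  have h1 := Int.lt_floor_add_one (y / δ)
  rw [← hm, le_div_iff₀ hδ] at h0
  rw [← hm, div_lt_iff₀ hδ] at h1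
  rw [← (Equiv.subRight m).tsum_eq (fun k : ℤ => ENNReal.ofReal (invSq (y + δ * k))),
    tsum_of_nat_of_neg_add_one ENNReal.summable ENNReal.summable]
  have e : ENNReal.ofReal (2 + 2 / δ) = ENNReal.ofReal (1 + 1 / δ) + ENNReal.ofReal (1 + 1 / δ) := by
    rw [← ENNReal.ofReal_add (by positivity) (by positivity)]
    congr 1
    ring
  rw [e]
  refine add_le_add (le_trans ?_ (tsum_ofReal_invSq_mul_le hδ))
    (le_trans ?_ (tsum_ofReal_invSq_mul_le hδ)) <;>
  refine ENNReal.tsum_le_tsum fun k => ENNReal.ofReal_le_ofReal (invSq_le_of_abs_le ?_)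
  · simp only [Equiv.subRight_apply, Int.cast_sub, Int.cast_natCast]
    rw [abs_of_nonneg (by positivity)]
    refine le_trans ?_ (le_abs_self _)
    linarith
  · simp only [Equiv.subRight_apply, Int.cast_sub, Int.cast_natCast, Int.cast_neg, Int.cast_add,
      Int.cast_one]
    rw [abs_of_nonneg (by positivity)]
    refine le_trans ?_ (neg_le_abs _)
    linarith

lemma tsum_nat_ofReal_invSq_le {δ : ℝ} (hδ : 0 < δ) (y : ℝ) :
    ∑' k : ℕ, ENNReal.ofReal (invSq (y + δ * k)) ≤ ENNReal.ofReal (2 + 2 / δ) := by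
  refine le_trans ?_ (tsum_int_ofReal_invSq_le hδ y)
  simpa using ENNReal.tsum_comp_le_tsum_of_injective Nat.cast_injective
    (fun k : ℤ => ENNReal.ofReal (invSq (y + δ * k)))

lemma sum_range_inv_succ_le (N : ℕ) :
    ∑ k ∈ range N, ((k : ℝ) + 1)⁻¹ ≤ 1 + Real.log N := by
  have := harmonic_le_one_add_log N
  simpa [harmonic] using this

lemma sum_range_inv_add_le {a : ℝ} (ha : 0 < a) (N : ℕ) :
    ∑ n ∈ range (N + 1), ((n : ℝ) + a)⁻¹ ≤ a⁻¹ + 1 + Real.log N := by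
  rw [sum_range_succ']
  have : ∑ n ∈ range N, (((n + 1 : ℕ) : ℝ) + a)⁻¹ ≤ ∑ n ∈ range N, ((n : ℝ) + 1)⁻¹ := by
    refine sum_le_sum fun n _ => inv_anti₀ (by positivity) ?_
    push_cast
    linarith
  have := sum_range_inv_succ_le N
  simp only [Nat.cast_zero, zero_add]
  linarith

lemma tsum_ite_lt_eq_sum_range (N : ℕ) (f : ℕ → ENNReal) :
    ∑' n, (if n < N then f n else 0) = ∑ n ∈ range N, f n := by
  rw [tsum_eq_sum (s := range N) (fun n hn => if_neg (by simpa using hn))]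
  exact sum_congr rfl fun n hn => if_pos (by simpa using hn)

lemma exists_tsum_invSq_lattice_le {a : ℝ} (ha : 0 < a) : ∃ C, 0 < C ∧ ∀ G τ : ℝ, 4 ≤ G →
    |τ| ≤ 2 * G ^ 2 → ∑' n : ℕ, ∑' k : ℕ,
      ENNReal.ofReal (invSq ((τ + 2 * Real.pi * (k + 1) * (n + a)) / G)) ≤
        ENNReal.ofReal (C * (G * Real.log G)) := by
  refine ⟨3 * a⁻¹ + 75, by positivity, fun G τ hG hτ => ?_⟩
  have hG0 : 0 < G := by linarith
  have hpi := Real.pi_gt_three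
  set K := ⌈G⌉₊ with hK
  have hK1 : G ≤ K := Nat.le_ceil G
  have hK2 : (K : ℝ) ≤ G + 1 := (Nat.ceil_lt_add_one hG0.le).le
  have hlogK : Real.log K ≤ Real.log G + 1 := by
    have : (K : ℝ) ≤ G * Real.exp 1 := by nlinarith [Real.add_one_le_exp 1]
    calc Real.log K ≤ Real.log (G * Real.exp 1) :=
          Real.log_le_log (by linarith) this
      _ = _ := by rw [Real.log_mul hG0.ne' (Real.exp_ne_zero _), Real.log_exp]
  have hlog1 : 1 ≤ Real.log G := by
    rw [Real.le_log_iff_exp_le hG0]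
    linarith [Real.exp_one_lt_d9]
  let t : ℕ → ℕ → ENNReal := fun n k =>
    ENNReal.ofReal (invSq ((τ + 2 * Real.pi * (k + 1) * (n + a)) / G))
  have hA : ∀ n : ℕ, ∑' k, t n k ≤ ENNReal.ofReal (2 + G * ((n : ℝ) + a)⁻¹) := by
    intro n
    have hδ : 0 < 2 * Real.pi * (n + a) / G := by positivity
    calc ∑' k, t n k = ∑' k : ℕ, ENNReal.ofReal (invSq ((τ + 2 * Real.pi * (n + a)) / G +
          2 * Real.pi * (n + a) / G * k)) := by
          refine tsum_congr fun k => ?_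
          simp only [t]
          congr 2
          ring
      _ ≤ _ := tsum_nat_ofReal_invSq_le hδ _
      _ ≤ _ := by
          refine ENNReal.ofReal_le_ofReal ?_
          have : 2 / (2 * Real.pi * (n + a) / G) = (1 / Real.pi) * (G * ((n : ℝ) + a)⁻¹) := by
            field_simp
          rw [this]
          have h2 : 1 / Real.pi ≤ 1 := by rw [div_le_one (by linarith)]; linarith
          have h3 : 0 ≤ G * ((n : ℝ) + a)⁻¹ := by positivity
          nlinarith
  have hB : ∀ k : ℕ, ∑' n, t n k ≤ ENNReal.ofReal (2 + G * ((k : ℝ) + 1)⁻¹) := by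
    intro k
    have hδ : 0 < 2 * Real.pi * (k + 1) / G := by positivity
    calc ∑' n, t n k = ∑' n : ℕ, ENNReal.ofReal (invSq ((τ + 2 * Real.pi * (k + 1) * a) / G +
          2 * Real.pi * (k + 1) / G * n)) := by
          refine tsum_congr fun n => ?_
          simp only [t]
          congr 2
          ring
      _ ≤ _ := tsum_nat_ofReal_invSq_le hδ _
      _ ≤ _ := by
          refine ENNReal.ofReal_le_ofReal ?_
          have : 2 / (2 * Real.pi * (k + 1) / G) = (1 / Real.pi) * (G * ((k : ℝ) + 1)⁻¹) := by
            field_simp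
          rw [this]
          have h2 : 1 / Real.pi ≤ 1 := by rw [div_le_one (by linarith)]; linarith
          have h3 : 0 ≤ G * ((k : ℝ) + 1)⁻¹ := by positivity
          nlinarith
  let v : ℕ → ENNReal := fun k => ENNReal.ofReal (4 * invSq ((1 : ℝ) * k))
  let u : ℕ → ENNReal := fun n => ENNReal.ofReal (invSq (G⁻¹ * n))
  have hpt : ∀ n k, t n k ≤ (if n < K + 1 then t n k else 0) + (if k < K then t n k else 0) +
      v k * u n := by
    intro n k
    split_ifs with h1 h2 h2
    · exact le_add_right (le_add_right le_rfl)
    · exact le_add_right (le_add_right le_rfl)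
    · exact le_add_right (le_add_left le_rfl)
    · rw [zero_add, zero_add]
      simp only [t, v, u]
      rw [← ENNReal.ofReal_mul (by have := invSq_nonneg ((1 : ℝ) * k); positivity)]
      refine ENNReal.ofReal_le_ofReal ?_
      have hn : G ≤ n := hK1.trans (by exact_mod_cast (by omega : K ≤ n))
      have hk : G ≤ k := hK1.trans (by exact_mod_cast (by omega : K ≤ k))
      have hnk : G * G ≤ (k + 1) * n := by nlinarith
      have h5 : (k + 1) * (n : ℝ) / G * 2 ≤
          |(τ + 2 * Real.pi * (k + 1) * (n + a)) / G| := by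
        rw [abs_div, abs_of_pos hG0, div_mul_eq_mul_div]
        gcongr
        refine le_trans ?_ (le_abs_self _)
        have h6 := (abs_le.1 hτ).1
        have h7 : 2 * 3 * ((k + 1) * (n : ℝ)) ≤ 2 * Real.pi * (k + 1) * (n + a) := by
          calc 2 * 3 * ((k + 1) * (n : ℝ)) = 2 * 3 * (k + 1) * n := by ring
            _ ≤ _ := by gcongr; linarith
        nlinarith
      have h6 : (1 + (n : ℝ) / G) * (1 + k) ≤
          2 * |(τ + 2 * Real.pi * (k + 1) * (n + a)) / G| := by
        refine le_trans ?_ (mul_le_mul_of_nonneg_left h5 (by norm_num))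
        have : 1 ≤ (n : ℝ) / G := by rwa [le_div_iff₀ hG0, one_mul]
        have h8 : (k + 1) * (n : ℝ) / G = (k + 1) * ((n : ℝ) / G) := by ring
        rw [h8]
        nlinarith
      set X := |(τ + 2 * Real.pi * (k + 1) * (n + a)) / G| with hX
      have hXpos : 0 ≤ X := abs_nonneg _
      rw [invSq, ← hX, invSq, invSq, one_mul, abs_of_nonneg (by positivity : (0 : ℝ) ≤ k),
        abs_of_nonneg (by positivity : 0 ≤ G⁻¹ * n), mul_assoc, ← mul_inv, ← mul_pow]
      have h9 : 0 < (1 + (k : ℝ)) * (1 + G⁻¹ * n) := by positivity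
      rw [inv_le_comm₀ (by positivity) (by positivity), mul_inv, inv_inv]
      have h10 : (1 + (k : ℝ)) * (1 + G⁻¹ * n) ≤ 2 * (1 + X) := by
        have : (1 + (k : ℝ)) * (1 + G⁻¹ * n) = (1 + (n : ℝ) / G) * (1 + k) := by ring
        rw [this]
        linarith
      nlinarith
  have hsum : ∑' n, ∑' k, t n k ≤ (∑ n ∈ range (K + 1), ∑' k, t n k) +
      (∑ k ∈ range K, ∑' n, t n k) + (∑' k, v k) * ∑' n, u n := by
    calc ∑' n, ∑' k, t n k ≤ ∑' n, ∑' k, ((if n < K + 1 then t n k else 0) +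
          (if k < K then t n k else 0) + v k * u n) :=
          ENNReal.tsum_le_tsum fun n => ENNReal.tsum_le_tsum fun k => hpt n k
      _ = _ := by
          simp only [ENNReal.tsum_add]
          congr 1
          · congr 1
            · rw [← tsum_ite_lt_eq_sum_range]
              refine tsum_congr fun n => ?_
              split_ifs <;> simp
            · rw [ENNReal.tsum_comm, ← tsum_ite_lt_eq_sum_range]
              refine tsum_congr fun n => ?_
              split_ifs <;> simp
          · simp only [ENNReal.tsum_mul_right, ENNReal.tsum_mul_left]
  have hv : ∑' k, v k ≤ ENNReal.ofReal 8 := by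
    simp only [v]
    simp only [ENNReal.ofReal_mul (by norm_num : (0 : ℝ) ≤ 4)]
    rw [ENNReal.tsum_mul_left]
    calc _ ≤ ENNReal.ofReal 4 * ENNReal.ofReal (1 + 1 / 1) := by
          gcongr; exact tsum_ofReal_invSq_mul_le one_pos
      _ = ENNReal.ofReal 8 := by rw [← ENNReal.ofReal_mul (by norm_num)]; norm_num
  have hu : ∑' n, u n ≤ ENNReal.ofReal (1 + G) := by
    simpa using tsum_ofReal_invSq_mul_le (inv_pos.2 hG0)
  have hs1 : ∑ n ∈ range (K + 1), ∑' k, t n k ≤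
      ENNReal.ofReal (∑ n ∈ range (K + 1), (2 + G * ((n : ℝ) + a)⁻¹)) := by
    rw [ENNReal.ofReal_sum_of_nonneg fun n _ => by positivity]
    exact sum_le_sum fun n _ => hA n
  have hs2 : ∑ k ∈ range K, ∑' n, t n k ≤
      ENNReal.ofReal (∑ k ∈ range K, (2 + G * ((k : ℝ) + 1)⁻¹)) := by
    rw [ENNReal.ofReal_sum_of_nonneg fun n _ => by positivity]
    exact sum_le_sum fun n _ => hB n
  refine hsum.trans ((add_le_add (add_le_add hs1 hs2) (mul_le_mul' hv hu)).trans ?_)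
  rw [← ENNReal.ofReal_add (sum_nonneg fun n _ => by positivity)
    (sum_nonneg fun n _ => by positivity), ← ENNReal.ofReal_mul (by norm_num),
    ← ENNReal.ofReal_add (add_nonneg (sum_nonneg fun n _ => by positivity)
    (sum_nonneg fun n _ => by positivity)) (by positivity)]
  refine ENNReal.ofReal_le_ofReal ?_
  rw [sum_add_distrib, sum_add_distrib, ← mul_sum, ← mul_sum]
  have b1 := sum_range_inv_add_le ha K
  have b2 := sum_range_inv_succ_le K
  simp only [sum_const, card_range, nsmul_eq_mul]
  push_cast
  have ha' : 0 ≤ a⁻¹ := by positivity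
  have c1 : G * ∑ n ∈ range (K + 1), ((n : ℝ) + a)⁻¹ ≤ G * (a⁻¹ + 2 + Real.log G) := by
    gcongr; linarith
  have c2 : G * ∑ n ∈ range K, ((n : ℝ) + 1)⁻¹ ≤ G * (2 + Real.log G) := by
    gcongr; linarith
  have c3 : G * a⁻¹ ≤ a⁻¹ * (G * Real.log G) := by
    have : 0 ≤ G * a⁻¹ := by positivity
    nlinarith
  have c4 : G ≤ G * Real.log G := by nlinarith
  have c5 : 0 ≤ a⁻¹ * (G * Real.log G) := by positivity
  nlinarith

section

/-- The difference between `(n + a) ^ (-s)` and the integral of `y ^ (-s)` over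
`[n + a, n + 1 + a]`. -/
noncomputable def emTerm (a : ℝ) (s : ℂ) (n : ℕ) : ℂ :=
  ((n + a : ℝ) : ℂ) ^ (-s) -
    (((n + 1 + a : ℝ) : ℂ) ^ (1 - s) - ((n + a : ℝ) : ℂ) ^ (1 - s)) / (1 - s)

variable {a : ℝ}

lemma norm_emTerm_le (ha : 0 < a) {s : ℂ} (hs : 0 < s.re) (hs1 : s ≠ 1) (n : ℕ) :
    ‖emTerm a s n‖ ≤ ‖s‖ * (n + a) ^ (-s.re - 1) := by
  set x : ℝ := n + a with hx
  have hx0 : 0 < x := by positivity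
  have hs0 : s ≠ 0 := by rintro rfl; simp at hs
  have hs1' : 1 - s ≠ 0 := sub_ne_zero.2 hs1.symm
  have hpos : ∀ v ∈ Set.Icc (0 : ℝ) 1, 0 < x + v := fun v hv => by linarith [hv.1]
  have h1 : ∀ v ∈ Set.Icc (0 : ℝ) 1,
      ‖((x + v : ℝ) : ℂ) ^ (-s) - (x : ℂ) ^ (-s)‖ ≤ ‖s‖ * x ^ (-s.re - 1) := by
    intro v hv
    have hd : ∀ w ∈ Set.Icc (0 : ℝ) 1, HasDerivWithinAt (fun w : ℝ => ((x + w : ℝ) : ℂ) ^ (-s))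
        (-s * ((x + w : ℝ) : ℂ) ^ (-s - 1)) (Set.Icc 0 1) w := fun w hw => by
      have := (hasDerivAt_ofReal_cpow_const (hpos w hw).ne' (neg_ne_zero.2 hs0)).comp_const_add x w
      exact this.hasDerivWithinAt
    have hb : ∀ w ∈ Set.Icc (0 : ℝ) 1, ‖-s * ((x + w : ℝ) : ℂ) ^ (-s - 1)‖ ≤
        ‖s‖ * x ^ (-s.re - 1) := fun w hw => by
      rw [norm_mul, norm_neg, norm_cpow_eq_rpow_re_of_pos (hpos w hw)]
      simp only [sub_re, neg_re, one_re]
      gcongr ?_ * ?_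
      exact Real.rpow_le_rpow_of_nonpos hx0 (by linarith [hw.1]) (by linarith)
    have := (convex_Icc (0 : ℝ) 1).norm_image_sub_le_of_norm_hasDerivWithin_le hd hb
      (Set.left_mem_Icc.2 zero_le_one) hv
    rw [add_zero, sub_zero, Real.norm_eq_abs, abs_of_nonneg hv.1] at this
    refine this.trans ?_
    have h0 : 0 ≤ ‖s‖ * x ^ (-s.re - 1) := by positivity
    nlinarith [hv.2]
  have h2 := norm_image_sub_le_of_norm_deriv_le_segment_01' (C := ‖s‖ * x ^ (-s.re - 1))
    (f := fun v : ℝ => (v : ℂ) * (x : ℂ) ^ (-s) - ((x + v : ℝ) : ℂ) ^ (1 - s) / (1 - s))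
    (f' := fun v : ℝ => (x : ℂ) ^ (-s) - ((x + v : ℝ) : ℂ) ^ (-s)) (fun v hv => by
      have h3 : HasDerivAt (fun v : ℝ => (v : ℂ) * (x : ℂ) ^ (-s)) (1 * (x : ℂ) ^ (-s)) v :=
        (hasDerivAt_id v).ofReal_comp.mul_const _
      have h4 := ((hasDerivAt_ofReal_cpow_const (hpos v hv).ne' hs1').comp_const_add x v).div_const
        (1 - s)
      refine ((h3.sub h4).congr_deriv ?_).hasDerivWithinAt
      rw [mul_div_cancel_left₀ _ hs1', one_mul, sub_sub_cancel_left])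
    (fun v hv => by rw [norm_sub_rev]; exact h1 v ⟨hv.1, hv.2.le⟩)
  refine le_of_eq_of_le ?_ h2
  congr 1
  simp only [emTerm, ofReal_one, ofReal_zero, one_mul, zero_mul, add_zero]
  rw [show (n + 1 + a : ℝ) = x + 1 by rw [hx]; ring]
  ring

lemma summable_nat_add_rpow (ha : 0 < a) {σ : ℝ} (hσ : 1 < σ) :
    Summable (fun n : ℕ => ((n : ℝ) + a) ^ (-σ)) := by
  refine ((Real.summable_one_div_nat_add_rpow a σ).2 hσ).congr fun n => ?_
  have : 0 < (n : ℝ) + a := by positivity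
  rw [abs_of_pos this, Real.rpow_neg this.le, one_div]

lemma summable_emTerm (ha : 0 < a) {s : ℂ} (hs : 0 < s.re) (hs1 : s ≠ 1) :
    Summable (emTerm a s) := by
  refine Summable.of_norm_bounded ?_ (norm_emTerm_le ha hs hs1)
  refine ((summable_nat_add_rpow ha (σ := s.re + 1) (by linarith)).mul_left ‖s‖).congr fun n => ?_
  rw [neg_add']

lemma sum_emTerm (a : ℝ) (s : ℂ) (N : ℕ) : ∑ n ∈ range N, emTerm a s n =
    ∑ n ∈ range N, ((n + a : ℝ) : ℂ) ^ (-s) -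
      (((N + a : ℝ) : ℂ) ^ (1 - s) - (a : ℂ) ^ (1 - s)) / (1 - s) := by
  simp only [emTerm, sum_sub_distrib, ← sum_div]
  congr 2
  have := sum_range_sub (fun n : ℕ => ((n + a : ℝ) : ℂ) ^ (1 - s)) N
  simpa using this

lemma differentiableAt_tsum_emTerm (ha : 0 < a) {s : ℂ} (hs : 0 < s.re) (hs1 : s ≠ 1) :
    DifferentiableAt ℂ (fun s => ∑' n, emTerm a s n) s := by
  let V : Set ℂ := {z | s.re / 2 < z.re} ∩ Metric.ball 0 (‖s‖ + 1) ∩ {1}ᶜ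
  have hV : IsOpen V := ((isOpen_re_gt _).inter Metric.isOpen_ball).inter isOpen_compl_singleton
  have hsV : s ∈ V := ⟨⟨by simp only [Set.mem_ofPred_eq]; linarith, by simp⟩, hs1⟩
  have hsum : Summable fun n : ℕ => (‖s‖ + 1) *
      (((n : ℝ) + a) ^ (-(s.re / 2 + 1)) + ((n : ℝ) + a) ^ (-(‖s‖ + 1 + 1))) := by
    refine ((summable_nat_add_rpow ha (by linarith)).add
      (summable_nat_add_rpow ha ?_)).mul_left _
    linarith [norm_nonneg s]
  refine (differentiableOn_tsum_of_summable_norm hsum (fun n => ?_) hV fun n z hz => ?_)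
    |>.differentiableAt (hV.mem_nhds hsV)
  · intro z hz
    have h1 : 1 - z ≠ 0 := sub_ne_zero.2 (Ne.symm hz.2)
    have h2 : ((n + a : ℝ) : ℂ) ≠ 0 := by
      exact_mod_cast (by positivity : (n : ℝ) + a ≠ 0)
    have h3 : ((n + 1 + a : ℝ) : ℂ) ≠ 0 := by
      exact_mod_cast (by positivity : (n : ℝ) + 1 + a ≠ 0)
    unfold emTerm
    refine (DifferentiableAt.sub ?_ (DifferentiableAt.div (DifferentiableAt.sub ?_ ?_) ?_ h1))
      |>.differentiableWithinAt
    · exact DifferentiableAt.const_cpow (by fun_prop) (Or.inl h2)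
    · exact DifferentiableAt.const_cpow (by fun_prop) (Or.inl h3)
    · exact DifferentiableAt.const_cpow (by fun_prop) (Or.inl h2)
    · fun_prop
  · obtain ⟨⟨hz1, hz2⟩, hz3⟩ := hz
    rw [mem_ball_zero_iff] at hz2
    simp only [Set.mem_ofPred_eq] at hz1
    have h0 : 0 < (n : ℝ) + a := by positivity
    have hre := (le_abs_self _).trans (abs_re_le_norm z)
    refine (norm_emTerm_le ha (by linarith) hz3 n).trans ?_
    gcongr
    rcases le_total 1 ((n : ℝ) + a) with h | h
    · refine (Real.rpow_le_rpow_of_exponent_le h ?_).trans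
        (le_add_of_nonneg_right (by positivity))
      linarith
    · refine (Real.rpow_le_rpow_of_exponent_ge h0 h ?_).trans
        (le_add_of_nonneg_left (by positivity))
      linarith

lemma hasSum_hzeta (ha : 0 < a) (ha1 : a ≤ 1) {s : ℂ} (hs : 1 < s.re) :
    HasSum (fun n : ℕ => ((n + a : ℝ) : ℂ) ^ (-s)) (hzeta a s) := by
  refine (HurwitzZeta.hasSum_hurwitzZeta_of_one_lt_re ⟨ha.le, ha1⟩ hs).congr_fun fun n => ?_
  rw [cpow_neg, one_div]
  push_cast
  rfl

lemma hzeta_eq_tsum_of_one_lt_re (ha : 0 < a) (ha1 : a ≤ 1) {s : ℂ} (hs : 1 < s.re) :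
    hzeta a s = ∑' n, emTerm a s n - (a : ℂ) ^ (1 - s) / (1 - s) := by
  have hs1 : s ≠ 1 := by rintro rfl; simp at hs
  have h1 := (summable_emTerm ha (by linarith) hs1).hasSum.tendsto_sum_nat
  have h2 : Tendsto (fun N : ℕ => ((N + a : ℝ) : ℂ) ^ (1 - s)) atTop (nhds 0) := by
    rw [tendsto_zero_iff_norm_tendsto_zero]
    have h3 : Tendsto (fun N : ℕ => ((N : ℝ) + a) ^ (-(s.re - 1))) atTop (nhds 0) :=
      (tendsto_rpow_neg_atTop (by linarith)).comp
        (tendsto_atTop_add_const_right _ _ tendsto_natCast_atTop_atTop)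
    refine h3.congr fun N => ?_
    rw [norm_cpow_eq_rpow_re_of_pos (by positivity)]
    simp
  have h4 := ((hasSum_hzeta ha ha1 hs).tendsto_sum_nat).sub
    ((h2.sub_const ((a : ℂ) ^ (1 - s))).div_const (1 - s))
  simp only [sum_emTerm] at h1
  have := tendsto_nhds_unique h1 h4
  rw [this]
  ring

lemma hzeta_eq_tsum (ha : 0 < a) (ha1 : a ≤ 1) {s : ℂ} (hs : 0 < s.re) (hs1 : s ≠ 1) :
    hzeta a s = ∑' n, emTerm a s n - (a : ℂ) ^ (1 - s) / (1 - s) := by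
  have hac : (a : ℂ) ≠ 0 := by exact_mod_cast ha.ne'
  have hdR : ∀ z : ℂ, 0 < z.re → z ≠ 1 →
      DifferentiableAt ℂ (fun s => ∑' n, emTerm a s n - (a : ℂ) ^ (1 - s) / (1 - s)) z := by
    intro z hz hz1
    refine (differentiableAt_tsum_emTerm ha hz hz1).sub (DifferentiableAt.div ?_ (by fun_prop)
      (sub_ne_zero.2 hz1.symm))
    exact DifferentiableAt.const_cpow (by fun_prop) (Or.inl hac)
  have hdL : ∀ z : ℂ, z ≠ 1 → DifferentiableAt ℂ (hzeta a) z :=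
    fun z hz => HurwitzZeta.differentiableAt_hurwitzZeta _ hz
  have key : ∀ c : ℝ, ∀ z : ℂ, 0 < z.re → 0 < c * z.im →
      hzeta a z = ∑' n, emTerm a z n - (a : ℂ) ^ (1 - z) / (1 - z) := by
    intro c z hz hcz
    have hc : c ≠ 0 := by rintro rfl; simp at hcz
    let U : Set ℂ := {z | 0 < z.re} ∩ {z | 0 < c * z.im}
    have hU : IsOpen U := (isOpen_re_gt 0).inter
      (isOpen_lt continuous_const (continuous_const.mul continuous_im))
    have hUne : ∀ z ∈ U, z ≠ 1 := by rintro z ⟨-, hz⟩ rfl; simp at hz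
    have hUc : Convex ℝ U := by
      refine (convex_halfSpace_re_gt 0).inter ?_
      exact convex_halfSpace_gt (f := fun z : ℂ => c * z.im)
        ⟨fun x y => by simp [mul_add], fun r x => by simp; ring⟩ 0
    refine AnalyticOnNhd.eqOn_of_preconnected_of_eventuallyEq
      (DifferentiableOn.analyticOnNhd (fun z hz => (hdL z (hUne z hz)).differentiableWithinAt) hU)
      (DifferentiableOn.analyticOnNhd
        (fun z hz => (hdR z hz.1 (hUne z hz)).differentiableWithinAt) hU) hUc.isPreconnected
      (z₀ := 2 + (c⁻¹ : ℝ) * I) ⟨by simp, by simp [hc]⟩ ?_ ⟨hz, hcz⟩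
    filter_upwards [(isOpen_re_gt 1).mem_nhds
      (show (2 + (c⁻¹ : ℝ) * I : ℂ) ∈ {z : ℂ | 1 < z.re} by simp)] with w hw
    exact hzeta_eq_tsum_of_one_lt_re ha ha1 hw
  rcases lt_trichotomy s.im 0 with h | h | h
  · exact key (-1) s hs (by linarith)
  · have hc1 : ContinuousAt (fun y : ℝ => hzeta a (s + y * I)) 0 := by
      refine ContinuousAt.comp (g := hzeta a) ?_ (by fun_prop)
      simpa using (hdL s hs1).continuousAt
    have hc2 : ContinuousAt (fun y : ℝ => (fun z : ℂ =>
        ∑' n, emTerm a z n - (a : ℂ) ^ (1 - z) / (1 - z)) (s + y * I)) 0 := by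
      refine ContinuousAt.comp (g := fun z : ℂ =>
        ∑' n, emTerm a z n - (a : ℂ) ^ (1 - z) / (1 - z)) ?_ (by fun_prop)
      simpa using (hdR s hs hs1).continuousAt
    have h1 := hc1.tendsto.mono_left (nhdsWithin_le_nhds (s := Set.Ioi 0))
    have h2 := hc2.tendsto.mono_left (nhdsWithin_le_nhds (s := Set.Ioi 0))
    have h3 := tendsto_nhds_unique_of_eventuallyEq h1 h2 (by
      filter_upwards [self_mem_nhdsWithin] with y hy
      exact key 1 _ (by simpa using hs) (by simpa [h] using hy))
    simpa using h3
  · exact key 1 s hs (by linarith)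

end

section

variable {a : ℝ}

/-- The Euler–Maclaurin approximation of `hzeta a s` by `N` terms of the Dirichlet series. -/
noncomputable def zetaApprox (a : ℝ) (s : ℂ) (N : ℕ) : ℂ :=
  ∑ n ∈ range N, ((n + a : ℝ) : ℂ) ^ (-s) - ((N + a : ℝ) : ℂ) ^ (1 - s) / (1 - s)

lemma hzeta_sub_zetaApprox (ha : 0 < a) (ha1 : a ≤ 1) {s : ℂ} (hs : 0 < s.re) (hs1 : s ≠ 1)
    (N : ℕ) : hzeta a s - zetaApprox a s N = ∑' n, emTerm a s (n + N) := by
  rw [hzeta_eq_tsum ha ha1 hs hs1, ← (summable_emTerm ha hs hs1).sum_add_tsum_nat_add N,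
    sum_emTerm, zetaApprox]
  ring

lemma tendsto_zetaApprox (ha : 0 < a) (ha1 : a ≤ 1) {s : ℂ} (hs : 0 < s.re) (hs1 : s ≠ 1) :
    Tendsto (zetaApprox a s) atTop (nhds (hzeta a s)) := by
  have h := (tendsto_sum_nat_add (emTerm a s)).const_sub (hzeta a s)
  rw [sub_zero] at h
  refine h.congr fun N => ?_
  rw [← hzeta_sub_zetaApprox ha ha1 hs hs1]
  ring

lemma half_add_mul_I_ne_one (t : ℝ) : (1 / 2 + t * I : ℂ) ≠ 1 := fun h => by
  have := congrArg re h
  norm_num at this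

lemma half_add_mul_I_re (t : ℝ) : (1 / 2 + t * I : ℂ).re = 1 / 2 := by norm_num

lemma norm_half_add_mul_I_le (t : ℝ) : ‖(1 / 2 + t * I : ℂ)‖ ≤ 1 + |t| := by
  refine (norm_add_le _ _).trans ?_
  simp
  norm_num

lemma exists_norm_hzeta_sub_zetaApprox_le (ha : 0 < a) (ha1 : a ≤ 1) : ∃ C, 0 < C ∧
    ∀ (N : ℕ) (t : ℝ), ‖hzeta a (1 / 2 + t * I) - zetaApprox a (1 / 2 + t * I) N‖ ≤
      C * (1 + |t|) := by
  have hsum := summable_nat_add_rpow ha (σ := 3 / 2) (by norm_num)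
  have h0 : ∀ n : ℕ, 0 ≤ ((n : ℝ) + a) ^ (-(3 / 2 : ℝ)) := fun n => by positivity
  refine ⟨∑' n : ℕ, ((n : ℝ) + a) ^ (-(3 / 2 : ℝ)) + 1,
    add_pos_of_nonneg_of_pos (tsum_nonneg h0) one_pos, fun N t => ?_⟩
  have hre := half_add_mul_I_re t
  rw [hzeta_sub_zetaApprox ha ha1 (by rw [hre]; norm_num) (half_add_mul_I_ne_one t)]
  have hb : ∀ n : ℕ, ‖emTerm a (1 / 2 + t * I) (n + N)‖ ≤
      (1 + |t|) * (((n + N : ℕ) : ℝ) + a) ^ (-(3 / 2 : ℝ)) := fun n => by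
    refine (norm_emTerm_le ha (by rw [hre]; norm_num) (half_add_mul_I_ne_one t) _).trans ?_
    rw [hre]
    norm_num only
    gcongr
    exact norm_half_add_mul_I_le t
  have hs' := (summable_nat_add_iff N).2 hsum
  refine (tsum_of_norm_bounded (hs'.mul_left _).hasSum hb).trans ?_
  rw [tsum_mul_left, mul_comm]
  gcongr
  have := hsum.sum_add_tsum_nat_add N
  linarith [Finset.sum_nonneg fun n (_ : n ∈ range N) => h0 n]

lemma norm_cpow_div_le (ha : 0 < a) (ha1 : a ≤ 1) (t : ℝ) :
    ‖(a : ℂ) ^ (1 - (1 / 2 + t * I : ℂ)) / (1 - (1 / 2 + t * I))‖ ≤ 2 := by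
  have h1 : (1 - (1 / 2 + t * I : ℂ)).re = 1 / 2 := by norm_num
  rw [norm_div, norm_cpow_eq_rpow_re_of_pos ha, h1]
  have h2 : 1 / 2 ≤ ‖(1 - (1 / 2 + t * I : ℂ))‖ := by
    have := abs_re_le_norm (1 - (1 / 2 + t * I : ℂ))
    rw [h1, abs_of_pos (by norm_num)] at this
    exact this
  rw [div_le_iff₀ (by linarith)]
  have := Real.rpow_le_one ha.le ha1 (by norm_num : (0 : ℝ) ≤ 1 / 2)
  linarith

lemma exists_norm_hzeta_le (ha : 0 < a) (ha1 : a ≤ 1) : ∃ C, 0 < C ∧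
    ∀ t : ℝ, ‖hzeta a (1 / 2 + t * I)‖ ≤ C * (1 + |t|) := by
  obtain ⟨C, hC, h⟩ := exists_norm_hzeta_sub_zetaApprox_le ha ha1
  refine ⟨C + 2, by linarith, fun t => ?_⟩
  have h1 := h 0 t
  have h2 : ‖zetaApprox a (1 / 2 + t * I) 0‖ ≤ 2 := by
    simpa [zetaApprox] using norm_cpow_div_le ha ha1 t
  have h3 := norm_sub_norm_le (hzeta a (1 / 2 + t * I)) (zetaApprox a (1 / 2 + t * I) 0)
  nlinarith [abs_nonneg t]

lemma exists_norm_zetaApprox_le (ha : 0 < a) (ha1 : a ≤ 1) : ∃ C, 0 < C ∧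
    ∀ (N : ℕ) (t : ℝ), ‖zetaApprox a (1 / 2 + t * I) N‖ ≤ C * (1 + |t|) := by
  obtain ⟨C, hC, h⟩ := exists_norm_hzeta_sub_zetaApprox_le ha ha1
  obtain ⟨C', hC', h'⟩ := exists_norm_hzeta_le ha ha1
  refine ⟨C + C', by linarith, fun N t => ?_⟩
  have h1 := h N t
  have h3 := norm_sub_norm_le (zetaApprox a (1 / 2 + t * I) N) (hzeta a (1 / 2 + t * I))
  rw [norm_sub_rev] at h3
  linarith [h' t]

lemma continuous_hzeta_line {σ : ℝ} (hσ : σ ≠ 1) :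
    Continuous fun t : ℝ => hzeta a (σ + t * I) := by
  rw [continuous_iff_continuousAt]
  intro t
  have h1 : (σ + t * I : ℂ) ≠ 1 := fun h => by
    have := congrArg re h
    simp at this
    exact hσ this
  have h2 := (HurwitzZeta.differentiableAt_hurwitzZeta (a : UnitAddCircle) h1).continuousAt
  exact ContinuousAt.comp (f := fun t : ℝ => (σ + t * I : ℂ)) h2 (by fun_prop)

lemma continuous_hzeta_half : Continuous fun t : ℝ => hzeta a (1 / 2 + t * I) := by
  have := continuous_hzeta_line (a := a) (σ := 1 / 2) (by norm_num)
  simpa using this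

lemma continuous_zetaApprox (ha : 0 < a) (N : ℕ) :
    Continuous fun t : ℝ => zetaApprox a (1 / 2 + t * I) N := by
  have h1 : ∀ n : ℕ, ((n + a : ℝ) : ℂ) ≠ 0 := fun n => by
    exact_mod_cast (by positivity : (n : ℝ) + a ≠ 0)
  unfold zetaApprox
  refine Continuous.sub (continuous_finsetSum _ fun n _ => ?_) (Continuous.div ?_ ?_ ?_)
  · exact Continuous.const_cpow (by fun_prop) (Or.inl (h1 n))
  · exact Continuous.const_cpow (by fun_prop) (Or.inl (h1 N))
  · fun_prop
  · exact fun t => sub_ne_zero.2 (half_add_mul_I_ne_one t).symm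

end

/-! ### The averaging kernel -/

section

variable {η : ℝ → ℂ} {κ : ℝ → ℝ}

/-- The kernel `κ` rescaled to have width `G` and centre `τ`. -/
noncomputable def window (κ : ℝ → ℝ) (G τ t : ℝ) : ℝ := κ ((t - τ) / G) / G

lemma window_nonneg (hη : SmoothingKernel η κ) {G : ℝ} (hG : 0 < G) (τ t : ℝ) :
    0 ≤ window κ G τ t := div_nonneg (hη.nonneg _) hG.le

lemma continuous_window (hη : SmoothingKernel η κ) (G τ : ℝ) :
    Continuous (window κ G τ) := by
  have := hη.continuous
  unfold window
  fun_prop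

lemma integrable_inv_one_add_abs_sq : Integrable fun t : ℝ => ((1 + |t|) ^ 2)⁻¹ := by
  have := integrable_one_add_norm (E := ℝ) (μ := volume) (r := 2) (by simp)
  refine this.congr (.of_forall fun t => ?_)
  simp only
  rw [Real.rpow_neg (by positivity), Real.norm_eq_abs]
  norm_cast

lemma one_add_abs_le_mul {G : ℝ} (hG : 0 < G) (τ t : ℝ) :
    1 + |t| ≤ (1 + |τ| + G) * (1 + |(t - τ) / G|) := by
  have h1 : |t| ≤ |τ| + G * |(t - τ) / G| := by
    rw [abs_div, abs_of_pos hG, mul_div_cancel₀ _ hG.ne']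
    have := abs_add_le τ (t - τ)
    rwa [add_sub_cancel] at this
  nlinarith [abs_nonneg τ, abs_nonneg ((t - τ) / G), mul_nonneg (abs_nonneg τ)
    (abs_nonneg ((t - τ) / G))]

lemma integrable_window_mul (hη : SmoothingKernel η κ) {G : ℝ} (hG : 0 < G) (τ : ℝ)
    {F : ℝ → ℂ} (hF : AEStronglyMeasurable F) {C : ℝ}
    (hb : ∀ t, ‖F t‖ ≤ C * (1 + |t|) ^ 4) :
    Integrable fun t => (window κ G τ t : ℂ) * F t := by
  obtain ⟨D, hD⟩ := hη.decay
  have h0 : Integrable fun t : ℝ => ((1 + |(t - τ) / G|) ^ 2)⁻¹ :=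
    (integrable_inv_one_add_abs_sq.comp_div hG.ne').comp_sub_right τ
  refine (h0.const_mul (|D| * |C| * (1 + |τ| + G) ^ 4 / G)).mono' ?_ (.of_forall fun t => ?_)
  · exact (continuous_ofReal.comp (continuous_window hη G τ)).aestronglyMeasurable.mul hF
  · set y := (t - τ) / G
    have h1 := one_add_abs_le_mul hG τ t
    have hy : 0 < 1 + |y| := by positivity
    rw [norm_mul, norm_real, Real.norm_eq_abs, abs_of_nonneg (window_nonneg hη hG _ _), window]
    have h2 : κ y ≤ |D| * ((1 + |y|) ^ 12)⁻¹ :=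
      (hD y).trans (mul_le_mul_of_nonneg_right (le_abs_self D) (by positivity))
    have h3 : ‖F t‖ ≤ |C| * ((1 + |τ| + G) * (1 + |y|)) ^ 4 := by
      refine (hb t).trans ?_
      refine mul_le_mul (le_abs_self C) ?_ (by positivity) (abs_nonneg _)
      exact pow_le_pow_left₀ (by positivity) h1 4
    calc κ y / G * ‖F t‖ ≤ |D| * ((1 + |y|) ^ 12)⁻¹ / G *
          (|C| * ((1 + |τ| + G) * (1 + |y|)) ^ 4) := by gcongr
      _ = |D| * |C| * (1 + |τ| + G) ^ 4 / G * ((1 + |y|) ^ 8)⁻¹ := by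
          field_simp
      _ ≤ _ := by
          gcongr _ * ?_
          refine inv_anti₀ (by positivity) ?_
          exact pow_le_pow_right₀ (by linarith [abs_nonneg y]) (by norm_num)

lemma integral_window_mul_exp (hη : SmoothingKernel η κ) {G : ℝ} (hG : 0 < G) (τ u : ℝ) :
    ∫ t, (window κ G τ t : ℂ) * cexp (-(t * u : ℝ) * I) = cexp (-(τ * u : ℝ) * I) * η (G * u) := by
  have h1 := integral_sub_right_eq_self (μ := volume)
    (fun t : ℝ => (window κ G τ (t + τ) : ℂ) * cexp (-((t + τ) * u : ℝ) * I)) τ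
  simp only [sub_add_cancel] at h1
  rw [h1, ← hη.fourier, ← integral_const_mul]
  have h2 := Measure.integral_comp_mul_left (fun t : ℝ => (window κ G τ (t + τ) : ℂ) *
    cexp (-((t + τ) * u : ℝ) * I)) G
  rw [abs_of_pos (inv_pos.2 hG), eq_inv_smul_iff₀ hG.ne'] at h2
  rw [← h2, ← integral_smul]
  refine integral_congr_ae (.of_forall fun y => ?_)
  simp only [window, add_sub_cancel_right, mul_div_cancel_left₀ _ hG.ne', real_smul]
  rw [mul_left_comm (cexp _), ← Complex.exp_add, ← mul_assoc]
  congr 1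
  · have : (G : ℂ) ≠ 0 := by exact_mod_cast hG.ne'
    push_cast
    field_simp
  · congr 1
    push_cast
    ring

lemma integral_window (hη : SmoothingKernel η κ) {G : ℝ} (hG : 0 < G) (τ : ℝ) :
    ∫ t, window κ G τ t = 1 := by
  have := integral_window_mul_exp hη hG τ 0
  simp only [mul_zero, ofReal_zero, neg_zero, zero_mul, Complex.exp_zero, mul_one,
    hη.map_zero, integral_complex_ofReal] at this
  exact_mod_cast this

lemma integral_window_mul_cpow (hη : SmoothingKernel η κ) {G : ℝ} (hG : 0 < G) (τ : ℝ) {y z : ℝ}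
    (hy : 0 < y) (hz : 0 < z) :
    ∫ t, (window κ G τ t : ℂ) * ((y : ℂ) ^ (-(1 / 2 + t * I : ℂ)) *
      (z : ℂ) ^ ((1 / 2 + t * I : ℂ) - 1)) = (z : ℂ)⁻¹ * logBump η G τ (y / z - 1) := by
  have hyc : (y : ℂ) ≠ 0 := by exact_mod_cast hy.ne'
  have hzc : (z : ℂ) ≠ 0 := by exact_mod_cast hz.ne'
  have hyz : 0 < y / z := by positivity
  have h1 := integral_window_mul_exp hη hG τ (Real.log (y / z))
  have hlog : -1 < y / z - 1 := by linarith
  rw [logBump, if_pos hlog, add_sub_cancel]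
  have e1 : ∀ t : ℝ, (window κ G τ t : ℂ) * ((y : ℂ) ^ (-(1 / 2 + t * I : ℂ)) *
      (z : ℂ) ^ ((1 / 2 + t * I : ℂ) - 1)) = (z : ℂ)⁻¹ * cexp (-(1 / 2) * Real.log (y / z)) *
        ((window κ G τ t : ℂ) * cexp (-(t * Real.log (y / z) : ℝ) * I)) := fun t => by
    rw [show (z : ℂ)⁻¹ = cexp (-Real.log z) by
        rw [Complex.exp_neg, ← ofReal_exp, Real.exp_log hz],
      cpow_def_of_ne_zero hyc, cpow_def_of_ne_zero hzc,
      ← ofReal_log hy.le, ← ofReal_log hz.le, Real.log_div hy.ne' hz.ne',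
      mul_left_comm _ (window κ G τ t : ℂ), ← Complex.exp_add, ← Complex.exp_add,
      ← Complex.exp_add]
    congr 2
    push_cast
    ring
  simp_rw [e1]
  rw [integral_const_mul, h1, mul_assoc, ← mul_assoc (cexp _), ← Complex.exp_add]
  congr 4
  push_cast
  ring

end

section

variable {η : ℝ → ℂ} {κ : ℝ → ℝ} {a : ℝ}

lemma abs_le_one_of_logBump_ne_zero (hη : SmoothingKernel η κ) {G τ v : ℝ} (hG : 4 ≤ G)
    (h : logBump η G τ v ≠ 0) : |v| < 3 / 4 / G := by
  by_contra! h1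
  refine h (logBump_eq_zero hη hG ?_)
  rw [abs_mul, abs_of_pos (by linarith : 0 < G)]
  rwa [div_le_iff₀' (by linarith)] at h1

lemma logBump_eq_zero_of_one_le (hη : SmoothingKernel η κ) {G τ v : ℝ} (hG : 4 ≤ G)
    (h : 1 ≤ |v|) : logBump η G τ v = 0 := by
  by_contra! h1
  have h2 := abs_le_one_of_logBump_ne_zero hη hG h1
  rw [lt_div_iff₀ (by linarith)] at h2
  nlinarith

lemma integral_window_mul_cpow_div (hη : SmoothingKernel η κ) {G : ℝ} (hG : 4 ≤ G) (τ : ℝ)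
    {y z : ℝ} (hz : 0 < z) (hyz : 2 * z ≤ y) :
    ∫ t, (window κ G τ t : ℂ) * ((y : ℂ) ^ (1 - (1 / 2 + t * I : ℂ)) / (1 - (1 / 2 + t * I)) *
      (z : ℂ) ^ ((1 / 2 + t * I : ℂ) - 1)) = oscInt η G τ 0 := by
  have hG0 : 0 < G := by linarith
  have hy : 0 < y := by linarith
  have e1 : ∀ t : ℝ, (window κ G τ t : ℂ) *
      ((y : ℂ) ^ (1 - (1 / 2 + t * I : ℂ)) / (1 - (1 / 2 + t * I)) *
      (z : ℂ) ^ ((1 / 2 + t * I : ℂ) - 1)) =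
      ∫ w in Set.Ioc 0 y, (window κ G τ t : ℂ) * ((w : ℂ) ^ (-(1 / 2 + t * I : ℂ)) *
        (z : ℂ) ^ ((1 / 2 + t * I : ℂ) - 1)) := fun t => by
    rw [integral_const_mul, integral_mul_const, ← intervalIntegral.integral_of_le hy.le,
      integral_cpow (Or.inl (by norm_num))]
    have h2 : -(1 / 2 + t * I : ℂ) + 1 = 1 - (1 / 2 + t * I) := by ring
    have h3 : (1 - (1 / 2 + t * I : ℂ)) ≠ 0 := sub_ne_zero.2 (half_add_mul_I_ne_one t).symm
    rw [h2, ofReal_zero, zero_cpow h3, sub_zero]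
  simp_rw [e1]
  rw [integral_integral_swap]
  · calc ∫ w in Set.Ioc 0 y, ∫ t, (window κ G τ t : ℂ) * ((w : ℂ) ^ (-(1 / 2 + t * I : ℂ)) *
          (z : ℂ) ^ ((1 / 2 + t * I : ℂ) - 1)) =
        ∫ w in Set.Ioc 0 y, (z : ℂ)⁻¹ * logBump η G τ (w / z - 1) :=
          setIntegral_congr_fun measurableSet_Ioc fun w hw =>
            integral_window_mul_cpow hη hG0 τ hw.1 hz
      _ = ∫ v in Set.Ioc (-1) (y / z - 1), logBump η G τ v := by
          have h1 : -1 ≤ y / z - 1 := by linarith [div_pos hy hz]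
          rw [integral_const_mul, ← intervalIntegral.integral_of_le hy.le,
            intervalIntegral.integral_comp_div_sub (logBump η G τ) hz.ne',
            ← intervalIntegral.integral_of_le h1, zero_div, zero_sub, real_smul, ← mul_assoc,
            inv_mul_cancel₀ (by exact_mod_cast hz.ne'), one_mul]
      _ = ∫ v, logBump η G τ v := by
          refine setIntegral_eq_integral_of_forall_compl_eq_zero fun v hv => ?_
          rw [Set.mem_Ioc, not_and_or, not_lt, not_le] at hv
          rcases hv with hv | hv
          · exact logBump_of_le hv
          · refine logBump_eq_zero_of_one_le hη hG (le_trans ?_ (le_abs_self v))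
            have : 2 ≤ y / z := (le_div_iff₀ hz).2 hyz
            linarith
      _ = oscInt η G τ 0 := by simp [oscInt]
  · have h1 : Integrable (fun t => window κ G τ t) := by
      have := integrable_window_mul hη hG0 τ (F := fun _ => 1) (C := 1)
        aestronglyMeasurable_const fun t => by
          rw [norm_one, one_mul]
          exact one_le_pow₀ (by linarith [abs_nonneg t])
      simpa using this.re
    have h2 : IntegrableOn (fun w : ℝ => w ^ (-(1 / 2) : ℝ)) (Set.Ioc 0 y) := by
      rw [← intervalIntegrable_iff_integrableOn_Ioc_of_le hy.le]
      exact intervalIntegral.intervalIntegrable_rpow' (by norm_num)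
    refine ((h1.mul_prod h2).mul_const (z ^ (-(1 / 2) : ℝ))).mono' ?_ ?_
    · have := hη.continuous.measurable
      refine Measurable.aestronglyMeasurable ?_
      unfold window Function.uncurry
      fun_prop
    · have h3 : ∀ᵐ p ∂((volume : Measure ℝ).prod (volume.restrict (Set.Ioc 0 y))), 0 < p.2 := by
        have := (Measure.quasiMeasurePreserving_snd (μ := (volume : Measure ℝ))
          (ν := volume.restrict (Set.Ioc 0 y))).ae
          ((ae_restrict_mem measurableSet_Ioc).mono fun w hw => hw.1)
        exact this
      filter_upwards [h3] with p hp
      simp only [Function.uncurry, norm_mul, norm_real, Real.norm_eq_abs,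
        abs_of_nonneg (window_nonneg hη hG0 _ _), norm_cpow_eq_rpow_re_of_pos hp,
        norm_cpow_eq_rpow_re_of_pos hz]
      norm_num
      rw [mul_assoc]

/-- The windowed mean of `hzeta a (1 / 2 + t * I) * z ^ (-1 / 2 + t * I)`. -/
noncomputable def zetaMean (κ : ℝ → ℝ) (G a τ z : ℝ) : ℂ :=
  ∫ t, (window κ G τ t : ℂ) * (hzeta a (1 / 2 + t * I) * (z : ℂ) ^ ((1 / 2 + t * I : ℂ) - 1))

lemma norm_cpow_half (z : ℝ) (hz : 0 < z) (t : ℝ) :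
    ‖(z : ℂ) ^ ((1 / 2 + t * I : ℂ) - 1)‖ = z ^ (-(1 / 2) : ℝ) := by
  rw [norm_cpow_eq_rpow_re_of_pos hz]
  norm_num

lemma continuous_cpow_half {z : ℝ} (hz : 0 < z) {f : ℝ → ℂ} (hf : Continuous f) :
    Continuous fun t : ℝ => (z : ℂ) ^ (f t) :=
  Continuous.const_cpow hf (Or.inl (by exact_mod_cast hz.ne'))

lemma one_add_abs_le_pow_four (t : ℝ) : 1 + |t| ≤ (1 + |t|) ^ 4 :=
  le_self_pow₀ (by linarith [abs_nonneg t]) (by norm_num)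

lemma integral_window_mul_zetaApprox (hη : SmoothingKernel η κ) {G : ℝ} (hG : 4 ≤ G) (ha : 0 < a)
    (τ : ℝ) {z : ℝ} (hz : 0 < z) {N : ℕ} (hN : 2 * z ≤ N + a) :
    ∫ t, (window κ G τ t : ℂ) * (zetaApprox a (1 / 2 + t * I) N *
      (z : ℂ) ^ ((1 / 2 + t * I : ℂ) - 1)) =
    ∑ n ∈ range N, (z : ℂ)⁻¹ * logBump η G τ ((n + a) / z - 1) - oscInt η G τ 0 := by
  have hG0 : 0 < G := by linarith
  have hx : ∀ n : ℕ, 0 < (n : ℝ) + a := fun n => by positivity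
  have hne : ∀ t : ℝ, (1 - (1 / 2 + t * I : ℂ)) ≠ 0 := fun t =>
    sub_ne_zero.2 (half_add_mul_I_ne_one t).symm
  have h1 : ∀ n : ℕ, Integrable fun t => (window κ G τ t : ℂ) *
      (((n + a : ℝ) : ℂ) ^ (-(1 / 2 + t * I : ℂ)) * (z : ℂ) ^ ((1 / 2 + t * I : ℂ) - 1)) := by
    intro n
    refine integrable_window_mul hη hG0 τ (C := (n + a) ^ (-(1 / 2) : ℝ) * z ^ (-(1 / 2) : ℝ))
      ((continuous_cpow_half (hx n) (by fun_prop)).mul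
        (continuous_cpow_half hz (by fun_prop))).aestronglyMeasurable fun t => ?_
    rw [norm_mul, norm_cpow_half z hz, norm_cpow_eq_rpow_re_of_pos (hx n)]
    have hr : (-(1 / 2 + t * I : ℂ)).re = -(1 / 2) := by norm_num
    rw [hr]
    refine le_mul_of_one_le_right (by have := hx n; positivity)
      (one_le_pow₀ (by linarith [abs_nonneg t]))
  have h2 : Integrable fun t => (window κ G τ t : ℂ) *
      (((N + a : ℝ) : ℂ) ^ (1 - (1 / 2 + t * I : ℂ)) / (1 - (1 / 2 + t * I)) *
        (z : ℂ) ^ ((1 / 2 + t * I : ℂ) - 1)) := by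
    refine integrable_window_mul hη hG0 τ (C := (N + a) ^ (1 / 2 : ℝ) * 2 * z ^ (-(1 / 2) : ℝ))
      (((continuous_cpow_half (hx N) (by fun_prop)).div (by fun_prop) hne).mul
        (continuous_cpow_half hz (by fun_prop))).aestronglyMeasurable fun t => ?_
    have hr : (1 - (1 / 2 + t * I : ℂ)).re = 1 / 2 := by norm_num
    rw [norm_mul, norm_div, norm_cpow_half z hz, norm_cpow_eq_rpow_re_of_pos (hx N), hr]
    have h3 : 1 / 2 ≤ ‖(1 - (1 / 2 + t * I : ℂ))‖ := by
      have := abs_re_le_norm (1 - (1 / 2 + t * I : ℂ))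
      rwa [hr, abs_of_pos (by norm_num)] at this
    have hN0 := hx N
    calc (N + a : ℝ) ^ (1 / 2 : ℝ) / ‖(1 - (1 / 2 + t * I : ℂ))‖ * z ^ (-(1 / 2) : ℝ)
        ≤ (N + a) ^ (1 / 2 : ℝ) / (1 / 2) * z ^ (-(1 / 2) : ℝ) := by gcongr
      _ = (N + a) ^ (1 / 2 : ℝ) * 2 * z ^ (-(1 / 2) : ℝ) := by ring
      _ ≤ _ := le_mul_of_one_le_right (by positivity) (one_le_pow₀ (by linarith [abs_nonneg t]))
  have e1 : ∀ t : ℝ, (window κ G τ t : ℂ) * (zetaApprox a (1 / 2 + t * I) N *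
      (z : ℂ) ^ ((1 / 2 + t * I : ℂ) - 1)) =
      ∑ n ∈ range N, (window κ G τ t : ℂ) *
        (((n + a : ℝ) : ℂ) ^ (-(1 / 2 + t * I : ℂ)) * (z : ℂ) ^ ((1 / 2 + t * I : ℂ) - 1)) -
      (window κ G τ t : ℂ) *
      (((N + a : ℝ) : ℂ) ^ (1 - (1 / 2 + t * I : ℂ)) / (1 - (1 / 2 + t * I)) *
        (z : ℂ) ^ ((1 / 2 + t * I : ℂ) - 1)) := fun t => by
    rw [zetaApprox, sub_mul, mul_sub, Finset.sum_mul, Finset.mul_sum]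
  simp_rw [e1]
  rw [integral_sub (integrable_finsetSum _ fun n _ => h1 n) h2,
    integral_finsetSum _ fun n _ => h1 n, integral_window_mul_cpow_div hη hG τ hz hN]
  congr 1
  exact Finset.sum_congr rfl fun n _ => integral_window_mul_cpow hη hG0 τ (hx n) hz

lemma tendsto_sum_logBump (hη : SmoothingKernel η κ) {G : ℝ} (hG : 4 ≤ G) (ha : 0 < a)
    (ha1 : a ≤ 1) (τ : ℝ) {z : ℝ} (hz : 0 < z) :
    Tendsto (fun N : ℕ => ∑ n ∈ range N, (z : ℂ)⁻¹ * logBump η G τ ((n + a) / z - 1)) atTop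
      (nhds (zetaMean κ G a τ z + oscInt η G τ 0)) := by
  have hG0 : 0 < G := by linarith
  obtain ⟨C, hC, hb⟩ := exists_norm_zetaApprox_le ha ha1
  have h1 : Tendsto (fun N : ℕ => ∫ t, (window κ G τ t : ℂ) * (zetaApprox a (1 / 2 + t * I) N *
      (z : ℂ) ^ ((1 / 2 + t * I : ℂ) - 1))) atTop (nhds (zetaMean κ G a τ z)) := by
    have hInt := integrable_window_mul hη hG0 τ
      (F := fun t => ((C * (1 + |t|) * z ^ (-(1 / 2) : ℝ) : ℝ) : ℂ))
      (C := C * z ^ (-(1 / 2) : ℝ)) (by fun_prop) fun t => by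
        rw [norm_real, Real.norm_eq_abs, abs_of_nonneg (by positivity), mul_right_comm]
        gcongr
        exact one_add_abs_le_pow_four t
    refine tendsto_integral_of_dominated_convergence _ (fun N => ?_) hInt.norm (fun N => ?_) ?_
    · exact ((continuous_ofReal.comp (continuous_window hη G τ)).mul
        ((continuous_zetaApprox ha N).mul
          (continuous_cpow_half hz (by fun_prop)))).aestronglyMeasurable
    · refine .of_forall fun t => ?_
      simp only [norm_mul, norm_cpow_half z hz]
      gcongr
      rw [norm_real, Real.norm_eq_abs, abs_of_nonneg (by positivity)]
      gcongr
      exact hb N t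
    · refine .of_forall fun t => ?_
      exact ((tendsto_zetaApprox ha ha1 (by norm_num) (half_add_mul_I_ne_one t)).mul_const _)
        |>.const_mul _
  refine (h1.add_const (oscInt η G τ 0)).congr' ?_
  filter_upwards [eventually_ge_atTop ⌈2 * z⌉₊] with N hN
  have h2 : 2 * z ≤ N + a := by
    have := Nat.ceil_le.1 hN
    linarith
  rw [integral_window_mul_zetaApprox hη hG ha τ hz h2, sub_add_cancel]

open scoped FourierTransform in
lemma fourier_logBump_div (G τ : ℝ) {z : ℝ} (hz : 0 < z) (k : ℝ) :
    𝓕 (fun x : ℝ => (z : ℂ)⁻¹ * logBump η G τ (x / z)) k = oscInt η G τ (2 * Real.pi * k * z) := by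
  rw [Real.fourier_eq', oscInt]
  have h := Measure.integral_comp_div (fun v : ℝ => logBump η G τ v *
    cexp (-(2 * Real.pi * k * z * v : ℝ) * I)) z
  rw [abs_of_pos hz, ← inv_smul_eq_iff₀ hz.ne'] at h
  rw [← h, ← integral_smul]
  refine integral_congr_ae (.of_forall fun x => ?_)
  have hzc : (z : ℂ) ≠ 0 := by exact_mod_cast hz.ne'
  simp only [smul_eq_mul, real_smul, ofReal_inv]
  rw [mul_comm, mul_assoc]
  congr 3
  simp only [RCLike.inner_apply, conj_trivial]
  push_cast
  field_simp

end

section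

variable {η : ℝ → ℂ} {κ : ℝ → ℝ} {a : ℝ}

lemma inv_cube_le_invSq (x : ℝ) {y : ℝ} (h : |y| = x) : ((1 + x) ^ 3)⁻¹ ≤ invSq y := by
  rw [invSq, h]
  have hx : 0 ≤ x := h ▸ abs_nonneg y
  exact inv_anti₀ (by positivity) (pow_le_pow_right₀ (by linarith) (by norm_num))

lemma exists_norm_oscInt_le_invSq (hη : SmoothingKernel η κ) : ∃ C, 0 < C ∧ ∀ G τ ξ : ℝ, 4 ≤ G →
    |τ| ≤ 2 * G ^ 2 → ‖oscInt η G τ ξ‖ ≤ C / G * invSq ((τ + ξ) / G) := by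
  obtain ⟨C, hC, h⟩ := exists_oscInt_bound hη
  refine ⟨C, hC, fun G τ ξ hG hτ => (h G τ ξ hG hτ).trans ?_⟩
  have hG0 : 0 < G := by linarith
  gcongr
  exact inv_cube_le_invSq _ (by rw [abs_div, abs_of_pos hG0])

lemma summable_int_invSq {δ : ℝ} (hδ : 0 < δ) (y : ℝ) :
    Summable fun k : ℤ => invSq (y + δ * k) := by
  have h := tsum_int_ofReal_invSq_le hδ y
  exact (ENNReal.summable_toReal (h.trans_lt ENNReal.ofReal_lt_top).ne).congr fun k =>
    ENNReal.toReal_ofReal (invSq_nonneg _)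

lemma summable_int_norm_oscInt (hη : SmoothingKernel η κ) {G τ : ℝ} (hG : 4 ≤ G)
    (hτ : |τ| ≤ 2 * G ^ 2) {z : ℝ} (hz : 0 < z) :
    Summable fun k : ℤ => ‖oscInt η G τ (2 * Real.pi * k * z)‖ := by
  obtain ⟨C, hC, h⟩ := exists_norm_oscInt_le_invSq hη
  have hG0 : 0 < G := by linarith
  have hs := (summable_int_invSq (δ := 2 * Real.pi * z / G) (by positivity) (τ / G)).mul_left
    (C / G)
  refine Summable.of_nonneg_of_le (fun _ => norm_nonneg _) (fun k => (h G τ _ hG hτ).trans ?_) hs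
  refine le_of_eq ?_
  congr 2
  ring

/-- The pair of oscillatory integrals attached to the lattice point `(n, k)`. -/
noncomputable def oscPair (η : ℝ → ℂ) (G a τ : ℝ) (n k : ℕ) : ℂ :=
  oscInt η G τ (2 * Real.pi * (k + 1) * (n + a)) + oscInt η G τ (-(2 * Real.pi * (k + 1) * (n + a)))

lemma zetaMean_eq_tsum (hη : SmoothingKernel η κ) {G τ : ℝ} (hG : 4 ≤ G)
    (hτ : |τ| ≤ 2 * G ^ 2) (ha : 0 < a) (ha1 : a ≤ 1) (n : ℕ) :
    zetaMean κ G a τ (n + a) = ∑' k : ℕ, oscPair η G a τ n k := by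
  set z : ℝ := n + a with hz
  have hz0 : 0 < z := by positivity
  have hzc : (z : ℂ) ≠ 0 := by exact_mod_cast hz0.ne'
  obtain ⟨f, hf⟩ : ∃ f : ℝ → ℂ, f = fun x => (z : ℂ)⁻¹ * logBump η G τ (x / z) := ⟨_, rfl⟩
  have hfc : Continuous f := by
    rw [hf]
    have := continuous_logBump hη hG τ
    fun_prop
  have hf0 : ∀ x, z ≤ |x| → f x = 0 := fun x hx => by
    rw [hf]
    simp only
    rw [logBump_eq_zero_of_one_le hη hG, mul_zero]
    rwa [abs_div, abs_of_pos hz0, one_le_div hz0]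
  have hO : f =O[cocompact ℝ] fun x : ℝ => |x| ^ (-2 : ℝ) := by
    refine Asymptotics.IsBigO.of_bound 1 ?_
    have : ∀ᶠ x in cocompact ℝ, z ≤ ‖x‖ := tendsto_norm_cocompact_atTop.eventually_ge_atTop z
    filter_upwards [this] with x hx
    rw [hf0 x hx, norm_zero]
    positivity
  have hF : ∀ k : ℤ, FourierTransform.fourier f (k : ℝ) =
      oscInt η G τ (2 * Real.pi * k * z) := fun k => by
    rw [hf]
    exact fourier_logBump_div G τ hz0 k
  have hsum := summable_int_norm_oscInt hη hG hτ hz0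
  have hP := Real.tsum_eq_tsum_fourier_of_rpow_decay_of_summable hfc (b := 2) (by norm_num) hO
    (by simp only [hF]; exact hsum.of_norm) 0
  simp only [zero_add, hF, QuotientAddGroup.mk_zero, fourier_eval_zero, mul_one] at hP
  have hfin : (Function.support fun m : ℤ => f m) ⊆ Set.Icc (-⌈z⌉) ⌈z⌉ := by
    intro m hm
    have h1 : |(m : ℝ)| < z := by
      by_contra! h
      exact hm (hf0 m h)
    rw [abs_lt] at h1
    have h2 := Int.le_ceil z
    constructor
    · have : (-⌈z⌉ : ℝ) < m := by linarith
      exact_mod_cast this.le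
    · have : (m : ℝ) < ⌈z⌉ := by linarith
      exact_mod_cast this.le
  have hsf : Summable fun m : ℤ => f m :=
    summable_of_hasFiniteSupport ((Set.finite_Icc _ _).subset hfin)
  have h1 : HasSum (fun m : ℤ => f ((m - n : ℤ) : ℝ)) (∑' m : ℤ, f m) := by
    have := (Equiv.subRight (n : ℤ)).hasSum_iff.2 hsf.hasSum
    exact this
  have h2 : HasSum (fun m : ℕ => f (((m : ℤ) - n : ℤ) : ℝ)) (∑' m : ℤ, f m) := by
    refine (Function.Injective.hasSum_iff (f := fun m : ℤ => f ((m - n : ℤ) : ℝ))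
      (g := fun m : ℕ => (m : ℤ)) Nat.cast_injective fun m hm => ?_).2 h1
    have hm0 : m < 0 := by
      by_contra! h
      exact hm ⟨m.toNat, Int.toNat_of_nonneg h⟩
    rw [hf]
    simp only
    rw [logBump_of_le, mul_zero]
    rw [div_le_iff₀ hz0, hz]
    have : (m : ℝ) ≤ -1 := by exact_mod_cast (by omega : m ≤ -1)
    push_cast
    linarith
  have h3 := tendsto_nhds_unique h2.tendsto_sum_nat (by
    refine (tendsto_sum_logBump hη hG ha ha1 τ hz0).congr fun N => ?_
    refine Finset.sum_congr rfl fun m _ => ?_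
    rw [hf]
    simp only
    congr 2
    push_cast
    rw [div_sub_one hz0.ne', hz]
    congr 1
    ring)
  have hs1 : Summable fun k : ℕ => oscInt η G τ (2 * Real.pi * (k + 1) * z) := by
    have := hsum.of_norm.comp_injective (i := fun k : ℕ => (k : ℤ) + 1) (fun i j h => by
      simpa using h)
    simpa [Function.comp_def] using this
  have hs2 : Summable fun k : ℕ => oscInt η G τ (-(2 * Real.pi * (k + 1) * z)) := by
    have := hsum.of_norm.comp_injective (i := fun k : ℕ => -((k : ℤ) + 1)) (fun i j h => by
      simpa using h)
    refine this.congr fun k => ?_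
    simp only [Function.comp_def]
    congr 1
    push_cast
    ring
  have hs2' : Summable fun k : ℕ =>
      (fun k : ℤ => oscInt η G τ (2 * Real.pi * k * z)) (-((k : ℤ) + 1)) := by
    refine hs2.congr fun k => ?_
    simp only
    congr 1
    push_cast
    ring
  have h4 := tsum_of_add_one_of_neg_add_one (f := fun k : ℤ => oscInt η G τ (2 * Real.pi * k * z))
    (by simpa using hs1) hs2'
  rw [← hP, h3] at h4
  have h5 : zetaMean κ G a τ z = (zetaMean κ G a τ z + oscInt η G τ 0) - oscInt η G τ 0 := by ring
  rw [h5, h4]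
  simp only [oscPair, ← hz]
  rw [hs1.tsum_add hs2]
  simp only [Int.cast_zero, mul_zero, zero_mul, Int.cast_add, Int.cast_natCast, Int.cast_one,
    Int.cast_neg, mul_neg, neg_mul]
  ring

end

section

variable {η : ℝ → ℂ} {κ : ℝ → ℝ} {a : ℝ}

/-- The discrepancy between the number of `n : ℕ` with `n + a ≤ y` and `y`. -/
noncomputable def countDiff (a y : ℝ) : ℝ := ⌊y + 1 - a⌋₊ - y

lemma measurable_countDiff : Measurable (countDiff a) := by
  unfold countDiff
  have : Measurable fun y : ℝ => (⌊y + 1 - a⌋₊ : ℝ) :=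
    (measurable_from_nat (f := fun n : ℕ => (n : ℝ))).comp
      (Nat.measurable_floor.comp (by fun_prop : Measurable fun y : ℝ => y + 1 - a))
  exact this.sub measurable_id

lemma abs_countDiff_le_one (ha : 0 < a) (ha1 : a ≤ 1) {y : ℝ} (hy : 0 ≤ y) :
    |countDiff a y| ≤ 1 := by
  have h1 := Nat.floor_le (by linarith : 0 ≤ y + 1 - a)
  have h2 := Nat.lt_floor_add_one (y + 1 - a)
  rw [countDiff, abs_le]
  constructor <;> linarith

lemma countDiff_of_lt {y : ℝ} (hy : y < a) : countDiff a y = -y := by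
  rw [countDiff, Nat.floor_eq_zero.2 (by linarith)]
  simp

lemma countDiff_of_mem {M : ℕ} {y : ℝ} (h1 : M + a ≤ y) (h2 : y < M + 1 + a) :
    countDiff a y = M + 1 - y := by
  have : ⌊y + 1 - a⌋₊ = M + 1 := by
    rw [Nat.floor_eq_iff (by linarith [Nat.cast_nonneg (α := ℝ) M])]
    push_cast
    constructor <;> linarith
  rw [countDiff, this]
  push_cast
  rfl

lemma intervalIntegrable_countDiff_first (ha : 0 < a) {s : ℂ} (hs1 : s.re < 1) :
    IntervalIntegrable (fun y : ℝ => (countDiff a y : ℂ) * (y : ℂ) ^ (-s - 1)) volume 0 a ∧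
    ∫ y in (0 : ℝ)..a, (countDiff a y : ℂ) * (y : ℂ) ^ (-s - 1) =
      -((a : ℂ) ^ (1 - s) / (1 - s)) := by
  have h1 : (1 - s) ≠ 0 := fun h => by
    have := congrArg re h
    simp at this
    linarith
  have hae : ∀ᵐ y : ℝ, y ∈ Set.uIoc 0 a → -(y : ℂ) ^ (-s) =
      (countDiff a y : ℂ) * (y : ℂ) ^ (-s - 1) := by
    filter_upwards [compl_mem_ae_iff.2 (measure_singleton a)] with y hy hy'
    rw [Set.uIoc_of_le ha.le] at hy'
    have hya : y < a := lt_of_le_of_ne hy'.2 hy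
    have hyc : (y : ℂ) ≠ 0 := by exact_mod_cast hy'.1.ne'
    rw [countDiff_of_lt hya, cpow_sub _ _ hyc, cpow_one]
    push_cast
    field_simp
  constructor
  · have h2 : IntervalIntegrable (fun y : ℝ => -(y : ℂ) ^ (-s)) volume 0 a :=
      (intervalIntegral.intervalIntegrable_cpow' (by rw [neg_re]; linarith)).neg
    exact h2.congr_ae ((ae_restrict_iff' measurableSet_uIoc).2 hae)
  · rw [← intervalIntegral.integral_congr_ae hae, intervalIntegral.integral_neg,
      integral_cpow (Or.inl (by simp; linarith)), neg_add_eq_sub, ofReal_zero, zero_cpow h1,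
      sub_zero]

lemma intervalIntegrable_countDiff_step (ha : 0 < a) {s : ℂ} (hs0 : s ≠ 0) (hs1 : s ≠ 1) (M : ℕ) :
    IntervalIntegrable (fun y : ℝ => (countDiff a y : ℂ) * (y : ℂ) ^ (-s - 1)) volume
      (M + a) (M + 1 + a) ∧
    ∫ y in (M + a : ℝ)..(M + 1 + a), (countDiff a y : ℂ) * (y : ℂ) ^ (-s - 1) =
      (M + 1) * ((((M + 1 + a : ℝ) : ℂ) ^ (-s) - ((M + a : ℝ) : ℂ) ^ (-s)) / (-s)) -
        (((M + 1 + a : ℝ) : ℂ) ^ (1 - s) - ((M + a : ℝ) : ℂ) ^ (1 - s)) / (1 - s) := by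
  have hle : (M + a : ℝ) ≤ M + 1 + a := by linarith
  have hM : 0 < (M + a : ℝ) := by positivity
  have h0 : (0 : ℝ) ∉ Set.uIcc (M + a : ℝ) (M + 1 + a) := by
    rw [Set.uIcc_of_le hle]
    exact fun h => absurd h.1 (not_le.2 hM)
  have hae : ∀ᵐ y : ℝ, y ∈ Set.uIoc (M + a : ℝ) (M + 1 + a) →
      ((M + 1 : ℂ) * (y : ℂ) ^ (-s - 1) - (y : ℂ) ^ (-s)) =
      (countDiff a y : ℂ) * (y : ℂ) ^ (-s - 1) := by
    filter_upwards [compl_mem_ae_iff.2 (measure_singleton (M + 1 + a : ℝ))] with y hy hy'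
    rw [Set.uIoc_of_le hle] at hy'
    have hyc : (y : ℂ) ≠ 0 := by exact_mod_cast (hM.trans hy'.1).ne'
    rw [countDiff_of_mem hy'.1.le (lt_of_le_of_ne hy'.2 hy), cpow_sub _ _ hyc, cpow_one]
    push_cast
    field_simp
  have i1 : IntervalIntegrable (fun y : ℝ => (M + 1 : ℂ) * (y : ℂ) ^ (-s - 1)) volume
      (M + a) (M + 1 + a) :=
    (intervalIntegral.intervalIntegrable_cpow (Or.inr h0)).const_mul _
  have i2 : IntervalIntegrable (fun y : ℝ => (y : ℂ) ^ (-s)) volume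
      (M + a) (M + 1 + a) := intervalIntegral.intervalIntegrable_cpow (Or.inr h0)
  constructor
  · exact (i1.sub i2).congr_ae ((ae_restrict_iff' measurableSet_uIoc).2 hae)
  · rw [← intervalIntegral.integral_congr_ae hae, intervalIntegral.integral_sub i1 i2,
      intervalIntegral.integral_const_mul, integral_cpow (Or.inr ⟨?_, h0⟩),
      integral_cpow (Or.inr ⟨?_, h0⟩), sub_add_cancel, neg_add_eq_sub]
    · exact fun h => hs1 (neg_injective h)
    · exact fun h => hs0 (by linear_combination -h)

lemma intervalIntegral_countDiff (ha : 0 < a) {s : ℂ} (hs0 : s ≠ 0) (hs1 : s.re < 1) (M : ℕ) :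
    IntervalIntegrable (fun y : ℝ => (countDiff a y : ℂ) * (y : ℂ) ^ (-s - 1)) volume
      0 (M + a) ∧
    s * ∫ y in (0 : ℝ)..(M + a), (countDiff a y : ℂ) * (y : ℂ) ^ (-s - 1) =
      zetaApprox a s M + a * ((M + a : ℝ) : ℂ) ^ (-s) := by
  have hs1' : s ≠ 1 := by rintro rfl; simp at hs1
  have h1 : 1 - s ≠ 0 := sub_ne_zero.2 hs1'.symm
  induction M with
  | zero =>
    have h := intervalIntegrable_countDiff_first ha hs1
    have hac : (a : ℂ) ≠ 0 := by exact_mod_cast ha.ne'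
    simp only [Nat.cast_zero, zero_add, zetaApprox, Finset.range_zero, Finset.sum_empty]
    refine ⟨h.1, ?_⟩
    have e1 : (a : ℂ) ^ (1 - s) = a * (a : ℂ) ^ (-s) := by
      rw [sub_eq_add_neg, cpow_add _ _ hac, cpow_one]
    rw [h.2, e1]
    field_simp
    ring
  | succ M ih =>
    have h := intervalIntegrable_countDiff_step ha hs0 hs1' M
    push_cast
    refine ⟨ih.1.trans h.1, ?_⟩
    rw [← intervalIntegral.integral_add_adjacent_intervals ih.1 h.1, mul_add, ih.2, h.2]
    simp only [zetaApprox, Finset.sum_range_succ]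
    have e : ∀ x : ℝ, x ≠ 0 → (x : ℂ) ^ (1 - s) = x * (x : ℂ) ^ (-s) := fun x hx => by
      rw [sub_eq_add_neg, cpow_add _ _ (by exact_mod_cast hx), cpow_one]
    push_cast
    have e1 := e (M + a) (by positivity)
    have e2 := e (M + 1 + a) (by positivity)
    push_cast at e1 e2
    rw [e1, e2]
    field_simp
    ring

lemma integrableOn_countDiff (ha : 0 < a) (ha1 : a ≤ 1) :
    IntegrableOn (fun y : ℝ => |countDiff a y| * y ^ (-(3 / 2) : ℝ)) (Set.Ioi 0) := by
  have hm : Measurable fun y : ℝ => |countDiff a y| * y ^ (-(3 / 2) : ℝ) := by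
    have := measurable_countDiff (a := a)
    fun_prop
  have hm' : Measurable fun y : ℝ => |countDiff a y| := by
    have := measurable_countDiff (a := a)
    fun_prop
  rw [← Set.Ioo_union_Ici_eq_Ioi ha]
  refine IntegrableOn.union ?_ ?_
  · have h1 : IntegrableOn (fun w : ℝ => w ^ (-(1 / 2) : ℝ)) (Set.Ioo 0 a) := by
      rw [intervalIntegral.integrableOn_Ioo_rpow_iff ha]
      norm_num
    refine h1.congr_fun (fun y hy => ?_) measurableSet_Ioo
    simp only
    rw [countDiff_of_lt hy.2, abs_neg, abs_of_pos hy.1]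
    nth_rewrite 2 [← Real.rpow_one y]
    rw [← Real.rpow_add hy.1]
    norm_num
  · rw [integrableOn_Ici_iff_integrableOn_Ioi]
    have h1 : IntegrableOn (fun w : ℝ => w ^ (-(3 / 2) : ℝ)) (Set.Ioi a) :=
      integrableOn_Ioi_rpow_of_lt (by norm_num) ha
    refine h1.mono' hm.aestronglyMeasurable ?_
    refine (ae_restrict_mem measurableSet_Ioi).mono fun y hy => ?_
    have hy0 : 0 < y := ha.trans hy
    rw [Real.norm_of_nonneg (mul_nonneg (abs_nonneg _) (Real.rpow_nonneg hy0.le _))]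
    exact mul_le_of_le_one_left (by positivity) (abs_countDiff_le_one ha ha1 hy0.le)

lemma hzeta_div_eq_integral (ha : 0 < a) (ha1 : a ≤ 1) (t : ℝ) :
    hzeta a (1 / 2 + t * I) / (1 / 2 + t * I) =
      ∫ y in Set.Ioi (0 : ℝ), (countDiff a y : ℂ) * (y : ℂ) ^ (-(1 / 2 + t * I : ℂ) - 1) := by
  have hre := half_add_mul_I_re t
  have hs0 : (1 / 2 + t * I : ℂ) ≠ 0 := fun h => by
    rw [h] at hre
    norm_num at hre
  have hlim : Tendsto (fun M : ℕ => (M + a : ℝ)) atTop atTop :=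
    tendsto_atTop_add_const_right _ _ tendsto_natCast_atTop_atTop
  have hInt : IntegrableOn (fun y : ℝ => (countDiff a y : ℂ) * (y : ℂ) ^
      (-(1 / 2 + t * I : ℂ) - 1)) (Set.Ioi 0) := by
    refine (integrableOn_countDiff ha ha1).mono' ?_ ?_
    · have := measurable_countDiff (a := a)
      exact Measurable.aestronglyMeasurable (by fun_prop)
    · refine (ae_restrict_mem measurableSet_Ioi).mono fun y hy => ?_
      rw [norm_mul, norm_real, norm_cpow_eq_rpow_re_of_pos hy]
      norm_num
  have h1 := (intervalIntegral_tendsto_integral_Ioi 0 hInt hlim).const_mul (1 / 2 + t * I : ℂ)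
  have h2 : Tendsto (fun M : ℕ => zetaApprox a (1 / 2 + t * I) M +
      a * ((M + a : ℝ) : ℂ) ^ (-(1 / 2 + t * I : ℂ))) atTop
      (nhds (hzeta a (1 / 2 + t * I) + a * 0)) := by
    refine (tendsto_zetaApprox ha ha1 (by norm_num) (half_add_mul_I_ne_one t)).add
      (Tendsto.const_mul _ ?_)
    rw [tendsto_zero_iff_norm_tendsto_zero]
    refine ((tendsto_rpow_neg_atTop (by norm_num : (0 : ℝ) < 1 / 2)).comp hlim).congr fun M => ?_
    rw [norm_cpow_eq_rpow_re_of_pos (by positivity), neg_re, hre]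
    rfl
  have h3 := tendsto_nhds_unique h2 (h1.congr fun M =>
    (intervalIntegral_countDiff ha hs0 (by rw [hre]; norm_num) M).2)
  rw [mul_zero, add_zero] at h3
  rw [h3, mul_div_cancel_left₀ _ hs0]

lemma norm_le_one_of_smoothingKernel (hη : SmoothingKernel η κ) (u : ℝ) : ‖η u‖ ≤ 1 := by
  rw [← hη.fourier u]
  have h1 := integral_window hη one_pos 0
  simp only [window, sub_zero, div_one] at h1
  rw [← h1]
  refine norm_integral_le_of_norm_le ?_ (.of_forall fun y => ?_)
  · exact Integrable.of_integral_ne_zero (by rw [h1]; norm_num)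
  · rw [norm_mul, norm_real, Real.norm_eq_abs, abs_of_nonneg (hη.nonneg y), ← ofReal_neg,
      norm_exp_ofReal_mul_I, mul_one]

lemma norm_logBump_le (hη : SmoothingKernel η κ) {G : ℝ} (hG : 4 ≤ G) (τ v : ℝ) :
    ‖logBump η G τ v‖ ≤ 2 := by
  by_cases h0 : logBump η G τ v = 0
  · rw [h0, norm_zero]
    norm_num
  have h1 := abs_le_one_of_logBump_ne_zero hη hG h0
  have h2 : 3 / 4 / G ≤ 3 / 16 := by
    rw [div_le_iff₀ (by linarith)]
    linarith
  have h3 := (abs_lt.1 h1).1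
  have hv : 13 / 16 < 1 + v := by linarith
  rw [logBump, if_pos (by linarith), norm_mul, Complex.norm_exp]
  have h4 : (-(1 / 2 + τ * I : ℂ) * Real.log (1 + v)).re = -(1 / 2) * Real.log (1 + v) := by
    rw [re_mul_ofReal]
    simp
  have h5 := Real.one_sub_inv_le_log_of_pos (by linarith : 0 < 1 + v)
  have h6 : (1 + v)⁻¹ ≤ 16 / 13 := by
    rw [inv_le_comm₀ (by linarith) (by norm_num)]
    linarith
  have h7 : Real.exp (-(1 / 2) * Real.log (1 + v)) ≤ 2 := by
    rw [← Real.le_log_iff_exp_le (by norm_num)]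
    linarith [Real.log_two_gt_d9]
  rw [h4]
  nlinarith [norm_le_one_of_smoothingKernel hη (G * Real.log (1 + v)), norm_nonneg (η (G * Real.log (1 + v)))]

lemma norm_integral_window_hzeta_div_le (hη : SmoothingKernel η κ) {G : ℝ} (hG : 4 ≤ G)
    (ha : 0 < a) (ha1 : a ≤ 1) (τ : ℝ) {Y : ℝ} (hY : 0 < Y) :
    ‖∫ t, (window κ G τ t : ℂ) * (hzeta a (1 / 2 + t * I) *
      ((Y : ℂ) ^ (1 / 2 + t * I : ℂ) / (1 / 2 + t * I)))‖ ≤ 4 / G := by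
  have hG0 : 0 < G := by linarith
  have hYc : (Y : ℂ) ≠ 0 := by exact_mod_cast hY.ne'
  have e1 : ∀ t : ℝ, (window κ G τ t : ℂ) * (hzeta a (1 / 2 + t * I) *
      ((Y : ℂ) ^ (1 / 2 + t * I : ℂ) / (1 / 2 + t * I))) =
      ∫ y in Set.Ioi (0 : ℝ), (Y * countDiff a y / y : ℂ) * ((window κ G τ t : ℂ) *
        ((y : ℂ) ^ (-(1 / 2 + t * I : ℂ)) * (Y : ℂ) ^ ((1 / 2 + t * I : ℂ) - 1))) := fun t => by
    have e0 : (window κ G τ t : ℂ) * (hzeta a (1 / 2 + t * I) *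
        ((Y : ℂ) ^ (1 / 2 + t * I : ℂ) / (1 / 2 + t * I))) =
        (window κ G τ t : ℂ) * (Y : ℂ) ^ (1 / 2 + t * I : ℂ) *
          (hzeta a (1 / 2 + t * I) / (1 / 2 + t * I)) := by ring
    rw [e0, hzeta_div_eq_integral ha ha1, ← integral_const_mul]
    refine setIntegral_congr_fun measurableSet_Ioi fun y hy => ?_
    have hyc : (y : ℂ) ≠ 0 := by exact_mod_cast (Set.mem_Ioi.1 hy).ne'
    rw [cpow_sub _ 1 hYc, cpow_sub _ 1 hyc, cpow_one, cpow_one]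
    field_simp
  simp_rw [e1]
  rw [integral_integral_swap]
  · have e2 : ∀ y ∈ Set.Ioi (0 : ℝ), ∫ t, (Y * countDiff a y / y : ℂ) * ((window κ G τ t : ℂ) *
        ((y : ℂ) ^ (-(1 / 2 + t * I : ℂ)) * (Y : ℂ) ^ ((1 / 2 + t * I : ℂ) - 1))) =
        (countDiff a y / y : ℂ) * logBump η G τ (y / Y - 1) := fun y hy => by
      rw [integral_const_mul, integral_window_mul_cpow hη hG0 τ hy hY]
      field_simp
    rw [setIntegral_congr_fun measurableSet_Ioi e2]
    set d := 3 / 4 / G with hd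
    have hd1 : d ≤ 3 / 16 := by
      rw [hd, div_le_iff₀ (by linarith)]
      linarith
    have hd0 : 0 < d := by positivity
    have e3 : ∫ y in Set.Ioi (0 : ℝ), (countDiff a y / y : ℂ) * logBump η G τ (y / Y - 1) =
        ∫ y in Set.Icc (Y * (1 - d)) (Y * (1 + d)),
          (countDiff a y / y : ℂ) * logBump η G τ (y / Y - 1) := by
      refine setIntegral_eq_of_subset_of_forall_sdiff_eq_zero measurableSet_Ioi ?_ ?_
      · exact fun y hy => lt_of_lt_of_le (mul_pos hY (by linarith)) hy.1
      · intro y hy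
        by_contra! h
        have h1 := abs_lt.1 (abs_le_one_of_logBump_ne_zero hη hG (right_ne_zero_of_mul h))
        refine hy.2 ⟨?_, ?_⟩
        · rw [← le_div_iff₀' hY]; linarith [h1.1]
        · rw [← div_le_iff₀' hY]; linarith [h1.2]
    rw [e3]
    refine (norm_setIntegral_le_of_norm_le_const (C := 1 / (Y * (1 - d)) * 2)
      (by simp) fun y hy => ?_).trans ?_
    · have hy1 : 0 < Y * (1 - d) := mul_pos hY (by linarith)
      have hy0 : 0 < y := hy1.trans_le hy.1
      rw [norm_mul, norm_div, norm_real, norm_real, Real.norm_eq_abs, Real.norm_eq_abs,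
        abs_of_pos hy0]
      gcongr
      · exact abs_countDiff_le_one ha ha1 hy0.le
      · exact hy.1
      · exact norm_logBump_le hη hG _ _
    · rw [Real.volume_real_Icc_of_le (by nlinarith)]
      have h1 : (1 - d) ≠ 0 := by linarith
      have : 1 / (Y * (1 - d)) * 2 * (Y * (1 + d) - Y * (1 - d)) = 4 * d / (1 - d) := by
        field_simp
        ring
      rw [this, div_le_iff₀ (by linarith), hd]
      rw [hd] at hd1
      rw [show 4 * (3 / 4 / G) = 4 / G * (3 / 4) by ring]
      gcongr
      linarith
  · have h1 : Integrable (fun t => window κ G τ t) := by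
      have := integrable_window_mul hη hG0 τ (F := fun _ => 1) (C := 1)
        aestronglyMeasurable_const fun t => by
          rw [norm_one, one_mul]
          exact one_le_pow₀ (by linarith [abs_nonneg t])
      simpa using this.re
    refine ((h1.mul_prod (integrableOn_countDiff ha ha1)).mul_const (Y ^ (1 / 2 : ℝ))).mono' ?_ ?_
    · have := hη.continuous.measurable
      have := measurable_countDiff (a := a)
      refine Measurable.aestronglyMeasurable ?_
      unfold window Function.uncurry
      fun_prop
    · have h3 : ∀ᵐ p ∂((volume : Measure ℝ).prod (volume.restrict (Set.Ioi (0 : ℝ)))),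
          0 < p.2 := by
        have := (Measure.quasiMeasurePreserving_snd (μ := (volume : Measure ℝ))
          (ν := volume.restrict (Set.Ioi (0 : ℝ)))).ae
          ((ae_restrict_mem measurableSet_Ioi).mono fun w hw => hw)
        exact this
      filter_upwards [h3] with p hp
      have e2 : p.2 ^ (-(3 / 2) : ℝ) = p.2 ^ (-(1 / 2) : ℝ) / p.2 := by
        rw [← Real.rpow_sub_one hp.ne']
        norm_num
      have e3 : Y ^ (1 / 2 : ℝ) = Y * Y ^ (-(1 / 2) : ℝ) := by
        nth_rewrite 2 [← Real.rpow_one Y]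
        rw [← Real.rpow_add hY]
        norm_num
      have hr : (-(1 / 2 + p.1 * I : ℂ)).re = -(1 / 2) := by norm_num
      simp only [Function.uncurry, norm_mul, norm_div, norm_real, Real.norm_eq_abs,
        abs_of_nonneg (window_nonneg hη hG0 _ _), norm_cpow_eq_rpow_re_of_pos hp,
        norm_cpow_half Y hY, hr, abs_of_pos hp, abs_of_pos hY, e2, e3]
      refine le_of_eq ?_
      ring

end

section

variable {η : ℝ → ℂ} {κ : ℝ → ℝ} {a : ℝ}

lemma exists_summable_invSq_lattice (ha : 0 < a) : ∃ C, 0 < C ∧ ∀ G τ : ℝ, 4 ≤ G →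
    |τ| ≤ 2 * G ^ 2 →
    Summable (fun p : ℕ × ℕ => invSq ((τ + 2 * Real.pi * (p.2 + 1) * (p.1 + a)) / G)) ∧
    ∑' p : ℕ × ℕ, invSq ((τ + 2 * Real.pi * (p.2 + 1) * (p.1 + a)) / G) ≤
      C * (G * Real.log G) := by
  obtain ⟨C, hC, h⟩ := exists_tsum_invSq_lattice_le ha
  refine ⟨C, hC, fun G τ hG hτ => ?_⟩
  have h1 := h G τ hG hτ
  rw [← ENNReal.tsum_prod (f := fun n k : ℕ =>
    ENNReal.ofReal (invSq ((τ + 2 * Real.pi * (k + 1) * (n + a)) / G)))] at h1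
  have hs : Summable (fun p : ℕ × ℕ => invSq ((τ + 2 * Real.pi * (p.2 + 1) * (p.1 + a)) / G)) :=
    (ENNReal.summable_toReal (h1.trans_lt ENNReal.ofReal_lt_top).ne).congr fun p =>
      ENNReal.toReal_ofReal (invSq_nonneg _)
  refine ⟨hs, ?_⟩
  rw [← ENNReal.ofReal_tsum_of_nonneg (fun _ => invSq_nonneg _) hs] at h1
  have := Real.log_nonneg (by linarith : 1 ≤ G)
  exact (ENNReal.ofReal_le_ofReal_iff (by positivity)).1 h1

/-- The lattice weight dominating `oscPair`. -/
noncomputable def latticeWeight (G a τ : ℝ) (p : ℕ × ℕ) : ℝ :=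
  invSq ((τ + 2 * Real.pi * (p.2 + 1) * (p.1 + a)) / G) +
    invSq ((τ - 2 * Real.pi * (p.2 + 1) * (p.1 + a)) / G)

lemma exists_summable_latticeWeight (ha : 0 < a) : ∃ C, 0 < C ∧ ∀ G τ : ℝ, 4 ≤ G →
    |τ| ≤ 2 * G ^ 2 → Summable (latticeWeight G a τ) ∧
    ∑' p, latticeWeight G a τ p ≤ C * (G * Real.log G) := by
  obtain ⟨C, hC, h⟩ := exists_summable_invSq_lattice ha
  refine ⟨2 * C, by positivity, fun G τ hG hτ => ?_⟩
  obtain ⟨h1, h2⟩ := h G τ hG hτ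
  obtain ⟨h3, h4⟩ := h G (-τ) hG (by rwa [abs_neg])
  have e : ∀ p : ℕ × ℕ, invSq ((-τ + 2 * Real.pi * (p.2 + 1) * (p.1 + a)) / G) =
      invSq ((τ - 2 * Real.pi * (p.2 + 1) * (p.1 + a)) / G) := fun p => by
    rw [← invSq_neg]
    congr 1
    ring
  simp only [e] at h3 h4
  refine ⟨h1.add h3, ?_⟩
  have := h1.tsum_add h3
  simp only [latticeWeight]
  rw [this]
  linarith

lemma exists_norm_oscPair_le (hη : SmoothingKernel η κ) : ∃ C, 0 < C ∧ ∀ G τ a : ℝ, 4 ≤ G →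
    |τ| ≤ 2 * G ^ 2 → ∀ p : ℕ × ℕ,
      ‖oscPair η G a τ p.1 p.2‖ ≤ C / G * latticeWeight G a τ p := by
  obtain ⟨C, hC, h⟩ := exists_norm_oscInt_le_invSq hη
  refine ⟨C, hC, fun G τ a hG hτ p => ?_⟩
  rw [latticeWeight, mul_add]
  exact (norm_add_le _ _).trans (add_le_add (h _ _ _ hG hτ) (h _ _ _ hG hτ))

/-- The windowed correlation of `hzeta` on the lines of abscissae `1 / 2` and `1 / 2 + j`. -/
noncomputable def zetaCorr (κ : ℝ → ℝ) (G a : ℝ) (j : ℕ) (τ : ℝ) : ℂ :=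
  ∫ t, (window κ G τ t : ℂ) * (hzeta a (1 / 2 + t * I) *
    (starRingEnd ℂ) (hzeta a (1 / 2 + j + t * I)))

lemma conj_cpow_ofReal {x : ℝ} (hx : 0 < x) (w : ℂ) :
    (starRingEnd ℂ) ((x : ℂ) ^ w) = (x : ℂ) ^ ((starRingEnd ℂ) w) := by
  have hxc : (x : ℂ) ≠ 0 := by exact_mod_cast hx.ne'
  rw [cpow_def_of_ne_zero hxc, cpow_def_of_ne_zero hxc, ← Complex.exp_conj, map_mul,
    ← ofReal_log hx.le, conj_ofReal]

lemma hasSum_conj_hzeta (ha : 0 < a) (ha1 : a ≤ 1) {j : ℕ} (hj : 1 ≤ j) (t : ℝ) :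
    HasSum (fun n : ℕ => ((((n + a : ℝ) ^ j)⁻¹ : ℝ) : ℂ) *
      ((n + a : ℝ) : ℂ) ^ ((1 / 2 + t * I : ℂ) - 1))
      ((starRingEnd ℂ) (hzeta a (1 / 2 + j + t * I))) := by
  have hre : 1 < (1 / 2 + j + t * I : ℂ).re := by
    have : (1 : ℝ) ≤ j := by exact_mod_cast hj
    norm_num
    linarith
  refine (Complex.hasSum_conj'.2 (hasSum_hzeta ha ha1 hre)).congr_fun fun n => ?_
  have hx : 0 < (n + a : ℝ) := by positivity
  have hxc : ((n + a : ℝ) : ℂ) ≠ 0 := by exact_mod_cast hx.ne'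
  rw [conj_cpow_ofReal hx]
  have e : (starRingEnd ℂ) (-(1 / 2 + j + t * I : ℂ)) = ((1 / 2 + t * I : ℂ) - 1) - (j : ℂ) := by
    simp only [map_neg, map_add, map_mul, conj_ofReal, conj_I, map_one, map_div₀, map_ofNat,
      map_natCast]
    ring
  rw [e, cpow_sub _ (j : ℂ) hxc, cpow_natCast]
  push_cast
  exact (div_eq_inv_mul _ _).symm

lemma integrable_window_mul_hzeta_mul (hη : SmoothingKernel η κ) {G : ℝ} (hG : 0 < G)
    (ha : 0 < a) (ha1 : a ≤ 1) (τ : ℝ) {f : ℝ → ℂ} (hf : Continuous f) {C : ℝ}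
    (hb : ∀ t, ‖f t‖ ≤ C * (1 + |t|)) :
    Integrable fun t => (window κ G τ t : ℂ) * (hzeta a (1 / 2 + t * I) * f t) := by
  obtain ⟨D, hD, h⟩ := exists_norm_hzeta_le ha ha1
  refine integrable_window_mul hη hG τ (C := D * |C|)
    (continuous_hzeta_half.mul hf).aestronglyMeasurable fun t => ?_
  have h0 : 1 ≤ 1 + |t| := by linarith [abs_nonneg t]
  have hb' : ‖f t‖ ≤ |C| * (1 + |t|) := (hb t).trans (by gcongr; exact le_abs_self C)
  rw [norm_mul]
  calc ‖hzeta a (1 / 2 + t * I)‖ * ‖f t‖ ≤ (D * (1 + |t|)) * (|C| * (1 + |t|)) := by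
        gcongr
        exact h t
    _ = D * |C| * (1 + |t|) ^ 2 := by ring
    _ ≤ _ := by
        gcongr _ * ?_
        exact pow_le_pow_right₀ h0 (by norm_num)

lemma hasSum_zetaCorr (hη : SmoothingKernel η κ) {G : ℝ} (hG : 0 < G) (ha : 0 < a) (ha1 : a ≤ 1)
    {j : ℕ} (hj : 1 ≤ j) (τ : ℝ) :
    HasSum (fun n : ℕ => ((((n + a : ℝ) ^ j)⁻¹ : ℝ) : ℂ) * zetaMean κ G a τ (n + a))
      (zetaCorr κ G a j τ) := by
  have hx : ∀ n : ℕ, 0 < (n + a : ℝ) := fun n => by positivity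
  have hInt : ∀ n : ℕ, Integrable fun t => (window κ G τ t : ℂ) * (hzeta a (1 / 2 + t * I) *
      (((((n + a : ℝ) ^ j)⁻¹ : ℝ) : ℂ) * ((n + a : ℝ) : ℂ) ^ ((1 / 2 + t * I : ℂ) - 1))) := by
    intro n
    refine integrable_window_mul_hzeta_mul hη hG ha ha1 τ
      (C := ((n + a : ℝ) ^ j)⁻¹ * (n + a : ℝ) ^ (-(1 / 2) : ℝ))
      (continuous_const.mul (continuous_cpow_half (hx n) (by fun_prop))) fun t => ?_
    have := hx n
    rw [norm_mul, norm_cpow_half _ (hx n), norm_real, Real.norm_of_nonneg (by positivity)]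
    exact le_mul_of_one_le_right (by positivity) (by linarith [abs_nonneg t])
  have h1 := hasSum_integral_of_summable_integral_norm hInt ?_
  · have e1 : ∀ n : ℕ, ∫ t, (window κ G τ t : ℂ) * (hzeta a (1 / 2 + t * I) *
        (((((n + a : ℝ) ^ j)⁻¹ : ℝ) : ℂ) * ((n + a : ℝ) : ℂ) ^ ((1 / 2 + t * I : ℂ) - 1))) =
        ((((n + a : ℝ) ^ j)⁻¹ : ℝ) : ℂ) * zetaMean κ G a τ (n + a) := fun n => by
      rw [zetaMean, ← integral_const_mul]
      congr 1
      ext t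
      ring
    simp only [e1] at h1
    have e2 : zetaCorr κ G a j τ = ∫ t, ∑' n : ℕ, (window κ G τ t : ℂ) *
        (hzeta a (1 / 2 + t * I) *
        (((((n + a : ℝ) ^ j)⁻¹ : ℝ) : ℂ) * ((n + a : ℝ) : ℂ) ^ ((1 / 2 + t * I : ℂ) - 1))) := by
      unfold zetaCorr
      congr 1
      ext t
      rw [tsum_mul_left, tsum_mul_left, (hasSum_conj_hzeta ha ha1 hj t).tsum_eq]
    rwa [e2]
  · have hs : Summable fun n : ℕ => (∫ t, ‖(window κ G τ t : ℂ) * hzeta a (1 / 2 + t * I)‖) *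
        (((n + a : ℝ) ^ j)⁻¹ * (n + a : ℝ) ^ (-(1 / 2) : ℝ)) := by
      refine Summable.mul_left _ ?_
      have hj' : (1 : ℝ) ≤ j := by exact_mod_cast hj
      refine (summable_nat_add_rpow ha (σ := j + 1 / 2) (by linarith)).congr fun n => ?_
      rw [← Real.rpow_natCast, ← Real.rpow_neg (hx n).le, ← Real.rpow_add (hx n)]
      congr 1
      ring
    refine hs.congr fun n => ?_
    rw [← integral_mul_const]
    congr 1
    ext t
    have := hx n
    simp only [norm_mul]
    rw [norm_cpow_half _ (hx n), norm_real (((n + a : ℝ) ^ j)⁻¹),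
      Real.norm_of_nonneg (by positivity : 0 ≤ (((n + a : ℝ) ^ j)⁻¹))]
    ring

lemma conj_zetaApprox (ha : 0 < a) (N : ℕ) (t : ℝ) :
    (starRingEnd ℂ) (zetaApprox a (1 / 2 + t * I) N) =
      ∑ n ∈ range N, ((n + a : ℝ) : ℂ) ^ ((1 / 2 + t * I : ℂ) - 1) -
        ((N + a : ℝ) : ℂ) ^ (1 / 2 + t * I : ℂ) / (1 / 2 + t * I) := by
  have hx : ∀ n : ℕ, 0 < (n + a : ℝ) := fun n => by positivity
  have e1 : (starRingEnd ℂ) (-(1 / 2 + t * I : ℂ)) = (1 / 2 + t * I : ℂ) - 1 := by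
    simp only [map_neg, map_add, map_mul, conj_ofReal, conj_I, map_one, map_div₀, map_ofNat]
    ring
  have e2 : (starRingEnd ℂ) (1 - (1 / 2 + t * I : ℂ)) = 1 / 2 + t * I := by
    simp only [map_sub, map_add, map_mul, conj_ofReal, conj_I, map_one, map_div₀, map_ofNat]
    ring
  rw [zetaApprox, map_sub, map_sum, map_div₀, conj_cpow_ofReal (hx N), e2]
  congr 1
  exact Finset.sum_congr rfl fun n _ => by rw [conj_cpow_ofReal (hx n), e1]

lemma exists_tendsto_zetaCorr_zero (hη : SmoothingKernel η κ) {G : ℝ} (hG : 4 ≤ G) (ha : 0 < a)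
    (ha1 : a ≤ 1) (τ : ℝ) : ∃ D : ℕ → ℂ, (∀ N, ‖D N‖ ≤ 4 / G) ∧
    Tendsto (fun N : ℕ => ∑ n ∈ range N, zetaMean κ G a τ (n + a) - D N) atTop
      (nhds (zetaCorr κ G a 0 τ)) := by
  have hG0 : 0 < G := by linarith
  have hx : ∀ n : ℕ, 0 < (n + a : ℝ) := fun n => by positivity
  have hs0 : ∀ t : ℝ, (1 / 2 + t * I : ℂ) ≠ 0 := fun t h => by
    have := half_add_mul_I_re t
    rw [h] at this
    norm_num at this
  obtain ⟨C, hC, hb⟩ := exists_norm_zetaApprox_le ha ha1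
  obtain ⟨B, hB, hb'⟩ := exists_norm_hzeta_le ha ha1
  refine ⟨fun N => ∫ t, (window κ G τ t : ℂ) * (hzeta a (1 / 2 + t * I) *
      (((N + a : ℝ) : ℂ) ^ (1 / 2 + t * I : ℂ) / (1 / 2 + t * I))), fun N =>
      norm_integral_window_hzeta_div_le hη hG ha ha1 τ (hx N), ?_⟩
  have h1 : ∀ n : ℕ, Integrable fun t => (window κ G τ t : ℂ) * (hzeta a (1 / 2 + t * I) *
      ((n + a : ℝ) : ℂ) ^ ((1 / 2 + t * I : ℂ) - 1)) := fun n => by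
    refine integrable_window_mul_hzeta_mul hη hG0 ha ha1 τ (C := (n + a : ℝ) ^ (-(1 / 2) : ℝ))
      (continuous_cpow_half (hx n) (by fun_prop)) fun t => ?_
    rw [norm_cpow_half _ (hx n)]
    exact le_mul_of_one_le_right (Real.rpow_nonneg (hx n).le _) (by linarith [abs_nonneg t])
  have h2 : ∀ N : ℕ, Integrable fun t => (window κ G τ t : ℂ) * (hzeta a (1 / 2 + t * I) *
      (((N + a : ℝ) : ℂ) ^ (1 / 2 + t * I : ℂ) / (1 / 2 + t * I))) := fun N => by
    refine integrable_window_mul_hzeta_mul hη hG0 ha ha1 τ (C := (N + a : ℝ) ^ (1 / 2 : ℝ) * 2)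
      ((continuous_cpow_half (hx N) (by fun_prop)).div (by fun_prop) hs0) fun t => ?_
    have hr := half_add_mul_I_re t
    rw [norm_div, norm_cpow_eq_rpow_re_of_pos (hx N), hr]
    have h3 : 1 / 2 ≤ ‖(1 / 2 + t * I : ℂ)‖ := by
      have := abs_re_le_norm (1 / 2 + t * I : ℂ)
      rwa [hr, abs_of_pos (by norm_num)] at this
    have h4 := Real.rpow_nonneg (hx N).le (1 / 2)
    calc (N + a : ℝ) ^ (1 / 2 : ℝ) / ‖(1 / 2 + t * I : ℂ)‖
        ≤ (N + a : ℝ) ^ (1 / 2 : ℝ) / (1 / 2) := by gcongr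
      _ = (N + a : ℝ) ^ (1 / 2 : ℝ) * 2 := by ring
      _ ≤ _ := le_mul_of_one_le_right (by positivity) (by linarith [abs_nonneg t])
  have e1 : ∀ N : ℕ, ∫ t, (window κ G τ t : ℂ) * (hzeta a (1 / 2 + t * I) *
      (starRingEnd ℂ) (zetaApprox a (1 / 2 + t * I) N)) =
      ∑ n ∈ range N, zetaMean κ G a τ (n + a) - ∫ t, (window κ G τ t : ℂ) *
        (hzeta a (1 / 2 + t * I) *
        (((N + a : ℝ) : ℂ) ^ (1 / 2 + t * I : ℂ) / (1 / 2 + t * I))) := fun N => by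
    simp only [zetaMean]
    rw [← integral_finsetSum _ fun n _ => h1 n,
      ← integral_sub (integrable_finsetSum _ fun n _ => h1 n) (h2 N)]
    congr 1
    ext t
    rw [conj_zetaApprox ha, mul_sub, mul_sub, Finset.mul_sum, Finset.mul_sum]
  simp only [← e1, zetaCorr, Nat.cast_zero, add_zero]
  have hInt := integrable_window_mul hη hG0 τ
    (F := fun t => ((B * (1 + |t|) * (C * (1 + |t|)) : ℝ) : ℂ))
    (C := B * C) (by fun_prop) fun t => by
      rw [norm_real, Real.norm_eq_abs, abs_of_nonneg (by positivity)]
      calc B * (1 + |t|) * (C * (1 + |t|)) = B * C * (1 + |t|) ^ 2 := by ring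
        _ ≤ _ := by
          gcongr _ * ?_
          exact pow_le_pow_right₀ (by linarith [abs_nonneg t]) (by norm_num)
  refine tendsto_integral_of_dominated_convergence _ (fun N => ?_) hInt.norm (fun N => ?_) ?_
  · exact ((continuous_ofReal.comp (continuous_window hη G τ)).mul
      (continuous_hzeta_half.mul
        (continuous_conj.comp (continuous_zetaApprox ha N)))).aestronglyMeasurable
  · refine .of_forall fun t => ?_
    simp only [norm_mul, RCLike.norm_conj]
    gcongr
    rw [norm_real, Real.norm_eq_abs, abs_of_nonneg (by positivity)]
    exact mul_le_mul (hb' t) (hb N t) (norm_nonneg _) (by positivity)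
  · refine .of_forall fun t => ?_
    refine Tendsto.const_mul _ (Tendsto.const_mul _ ?_)
    exact (continuous_conj.tendsto _).comp
      (tendsto_zetaApprox ha ha1 (by norm_num) (half_add_mul_I_ne_one t))

lemma norm_zetaCorr_sub_tsum_zetaMean_le (hη : SmoothingKernel η κ) {G : ℝ} (hG : 4 ≤ G)
    (ha : 0 < a) (ha1 : a ≤ 1) (j : ℕ) (τ : ℝ)
    (hs : Summable fun n : ℕ => ((((n + a : ℝ) ^ j)⁻¹ : ℝ) : ℂ) * zetaMean κ G a τ (n + a)) :
    ‖zetaCorr κ G a j τ -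
      ∑' n : ℕ, ((((n + a : ℝ) ^ j)⁻¹ : ℝ) : ℂ) * zetaMean κ G a τ (n + a)‖ ≤ 4 / G := by
  have hG0 : 0 < G := by linarith
  rcases Nat.eq_zero_or_pos j with rfl | hj
  · simp only [pow_zero, inv_one, ofReal_one, one_mul] at hs ⊢
    obtain ⟨D, hD, hlim⟩ := exists_tendsto_zetaCorr_zero hη hG ha ha1 τ
    have h1 := (hlim.sub hs.hasSum.tendsto_sum_nat).norm
    refine le_of_tendsto h1 (.of_forall fun N => ?_)
    rw [sub_sub_cancel_left, norm_neg]
    exact hD N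
  · rw [(hasSum_zetaCorr hη hG0 ha ha1 hj τ).tsum_eq, sub_self, norm_zero]
    positivity

end

section

variable {η : ℝ → ℂ} {κ : ℝ → ℝ} {a : ℝ}

/-- The weight `(n + a) ^ (-j)` of the lattice point `(n, k)`. -/
noncomputable def latticeCoeff (a : ℝ) (j : ℕ) (p : ℕ × ℕ) : ℝ := ((p.1 + a : ℝ) ^ j)⁻¹

lemma latticeCoeff_nonneg (ha : 0 < a) (j : ℕ) (p : ℕ × ℕ) : 0 ≤ latticeCoeff a j p := by
  unfold latticeCoeff
  positivity

lemma latticeCoeff_le (ha : 0 < a) (j : ℕ) (p : ℕ × ℕ) : latticeCoeff a j p ≤ (a ^ j)⁻¹ := by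
  unfold latticeCoeff
  gcongr
  linarith [Nat.cast_nonneg (α := ℝ) p.1]

lemma one_le_log_of_four_le {G : ℝ} (hG : 4 ≤ G) : 1 ≤ Real.log G := by
  rw [Real.le_log_iff_exp_le (by linarith)]
  linarith [Real.exp_one_lt_d9]

lemma exists_zetaCorr_approx (hη : SmoothingKernel η κ) (ha : 0 < a) (ha1 : a ≤ 1) (j : ℕ) :
    ∃ C, 0 < C ∧ ∀ G τ : ℝ, 4 ≤ G → |τ| ≤ 2 * G ^ 2 →
      Summable (fun p : ℕ × ℕ => (latticeCoeff a j p : ℂ) * oscPair η G a τ p.1 p.2) ∧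
      ‖zetaCorr κ G a j τ - ∑' p : ℕ × ℕ, (latticeCoeff a j p : ℂ) * oscPair η G a τ p.1 p.2‖ ≤
        4 / G ∧ ‖zetaCorr κ G a j τ‖ ≤ C * Real.log G := by
  obtain ⟨C, hC, h⟩ := exists_summable_latticeWeight ha
  obtain ⟨D, hD, h'⟩ := exists_norm_oscPair_le hη
  refine ⟨4 + (a ^ j)⁻¹ * D * C, by positivity, fun G τ hG hτ => ?_⟩
  have hG0 : 0 < G := by linarith
  obtain ⟨hs, hsum⟩ := h G τ hG hτ
  have hb : ∀ p : ℕ × ℕ, ‖(latticeCoeff a j p : ℂ) * oscPair η G a τ p.1 p.2‖ ≤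
      (a ^ j)⁻¹ * (D / G) * latticeWeight G a τ p := fun p => by
    rw [norm_mul, norm_real, Real.norm_of_nonneg (latticeCoeff_nonneg ha j p), mul_assoc]
    exact mul_le_mul (latticeCoeff_le ha j p) (h' G τ a hG hτ p) (norm_nonneg _) (by positivity)
  have hsb := hs.mul_left ((a ^ j)⁻¹ * (D / G))
  have hS : Summable (fun p : ℕ × ℕ => (latticeCoeff a j p : ℂ) * oscPair η G a τ p.1 p.2) :=
    Summable.of_norm_bounded hsb hb
  have e1 : ∀ n : ℕ, ((((n + a : ℝ) ^ j)⁻¹ : ℝ) : ℂ) * zetaMean κ G a τ (n + a) =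
      ∑' k : ℕ, (latticeCoeff a j (n, k) : ℂ) * oscPair η G a τ n k := fun n => by
    rw [zetaMean_eq_tsum hη hG hτ ha ha1, ← tsum_mul_left]
    rfl
  have h1 := norm_zetaCorr_sub_tsum_zetaMean_le hη hG ha ha1 j τ (by
    simp only [e1]
    exact hS.prod)
  simp only [e1] at h1
  rw [← hS.tsum_prod] at h1
  refine ⟨hS, h1, ?_⟩
  have h2 := norm_le_insert' (zetaCorr κ G a j τ)
    (∑' p : ℕ × ℕ, (latticeCoeff a j p : ℂ) * oscPair η G a τ p.1 p.2)
  have h3 := tsum_of_norm_bounded hsb.hasSum hb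
  rw [tsum_mul_left] at h3
  have h4 : (a ^ j)⁻¹ * (D / G) * ∑' p, latticeWeight G a τ p ≤
      (a ^ j)⁻¹ * (D / G) * (C * (G * Real.log G)) := by gcongr
  have h5 : (a ^ j)⁻¹ * (D / G) * (C * (G * Real.log G)) = (a ^ j)⁻¹ * D * C * Real.log G := by
    field_simp
  have h6 : 4 / G ≤ 4 * Real.log G := by
    have h7 := one_le_log_of_four_le hG
    have h8 : 4 / G ≤ 4 := div_le_self (by norm_num) (by linarith)
    linarith
  linarith

lemma invSq_le_mul_invSq_add (x y : ℝ) : invSq x ≤ (1 + |y|) ^ 2 * invSq (x + y) := by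
  unfold invSq
  rw [← div_eq_mul_inv, le_div_iff₀ (by positivity), inv_mul_le_iff₀ (by positivity), ← mul_pow]
  refine pow_le_pow_left₀ (by positivity) ?_ 2
  nlinarith [abs_add_le x y, abs_nonneg x, abs_nonneg y, mul_nonneg (abs_nonneg x) (abs_nonneg y)]

lemma latticeWeight_le (hG : 0 < G) (a : ℝ) {τ T : ℝ} (hτ : |τ| ≤ T) (p : ℕ × ℕ) :
    latticeWeight G a τ p ≤ (1 + T / G) ^ 2 * latticeWeight G a 0 p := by
  have hτ' : |-τ / G| ≤ T / G := by
    rw [abs_div, abs_neg, abs_of_pos hG]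
    gcongr
  have h : ∀ ξ : ℝ, invSq ((τ + ξ) / G) ≤ (1 + T / G) ^ 2 * invSq ((0 + ξ) / G) := fun ξ => by
    have h1 := invSq_le_mul_invSq_add ((τ + ξ) / G) (-τ / G)
    rw [show (τ + ξ) / G + -τ / G = (0 + ξ) / G by ring] at h1
    refine h1.trans ?_
    have := invSq_nonneg ((0 + ξ) / G)
    gcongr
  simp only [latticeWeight, sub_eq_add_neg]
  rw [mul_add ((1 + T / G) ^ 2)]
  exact add_le_add (h _) (h _)

lemma stronglyMeasurable_zetaCorr (hη : SmoothingKernel η κ) (G a : ℝ) (j : ℕ) :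
    StronglyMeasurable (zetaCorr κ G a j) := by
  have h1 : Continuous fun t : ℝ => hzeta a (1 / 2 + j + t * I) := by
    have := continuous_hzeta_line (a := a) (σ := 1 / 2 + j) (fun h => by
      have h2 : (j : ℝ) * 2 = 1 := by linarith
      have h3 : j * 2 = 1 := by exact_mod_cast h2
      omega)
    simpa using this
  have h2 := hη.continuous
  have h3 : Continuous fun p : ℝ × ℝ => (window κ G p.1 p.2 : ℂ) * (hzeta a (1 / 2 + p.2 * I) *
      (starRingEnd ℂ) (hzeta a (1 / 2 + j + p.2 * I))) := by
    refine Continuous.mul ?_ (Continuous.mul ?_ ?_)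
    · unfold window
      fun_prop
    · exact continuous_hzeta_half.comp continuous_snd
    · exact continuous_conj.comp (h1.comp continuous_snd)
  exact h3.stronglyMeasurable.integral_prod_right'

/-- The lattice points `(n, k)` with `2 * π * (k + 1) * (n + a) ≤ T`, weighted by
`(n + a) ^ (-j)`. -/
noncomputable def latticeCount (a : ℝ) (j : ℕ) (T : ℝ) : ℝ :=
  ∑' p : ℕ × ℕ, if 2 * Real.pi * (p.2 + 1) * (p.1 + a) ≤ T then latticeCoeff a j p else 0

lemma exists_integral_zetaCorr_approx (hη : SmoothingKernel η κ) (ha : 0 < a) (ha1 : a ≤ 1)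
    (j : ℕ) : ∃ C, 0 < C ∧ ∀ G T : ℝ, 4 ≤ G → 0 ≤ T → T ≤ 2 * G ^ 2 →
      ‖(∫ τ in (0 : ℝ)..T, zetaCorr κ G a j τ) - (2 * Real.pi * latticeCount a j T : ℝ)‖ ≤
        C * (G * Real.log G) := by
  obtain ⟨B, hB, hcorr⟩ := exists_zetaCorr_approx hη ha ha1 j
  obtain ⟨C, hC, hlat⟩ := exists_summable_latticeWeight ha
  obtain ⟨D, hD, hosc⟩ := exists_norm_oscPair_le hη
  obtain ⟨E, hE, hInt⟩ := exists_integral_oscInt_bound hη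
  refine ⟨8 + (a ^ j)⁻¹ * E * (2 * C), by positivity, fun G T hG hT hTG => ?_⟩
  have hG0 : 0 < G := by linarith
  have hlog := one_le_log_of_four_le hG
  have hu : Set.uIoc 0 T = Set.Ioc 0 T := Set.uIoc_of_le hT
  have hτ : ∀ τ ∈ Set.uIoc 0 T, |τ| ≤ T := fun τ h => by
    rw [hu] at h
    rw [abs_of_pos h.1]
    exact h.2
  have h0 : |(0 : ℝ)| ≤ 2 * G ^ 2 := by rw [abs_zero]; positivity
  set F : ℕ × ℕ → ℝ → ℂ := fun p τ => (latticeCoeff a j p : ℂ) * oscPair η G a τ p.1 p.2 with hF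
  have hJ : ∀ ξ, Continuous fun τ => oscInt η G τ ξ := continuous_oscInt hη hG
  have hFc : ∀ p, Continuous (F p) := fun p => by
    rw [hF]
    unfold oscPair
    exact continuous_const.mul ((hJ _).add (hJ _))
  have hs0 := (hlat G 0 hG h0).1
  have hbound : ∀ p τ, |τ| ≤ T → ‖F p τ‖ ≤
      (a ^ j)⁻¹ * (D / G) * ((1 + T / G) ^ 2 * latticeWeight G a 0 p) := fun p τ h => by
    rw [hF]
    simp only
    rw [norm_mul, norm_real, Real.norm_of_nonneg (latticeCoeff_nonneg ha j p), mul_assoc]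
    refine mul_le_mul (latticeCoeff_le ha j p)
      ((hosc G τ a hG (h.trans hTG) p).trans ?_) (norm_nonneg _) (by positivity)
    gcongr
    exact latticeWeight_le hG0 a h p
  have hsumF : HasSum (fun p => ∫ τ in (0 : ℝ)..T, F p τ)
      (∫ τ in (0 : ℝ)..T, ∑' p, F p τ) := by
    refine intervalIntegral.hasSum_integral_of_dominated_convergence
      (bound := fun p _ => (a ^ j)⁻¹ * (D / G) * ((1 + T / G) ^ 2 * latticeWeight G a 0 p))
      (fun p => (hFc p).aestronglyMeasurable) (fun p => .of_forall fun τ h => hbound p τ (hτ τ h))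
      (.of_forall fun τ h => (hs0.mul_left _).mul_left _) intervalIntegrable_const
      (.of_forall fun τ h => (hcorr G τ hG ((hτ τ h).trans hTG)).1.hasSum)
  have hterm : ∀ p : ℕ × ℕ, ‖(∫ τ in (0 : ℝ)..T, F p τ) -
      ((2 * Real.pi * if 2 * Real.pi * (p.2 + 1) * (p.1 + a) ≤ T then latticeCoeff a j p else 0 :
        ℝ) : ℂ)‖ ≤ (a ^ j)⁻¹ * E * (latticeWeight G a T p + latticeWeight G a 0 p) := fun p => by
    set ξ : ℝ := 2 * Real.pi * (p.2 + 1) * (p.1 + a) with hξ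
    have hξ0 : 0 < ξ := by
      have := Real.pi_pos
      positivity
    have h1 := hInt G T ξ hG hT hTG
    have h2 := hInt G T (-ξ) hG hT hTG
    rw [if_neg (by rintro ⟨h, -⟩; linarith)] at h1
    rw [neg_neg] at h2
    have e1 : (∫ τ in (0 : ℝ)..T, F p τ) - ((2 * Real.pi * if ξ ≤ T then latticeCoeff a j p else 0 :
        ℝ) : ℂ) = (latticeCoeff a j p : ℂ) * (((∫ τ in (0 : ℝ)..T, oscInt η G τ ξ) - ((0 : ℝ) : ℂ)) +
          ((∫ τ in (0 : ℝ)..T, oscInt η G τ (-ξ)) -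
            ((if 0 ≤ ξ ∧ ξ ≤ T then 2 * Real.pi else 0 : ℝ) : ℂ))) := by
      rw [hF]
      simp only [oscPair, ← hξ]
      rw [intervalIntegral.integral_const_mul, intervalIntegral.integral_add
        ((hJ _).intervalIntegrable _ _) ((hJ _).intervalIntegrable _ _)]
      by_cases h : ξ ≤ T
      · rw [if_pos h, if_pos ⟨hξ0.le, h⟩]
        push_cast
        ring
      · rw [if_neg h, if_neg fun h' => h h'.2]
        push_cast
        ring
    rw [e1, norm_mul, norm_real, Real.norm_of_nonneg (latticeCoeff_nonneg ha j p), mul_assoc]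
    refine mul_le_mul (latticeCoeff_le ha j p) ((norm_add_le _ _).trans ?_) (norm_nonneg _)
      (by positivity)
    refine (add_le_add h1 h2).trans_eq ?_
    have e2 : ∀ x : ℝ, ((1 + |x| / G) ^ 2)⁻¹ = invSq (x / G) := fun x => by
      rw [invSq, abs_div, abs_of_pos hG0]
    rw [e2, e2, e2, e2, latticeWeight, latticeWeight, ← hξ, zero_add, zero_sub, sub_eq_add_neg]
    ring
  obtain ⟨hsT, hsT'⟩ := hlat G T hG (by rwa [abs_of_nonneg hT])
  have hs0' := (hlat G 0 hG h0).2
  have hsW := (hsT.add hs0).mul_left ((a ^ j)⁻¹ * E)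
  have hdiff := Summable.of_norm_bounded hsW hterm
  have hcount : HasSum (fun p : ℕ × ℕ => ((2 * Real.pi *
      if 2 * Real.pi * (p.2 + 1) * (p.1 + a) ≤ T then latticeCoeff a j p else 0 : ℝ) : ℂ))
      ((2 * Real.pi * latticeCount a j T : ℝ) : ℂ) := by
    have h1 := hsumF.summable.sub hdiff
    simp only [sub_sub_cancel] at h1
    have h2 := h1.hasSum
    rw [← ofReal_tsum, tsum_mul_left] at h2
    exact h2
  have hmain : ‖(∫ τ in (0 : ℝ)..T, ∑' p, F p τ) - (2 * Real.pi * latticeCount a j T : ℝ)‖ ≤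
      (a ^ j)⁻¹ * E * (2 * C) * (G * Real.log G) := by
    rw [← (hsumF.sub hcount).tsum_eq]
    refine (tsum_of_norm_bounded hsW.hasSum hterm).trans ?_
    rw [tsum_mul_left, hsT.tsum_add hs0, mul_assoc _ (2 * C)]
    gcongr
    linarith
  have hi1 : IntervalIntegrable (zetaCorr κ G a j) volume 0 T := by
    refine (intervalIntegrable_const (c := B * Real.log G)).mono_fun
      (stronglyMeasurable_zetaCorr hη G a j).aestronglyMeasurable ?_
    rw [Filter.EventuallyLE, ae_restrict_iff' measurableSet_uIoc]
    refine .of_forall fun τ h => ((hcorr G τ hG ((hτ τ h).trans hTG)).2.2).trans ?_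
    exact le_abs_self _
  have hi2 : IntervalIntegrable (fun τ => ∑' p, F p τ) volume 0 T := by
    refine ContinuousOn.intervalIntegrable (continuousOn_tsum (fun p => (hFc p).continuousOn)
      ((hs0.mul_left _).mul_left _) fun p τ h => hbound p τ ?_)
    rw [Set.uIcc_of_le hT] at h
    rw [abs_of_nonneg h.1]
    exact h.2
  have hsmall : ‖(∫ τ in (0 : ℝ)..T, zetaCorr κ G a j τ) - ∫ τ in (0 : ℝ)..T, ∑' p, F p τ‖ ≤
      8 * (G * Real.log G) := by
    rw [← intervalIntegral.integral_sub hi1 hi2]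
    refine (intervalIntegral.norm_integral_le_of_norm_le_const (C := 4 / G) fun τ h => ?_).trans ?_
    · exact (hcorr G τ hG ((hτ τ h).trans hTG)).2.1
    · rw [sub_zero, abs_of_nonneg hT, div_mul_eq_mul_div, div_le_iff₀ hG0]
      nlinarith
  calc _ = ‖((∫ τ in (0 : ℝ)..T, zetaCorr κ G a j τ) - ∫ τ in (0 : ℝ)..T, ∑' p, F p τ) +
        ((∫ τ in (0 : ℝ)..T, ∑' p, F p τ) - (2 * Real.pi * latticeCount a j T : ℝ))‖ := by
          congr 1; ring
    _ ≤ _ := (norm_add_le _ _).trans (by linarith)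

end

section

variable {a b c : ℝ}

lemma log_div_bounds {x : ℝ} (hx : 0 < x) {y : ℝ} (hy : 0 < y) :
    (y - x) / y ≤ Real.log y - Real.log x ∧ Real.log y - Real.log x ≤ (y - x) / x := by
  rw [← Real.log_div hy.ne' hx.ne']
  constructor
  · have := Real.one_sub_inv_le_log_of_pos (div_pos hy hx)
    rwa [inv_div, one_sub_div hy.ne'] at this
  · have := Real.log_le_sub_one_of_pos (div_pos hy hx)
    rwa [div_sub_one hx.ne'] at this

lemma tendsto_gammaGen (ha : 0 < a) : Tendsto
    (fun M : ℕ => (∑ m ∈ range (M + 1), 1 / ((m : ℝ) + a)) - Real.log ((M : ℝ) + a)) atTop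
    (nhds (gammaGen a)) ∧ ∀ M : ℕ,
    gammaGen a ≤ (∑ m ∈ range (M + 1), 1 / ((m : ℝ) + a)) - Real.log ((M : ℝ) + a) ∧
    (∑ m ∈ range (M + 1), 1 / ((m : ℝ) + a)) - Real.log ((M : ℝ) + a) ≤
      gammaGen a + 1 / (M + a) := by
  set u : ℕ → ℝ := fun M => (∑ m ∈ range (M + 1), 1 / ((m : ℝ) + a)) - Real.log ((M : ℝ) + a)
    with hu
  have hx : ∀ M : ℕ, 0 < (M : ℝ) + a := fun M => by positivity
  have hstep : ∀ M : ℕ, u (M + 1) - u M = 1 / ((M : ℝ) + 1 + a) -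
      (Real.log ((M : ℝ) + 1 + a) - Real.log ((M : ℝ) + a)) := fun M => by
    simp only [hu]
    rw [sum_range_succ _ (M + 1)]
    push_cast
    ring
  have hb : ∀ M : ℕ, 1 / ((M : ℝ) + 1 + a) ≤ Real.log ((M : ℝ) + 1 + a) - Real.log ((M : ℝ) + a) ∧
      Real.log ((M : ℝ) + 1 + a) - Real.log ((M : ℝ) + a) ≤ 1 / ((M : ℝ) + a) := fun M => by
    have h := log_div_bounds (hx M) (y := (M : ℝ) + 1 + a) (by positivity)
    rwa [show (M : ℝ) + 1 + a - (M + a) = 1 by ring] at h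
  have hanti : Antitone u := antitone_nat_of_succ_le fun M => by
    linarith [hstep M, (hb M).1]
  have hmono : Monotone fun M : ℕ => u M - 1 / ((M : ℝ) + a) := monotone_nat_of_le_succ fun M => by
    push_cast
    linarith [hstep M, (hb M).2]
  have hlow : ∀ M, u 0 - 1 / a ≤ u M := fun M => by
    have h1 := hmono M.zero_le
    have h2 : 0 ≤ 1 / ((M : ℝ) + a) := by positivity
    simp only [Nat.cast_zero, zero_add] at h1
    linarith
  have hlim : Tendsto u atTop (nhds (gammaGen a)) :=
    tendsto_nhds_limUnder ⟨_, tendsto_atTop_ciInf hanti ⟨_, Set.forall_mem_range.2 hlow⟩⟩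
  have hinv : Tendsto (fun M : ℕ => 1 / ((M : ℝ) + a)) atTop (nhds 0) :=
    tendsto_const_nhds.div_atTop (tendsto_natCast_atTop_atTop.atTop_add tendsto_const_nhds)
  refine ⟨hlim, fun M => ⟨hanti.le_of_tendsto hlim M, ?_⟩⟩
  have := hmono.ge_of_tendsto (by simpa using hlim.sub hinv) M
  linarith

lemma gammaGen_one : gammaGen 1 = Real.eulerMascheroniConstant := by
  refine tendsto_nhds_unique (tendsto_gammaGen one_pos).1 ?_
  refine ((tendsto_add_atTop_iff_nat 1).2 Real.tendsto_harmonic_sub_log).congr fun M => ?_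
  rw [harmonic]
  push_cast
  simp

lemma range_filter_add_le {N : ℕ} {Z : ℝ} (hZ : a ≤ Z) (ha : 0 < a) (hN : Z ≤ N) :
    (range N).filter (fun n : ℕ => (n : ℝ) + a ≤ Z) = range (⌊Z - a⌋₊ + 1) := by
  ext n
  rw [mem_filter, mem_range, mem_range, Nat.lt_succ_iff, Nat.le_floor_iff (by linarith),
    le_sub_iff_add_le, and_iff_right_iff_imp]
  intro h
  have : (n : ℝ) < N := by linarith
  exact_mod_cast this

lemma abs_sum_ite_add_le_sub_le (ha : 0 < a) (ha1 : a ≤ 1) {N : ℕ} {Z : ℝ} (hZ : 0 ≤ Z)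
    (hN : Z ≤ N) : |(∑ n ∈ range N, if (n : ℝ) + a ≤ Z then (1 : ℝ) else 0) - Z| ≤ 1 := by
  rcases lt_or_ge Z a with h | h
  · rw [sum_eq_zero fun n _ => if_neg (by have := Nat.cast_nonneg (α := ℝ) n; linarith), zero_sub,
      abs_neg, abs_of_nonneg hZ]
    linarith
  · rw [← sum_filter, range_filter_add_le h ha hN, sum_const, card_range, nsmul_eq_mul, mul_one,
      abs_le]
    have h1 := Nat.floor_le (sub_nonneg.2 h)
    have h2 := Nat.lt_floor_add_one (Z - a)
    push_cast
    constructor <;> linarith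

lemma abs_sum_ite_inv_sub_log_le (ha : 0 < a) (ha1 : a ≤ 1) {N : ℕ} {Y : ℝ} (hY : 1 ≤ Y)
    (hN : Y ≤ N) : |(∑ n ∈ range N, if (n : ℝ) + a ≤ Y then 1 / ((n : ℝ) + a) else 0) -
      (Real.log Y + gammaGen a)| ≤ (1 + 1 / a) / Y := by
  rw [← sum_filter, range_filter_add_le (ha1.trans hY) ha hN]
  set M := ⌊Y - a⌋₊
  have h1 : (M : ℝ) ≤ Y - a := Nat.floor_le (by linarith)
  have h2 : Y - a < M + 1 := Nat.lt_floor_add_one (Y - a)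
  have hM : 0 < (M : ℝ) + a := by positivity
  obtain ⟨h3, h4⟩ := (tendsto_gammaGen ha).2 M
  obtain ⟨h5, h6⟩ := log_div_bounds hM (y := Y) (by linarith)
  have h7 : 0 ≤ (Y - (M + a)) / Y := div_nonneg (by linarith) (by linarith)
  have h8 : (Y - (M + a)) / (M + a) ≤ 1 / (M + a) := by gcongr; linarith
  have h9 : 1 / ((M : ℝ) + a) ≤ (1 + 1 / a) / Y := by
    rw [div_le_div_iff₀ hM (by linarith)]
    have : 1 ≤ 1 / a * (M + a) := by
      rw [one_div_mul_eq_div, le_div_iff₀ ha]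
      linarith [Nat.cast_nonneg (α := ℝ) M]
    linarith
  rw [abs_le]
  constructor <;> linarith

lemma exists_abs_sum_hyperbola_le (hb : 0 < b) (hb1 : b ≤ 1) (hc : 0 < c) (hc1 : c ≤ 1) :
    ∃ C, 0 < C ∧ ∀ (Y : ℝ) (N : ℕ), 1 ≤ Y → Y ^ 2 / b ≤ N →
      |(∑ n ∈ range N, ∑ k ∈ range N,
        if ((k : ℝ) + c) * (n + b) ≤ Y ^ 2 ∧ (n : ℝ) + b ≤ Y then (1 : ℝ) else 0) -
        Y ^ 2 * (Real.log Y + gammaGen b)| ≤ C * Y := by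
  refine ⟨3 + 1 / b, by positivity, fun Y N hY hN => ?_⟩
  have hYN : Y ≤ N := by
    refine le_trans ?_ hN
    rw [le_div_iff₀ hb]
    nlinarith
  have h1 := abs_sum_ite_inv_sub_log_le hb hb1 hY hYN
  have h2 := abs_sum_ite_add_le_sub_le hb hb1 (by linarith) hYN
  have h3 : |(∑ n ∈ range N, ∑ k ∈ range N,
      if ((k : ℝ) + c) * (n + b) ≤ Y ^ 2 ∧ (n : ℝ) + b ≤ Y then (1 : ℝ) else 0) -
      Y ^ 2 * ∑ n ∈ range N, if (n : ℝ) + b ≤ Y then 1 / ((n : ℝ) + b) else 0| ≤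
      ∑ n ∈ range N, if (n : ℝ) + b ≤ Y then (1 : ℝ) else 0 := by
    rw [mul_sum, ← sum_sub_distrib]
    refine (abs_sum_le_sum_abs _ _).trans (sum_le_sum fun n _ => ?_)
    have hn : 0 < (n : ℝ) + b := by positivity
    split_ifs with h
    · simp only [h, and_true, ← le_div_iff₀ hn, mul_one_div]
      refine abs_sum_ite_add_le_sub_le hc hc1 (by positivity) (le_trans ?_ hN)
      gcongr
      linarith [Nat.cast_nonneg (α := ℝ) n]
    · simp [h]
  have h4 : |Y ^ 2 * ((∑ n ∈ range N, if (n : ℝ) + b ≤ Y then 1 / ((n : ℝ) + b) else 0) -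
      (Real.log Y + gammaGen b))| ≤ (1 + 1 / b) * Y := by
    rw [abs_mul, abs_of_nonneg (sq_nonneg Y)]
    calc _ ≤ Y ^ 2 * ((1 + 1 / b) / Y) := by gcongr
      _ = _ := by field_simp
  have h5 := abs_le.1 h2
  rw [abs_le] at h3 h4 ⊢
  constructor <;> linarith

lemma latticeCount_eq_sum (ha : 0 < a) (ha1 : a ≤ 1) (j : ℕ) {X : ℝ} {N : ℕ} (hN : X / a ≤ N) :
    latticeCount a j (2 * Real.pi * X) = ∑ n ∈ range N, ∑ k ∈ range N,
      if ((k : ℝ) + 1) * (n + a) ≤ X then ((n + a : ℝ) ^ j)⁻¹ else 0 := by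
  rw [latticeCount, ← sum_product', tsum_eq_sum (s := range N ×ˢ range N)]
  · refine sum_congr rfl fun p _ => ?_
    simp only [mul_assoc (2 * Real.pi), mul_le_mul_iff_right₀ Real.two_pi_pos]
    rfl
  · intro p hp
    refine if_neg fun h => hp ?_
    rw [mul_assoc (2 * Real.pi), mul_le_mul_iff_right₀ Real.two_pi_pos] at h
    rw [div_le_iff₀ ha] at hN
    have h1 := Nat.cast_nonneg (α := ℝ) p.1
    have h2 := Nat.cast_nonneg (α := ℝ) p.2
    have h3 : (0 : ℝ) ≤ p.2 * p.1 := mul_nonneg h2 h1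
    rw [mem_product, mem_range, mem_range]
    constructor
    · by_contra! hle
      have : (N : ℝ) ≤ p.1 := by exact_mod_cast hle
      nlinarith
    · by_contra! hle
      have : (N : ℝ) ≤ p.2 := by exact_mod_cast hle
      nlinarith

lemma exists_abs_latticeCount_zero_sub_le (ha : 0 < a) (ha1 : a ≤ 1) :
    ∃ C, 0 < C ∧ ∀ Y : ℝ, 1 ≤ Y → |latticeCount a 0 (2 * Real.pi * Y ^ 2) - Y ^ 2 *
      (2 * Real.log Y + gammaGen a + Real.eulerMascheroniConstant - 1)| ≤ C * Y := by
  obtain ⟨C₁, hC₁, h₁⟩ := exists_abs_sum_hyperbola_le ha ha1 one_pos le_rfl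
  obtain ⟨C₂, hC₂, h₂⟩ := exists_abs_sum_hyperbola_le one_pos le_rfl ha ha1
  refine ⟨C₁ + C₂ + 3, by positivity, fun Y hY => ?_⟩
  obtain ⟨N, hN⟩ := exists_nat_ge (Y ^ 2 / a)
  have hN1 : Y ^ 2 / 1 ≤ N := le_trans (by gcongr) hN
  have hYN : Y ≤ N := by
    refine le_trans ?_ hN1
    rw [div_one]
    nlinarith
  specialize h₁ Y N hY hN
  specialize h₂ Y N hY hN1
  rw [sum_comm] at h₂
  have h₃ := abs_sum_ite_add_le_sub_le ha ha1 (by linarith) hYN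
  have h₄ := abs_sum_ite_add_le_sub_le one_pos le_rfl (by linarith) hYN
  set S := ∑ n ∈ range N, if (n : ℝ) + a ≤ Y then (1 : ℝ) else 0
  set S' := ∑ n ∈ range N, if (n : ℝ) + 1 ≤ Y then (1 : ℝ) else 0
  have key : latticeCount a 0 (2 * Real.pi * Y ^ 2) =
      (∑ n ∈ range N, ∑ k ∈ range N,
        if ((k : ℝ) + 1) * (n + a) ≤ Y ^ 2 ∧ (n : ℝ) + a ≤ Y then (1 : ℝ) else 0) +
      (∑ n ∈ range N, ∑ k ∈ range N,
        if ((n : ℝ) + a) * (k + 1) ≤ Y ^ 2 ∧ (k : ℝ) + 1 ≤ Y then (1 : ℝ) else 0) - S * S' := by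
    rw [latticeCount_eq_sum ha ha1 0 hN, sum_mul_sum, ← sum_add_distrib, ← sum_sub_distrib]
    refine sum_congr rfl fun n _ => ?_
    rw [← sum_add_distrib, ← sum_sub_distrib]
    refine sum_congr rfl fun k _ => ?_
    rw [mul_comm ((k : ℝ) + 1), pow_zero, inv_one]
    have hn : 0 < (n : ℝ) + a := by positivity
    have hk : 0 < (k : ℝ) + 1 := by positivity
    by_cases h1 : (n : ℝ) + a ≤ Y <;> by_cases h2 : (k : ℝ) + 1 ≤ Y
    · have : ((n : ℝ) + a) * (k + 1) ≤ Y ^ 2 := by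
        rw [sq]
        exact mul_le_mul h1 h2 hk.le (by linarith)
      simp [h1, h2, this]
    · simp [h1, h2]
    · simp [h1, h2]
    · have : ¬ ((n : ℝ) + a) * (k + 1) ≤ Y ^ 2 := by
        push Not at h1 h2 ⊢
        rw [sq]
        exact mul_lt_mul'' h1 h2 (by linarith) (by linarith)
      simp [h1, h2, this]
  rw [gammaGen_one] at h₂
  have h₅ : |S * S' - Y ^ 2| ≤ 3 * Y := by
    rw [show S * S' - Y ^ 2 = (S - Y) * (S' - Y) + Y * (S' - Y) + (S - Y) * Y by ring]
    refine (abs_add_three _ _ _).trans ?_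
    rw [abs_mul, abs_mul, abs_mul, abs_of_nonneg (by linarith : 0 ≤ Y)]
    nlinarith [abs_nonneg (S - Y), abs_nonneg (S' - Y)]
  rw [key]
  rw [abs_le] at h₁ h₂ h₅ ⊢
  constructor <;> linarith

lemma inv_add_pow_le (ha : 0 < a) (i j : ℕ) (n : ℕ) :
    ((n + a : ℝ) ^ (i + j))⁻¹ ≤ (a ^ i)⁻¹ * ((n + a : ℝ) ^ j)⁻¹ := by
  rw [pow_add, mul_inv]
  gcongr
  linarith [Nat.cast_nonneg (α := ℝ) n]

lemma tsum_inv_add_sq_le (ha : 0 < a) (N : ℕ) :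
    Summable (fun n : ℕ => ((n + N + a : ℝ) ^ 2)⁻¹) ∧
    ∑' n : ℕ, ((n + N + a : ℝ) ^ 2)⁻¹ ≤ (1 + 1 / a) / (N + a) := by
  have h : ∀ M : ℕ, ∑ n ∈ range M, ((n + N + a : ℝ) ^ 2)⁻¹ ≤
      (1 + 1 / a) * (1 / (N + a) - 1 / (M + N + a)) := fun M => by
    induction M with
    | zero => simp
    | succ M ih =>
      rw [sum_range_succ]
      have hx : a ≤ (M : ℝ) + N + a := by
        have : (0 : ℝ) ≤ M + N := by positivity
        linarith
      set x : ℝ := M + N + a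
      have hx0 : 0 < x := by linarith
      have h1 : (x ^ 2)⁻¹ ≤ (1 + 1 / a) * (1 / x - 1 / (x + 1)) := by
        have h2 : (x ^ 2)⁻¹ = (1 + 1 / x) * (1 / x - 1 / (x + 1)) := by field_simp; ring
        rw [h2]
        have h3 : 0 ≤ 1 / x - 1 / (x + 1) := by
          rw [sub_nonneg]
          gcongr
          linarith
        gcongr
      push_cast
      rw [show (M : ℝ) + 1 + N + a = x + 1 by ring]
      linarith
  have h' : ∀ M : ℕ, ∑ n ∈ range M, ((n + N + a : ℝ) ^ 2)⁻¹ ≤ (1 + 1 / a) / (N + a) := fun M => by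
    refine (h M).trans ?_
    rw [div_eq_mul_one_div (1 + 1 / a) ((N : ℝ) + a)]
    have : 0 ≤ 1 / ((M : ℝ) + N + a) := by positivity
    gcongr
    linarith
  exact ⟨summable_of_sum_range_le (fun n => by positivity) h',
    Real.tsum_le_of_sum_range_le (fun n => by positivity) h'⟩

lemma hasSum_hzeta_nat (ha : 0 < a) (ha1 : a ≤ 1) (j : ℕ) :
    HasSum (fun n : ℕ => ((((n + a : ℝ) ^ (j + 2))⁻¹ : ℝ) : ℂ)) (hzeta a ((j + 2 : ℕ) : ℂ)) := by
  refine (hasSum_hzeta ha ha1 (s := ((j + 2 : ℕ) : ℂ)) ?_).congr_fun fun n => ?_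
  · rw [natCast_re]
    push_cast
    linarith [Nat.cast_nonneg (α := ℝ) j]
  · rw [cpow_neg, cpow_natCast]
    push_cast
    rfl

lemma mul_tsum_inv_pow_le (ha : 0 < a) (ha1 : a ≤ 1) (j : ℕ) {X : ℝ} (hX : 0 ≤ X) {N : ℕ}
    (hN : X / a ≤ N) (hs : Summable fun n : ℕ => ((n + a : ℝ) ^ (j + 2))⁻¹) :
    X * ∑' n : ℕ, (((n + N : ℕ) + a : ℝ) ^ (j + 2))⁻¹ ≤ (a ^ j)⁻¹ * (1 + 1 / a) := by
  obtain ⟨hs2, ht⟩ := tsum_inv_add_sq_le ha N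
  have h3 : ∑' n : ℕ, (((n + N : ℕ) + a : ℝ) ^ (j + 2))⁻¹ ≤
      ∑' n : ℕ, (a ^ j)⁻¹ * ((n + N + a : ℝ) ^ 2)⁻¹ := by
    refine Summable.tsum_le_tsum (fun n => ?_) ((summable_nat_add_iff N).2 hs) (hs2.mul_left _)
    have := inv_add_pow_le ha j 2 (n + N)
    rwa [Nat.cast_add] at this ⊢
  rw [tsum_mul_left] at h3
  have h4 : X / (N + a) ≤ 1 := by
    rw [div_le_one (by positivity)]
    have : X ≤ X / a := le_div_self hX ha ha1
    linarith
  calc _ ≤ X * ((a ^ j)⁻¹ * ((1 + 1 / a) / (N + a))) := by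
        refine mul_le_mul_of_nonneg_left (h3.trans ?_) hX
        gcongr
    _ = (a ^ j)⁻¹ * (1 + 1 / a) * (X / (N + a)) := by ring
    _ ≤ (a ^ j)⁻¹ * (1 + 1 / a) * 1 := by gcongr
    _ = _ := mul_one _

lemma abs_sum_lattice_sub_le (ha : 0 < a) (j : ℕ) {X : ℝ} (hX : 0 ≤ X) {N : ℕ}
    (hN : X / a ≤ (N + 1 : ℕ)) : |(∑ n ∈ range (N + 1), ∑ k ∈ range (N + 1),
      if ((k : ℝ) + 1) * (n + a) ≤ X then ((n + a : ℝ) ^ (j + 1))⁻¹ else 0) -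
      X * ∑ n ∈ range (N + 1), ((n + a : ℝ) ^ (j + 2))⁻¹| ≤
      (a ^ j)⁻¹ * (a⁻¹ + 1 + Real.log N) := by
  rw [mul_sum, ← sum_sub_distrib]
  refine (abs_sum_le_sum_abs _ _).trans ?_
  have h2 : ∀ n ∈ range (N + 1), |(∑ k ∈ range (N + 1),
      if ((k : ℝ) + 1) * (n + a) ≤ X then ((n + a : ℝ) ^ (j + 1))⁻¹ else 0) -
      X * ((n + a : ℝ) ^ (j + 2))⁻¹| ≤ (a ^ j)⁻¹ * (n + a : ℝ)⁻¹ := fun n _ => by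
    have hn : 0 < (n : ℝ) + a := by positivity
    have h3 := abs_sum_ite_add_le_sub_le one_pos le_rfl (N := N + 1) (Z := X / (n + a))
      (by positivity) (le_trans (by
        gcongr
        linarith [Nat.cast_nonneg (α := ℝ) n]) hN)
    have e : (∑ k ∈ range (N + 1),
        if ((k : ℝ) + 1) * (n + a) ≤ X then ((n + a : ℝ) ^ (j + 1))⁻¹ else 0) -
        X * ((n + a : ℝ) ^ (j + 2))⁻¹ = ((n + a : ℝ) ^ (j + 1))⁻¹ * ((∑ k ∈ range (N + 1),
        if (k : ℝ) + 1 ≤ X / (n + a) then (1 : ℝ) else 0) - X / (n + a)) := by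
      simp only [le_div_iff₀ hn]
      rw [mul_sub, mul_sum]
      simp only [mul_ite, mul_one, mul_zero]
      congr 1
      rw [pow_succ _ (j + 1), mul_inv]
      ring
    rw [e, abs_mul, abs_of_nonneg (by positivity)]
    have h4 := inv_add_pow_le ha j 1 n
    rw [pow_one] at h4
    calc _ ≤ ((n + a : ℝ) ^ (j + 1))⁻¹ * 1 := by gcongr
      _ ≤ _ := by rwa [mul_one]
  refine (sum_le_sum h2).trans ?_
  rw [← mul_sum]
  gcongr
  exact sum_range_inv_add_le ha N

lemma exists_norm_latticeCount_succ_sub_le (ha : 0 < a) (ha1 : a ≤ 1) (j : ℕ) :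
    ∃ C, 0 < C ∧ ∀ X : ℝ, 1 ≤ X → ‖((latticeCount a (j + 1) (2 * Real.pi * X) : ℝ) : ℂ) -
      X * hzeta a ((j + 2 : ℕ) : ℂ)‖ ≤ C * (1 + Real.log X) := by
  have hlog3 : 0 ≤ Real.log (3 / a) := Real.log_nonneg (by rw [le_div_iff₀ ha]; linarith)
  refine ⟨(a ^ j)⁻¹ * (a⁻¹ + 1 + Real.log (3 / a)) + (a ^ j)⁻¹ * (1 + 1 / a), by positivity,
    fun X hX => ?_⟩
  obtain ⟨N, hN⟩ : ∃ N, N = ⌈X / a⌉₊ := ⟨_, rfl⟩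
  have hXN : X / a ≤ (N + 1 : ℕ) := by
    push_cast
    exact (hN ▸ Nat.le_ceil (X / a)).trans (by linarith)
  have hN2 : (N : ℝ) ≤ 3 / a * X := by
    have h1 : (N : ℝ) < X / a + 1 := hN ▸ Nat.ceil_lt_add_one (by positivity)
    have h2 : 1 ≤ X / a := by rw [le_div_iff₀ ha]; linarith
    have h3 : 3 / a * X = 3 * (X / a) := by ring
    linarith
  have hN0 : (0 : ℝ) < N := by
    have : 0 < N := hN ▸ Nat.ceil_pos.2 (by positivity)
    exact_mod_cast this
  have hz := (hasSum_hzeta_nat ha ha1 j)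
  have hsr : Summable fun n : ℕ => ((n + a : ℝ) ^ (j + 2))⁻¹ := by exact_mod_cast hz.summable
  have hze : hzeta a ((j + 2 : ℕ) : ℂ) = ((∑' n : ℕ, ((n + a : ℝ) ^ (j + 2))⁻¹ : ℝ) : ℂ) := by
    rw [ofReal_tsum]
    exact hz.tsum_eq.symm
  have h1 := abs_sum_lattice_sub_le ha j (by linarith) hXN
  have h2 := mul_tsum_inv_pow_le ha ha1 j (by linarith) hXN hsr
  have h0 : 0 ≤ X * ∑' n : ℕ, (((n + (N + 1) : ℕ) + a : ℝ) ^ (j + 2))⁻¹ :=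
    mul_nonneg (by linarith) (tsum_nonneg fun n => by positivity)
  rw [hze, ← ofReal_mul, ← ofReal_sub, norm_real, Real.norm_eq_abs,
    latticeCount_eq_sum ha ha1 (j + 1) hXN, ← hsr.sum_add_tsum_nat_add (N + 1), mul_add, ← sub_sub]
  refine (abs_sub _ _).trans ((add_le_add h1 ((abs_of_nonneg h0).trans_le h2)).trans ?_)
  have hlogX := Real.log_nonneg hX
  have h6 : Real.log N ≤ Real.log (3 / a) + Real.log X := by
    rw [← Real.log_mul (by positivity) (by positivity)]
    exact Real.log_le_log hN0 hN2
  have h7 : (a ^ j)⁻¹ * Real.log N ≤ (a ^ j)⁻¹ * (Real.log (3 / a) + Real.log X) := by gcongr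
  have h8 : 0 ≤ (a ^ j)⁻¹ * (a⁻¹ + Real.log (3 / a)) * Real.log X := by positivity
  have h9 : 0 ≤ (a ^ j)⁻¹ * (1 + 1 / a) * Real.log X := by positivity
  linarith

end

section

variable {η : ℝ → ℂ} {κ : ℝ → ℝ} {a : ℝ}

lemma rpow_neg_three_halves_le {x : ℝ} (hx : 1 ≤ x) :
    x ^ (-(3 / 2) : ℝ) ≤ 4 * (1 / √x - 1 / √(x + 1)) := by
  have hx0 : 0 < x := by linarith
  have hp : 0 < √x := Real.sqrt_pos.2 hx0
  have hq : 0 < √(x + 1) := Real.sqrt_pos.2 (by linarith)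
  have hp2 := Real.sq_sqrt hx0.le
  have hq2 := Real.sq_sqrt (by linarith : 0 ≤ x + 1)
  have e : x ^ (-(3 / 2) : ℝ) = 1 / √x ^ 3 := by
    rw [Real.sqrt_eq_rpow, ← Real.rpow_natCast, ← Real.rpow_mul hx0.le, one_div, ← Real.rpow_neg hx0.le]
    norm_num
  rw [e]
  set p := √x
  set q := √(x + 1)
  have hpq : q ≤ 2 * p := abs_le_of_sq_le_sq' (by nlinarith) (by linarith) |>.2
  rw [div_sub_div _ _ hp.ne' hq.ne', mul_div_assoc', div_le_div_iff₀ (by positivity) (by positivity)]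
  have h1 : (q - p) * (q + p) = 1 := by linarith [show (q - p) * (q + p) = q ^ 2 - p ^ 2 by ring]
  have h3 : 0 < q - p := by
    by_contra! h
    nlinarith
  have h4 : q * (q + p) ≤ 4 * p ^ 2 := by nlinarith
  have h5 : q ≤ 4 * p ^ 2 * (q - p) := by
    have := mul_le_mul_of_nonneg_right h4 h3.le
    calc q = q * (q + p) * (q - p) := by linear_combination (-q) * h1
      _ ≤ _ := this
  calc 1 * (p * q) = p * q := one_mul _
    _ ≤ p * (4 * p ^ 2 * (q - p)) := by gcongr
    _ = _ := by ring

/-- The restriction of `n ↦ (n + a) ^ (-3/2)` to `Z ≤ n + a`. -/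
noncomputable def tailTerm (a Z : ℝ) (n : ℕ) : ℝ :=
  if Z ≤ n + a then (n + a : ℝ) ^ (-(3 / 2) : ℝ) else 0

lemma tailTerm_nonneg (ha : 0 < a) (Z : ℝ) (n : ℕ) : 0 ≤ tailTerm a Z n := by
  unfold tailTerm
  split_ifs
  · positivity
  · exact le_rfl

lemma tsum_tailTerm_le (ha : 0 < a) {Z : ℝ} (hZ : 1 ≤ Z) :
    Summable (tailTerm a Z) ∧ ∑' n, tailTerm a Z n ≤ 4 / √Z := by
  have h : ∀ M : ℕ, ∑ n ∈ range M, tailTerm a Z n ≤ 4 * (1 / √Z - 1 / √(max Z (M + a))) := by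
    intro M
    induction M with
    | zero =>
      simp only [range_zero, sum_empty]
      have : 1 / √(max Z ((0 : ℕ) + a)) ≤ 1 / √Z := by
        gcongr
        exact le_max_left _ _
      linarith
    | succ M ih =>
      rw [sum_range_succ, tailTerm]
      split_ifs with hM
      · have h1 := rpow_neg_three_halves_le (hZ.trans hM)
        rw [max_eq_right hM] at ih
        rw [max_eq_right (hM.trans (by push_cast; linarith))]
        push_cast
        rw [show (M : ℝ) + 1 + a = M + a + 1 by ring]
        linarith
      · have : 1 / √(max Z ((M + 1 : ℕ) + a)) ≤ 1 / √(max Z (M + a)) := by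
          have : 0 < max Z ((M : ℝ) + a) := lt_max_of_lt_left (by linarith)
          gcongr
          linarith
        linarith
  have h' : ∀ M : ℕ, ∑ n ∈ range M, tailTerm a Z n ≤ 4 / √Z := fun M => by
    refine (h M).trans ?_
    have : 0 ≤ 1 / √(max Z (M + a)) := by positivity
    rw [show 4 / √Z = 4 * (1 / √Z) by ring]
    linarith
  exact ⟨summable_of_sum_range_le (tailTerm_nonneg ha Z) h',
    Real.tsum_le_of_sum_range_le (tailTerm_nonneg ha Z) h'⟩

lemma half_le_of_log_sub_log_lt {x y G : ℝ} (hx : 0 < x) (hxy : x + 1 ≤ y) (hG : 4 ≤ G)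
    (h : Real.log y - Real.log x < 1 / (2 * G)) : G / 2 ≤ x := by
  have hy : 0 < y := by linarith
  have h1 := (log_div_bounds hx hy).1.trans_lt h
  rw [div_lt_div_iff₀ hy (by linarith)] at h1
  nlinarith

lemma norm_smoothing_log_mul_le (hη : SmoothingKernel η κ) (ha : 0 < a) {G α β : ℝ} (hG : 4 ≤ G)
    (hα : 3 / 2 ≤ α) (hβ : 3 / 2 ≤ β) {n m : ℕ} (hnm : n ≠ m) :
    ‖η (G * (Real.log (n + a) - Real.log (m + a)))‖ *
      ((n + a : ℝ) ^ (-α) * (m + a : ℝ) ^ (-β)) ≤ tailTerm a (G / 2) n * tailTerm a (G / 2) m := by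
  have hG0 : 0 < G := by linarith
  have hx : ∀ n : ℕ, 0 < (n + a : ℝ) := fun n => by positivity
  by_cases hu : 1 / 2 ≤ |G * (Real.log (n + a) - Real.log (m + a))|
  · rw [hη.eq_zero _ hu, norm_zero, zero_mul]
    exact mul_nonneg (tailTerm_nonneg ha _ _) (tailTerm_nonneg ha _ _)
  have hu' : |Real.log (n + a) - Real.log (m + a)| < 1 / (2 * G) := by
    rw [abs_mul, abs_of_pos hG0, not_le] at hu
    rw [lt_div_iff₀ (by positivity)]
    linarith
  rw [abs_lt] at hu'
  have hboth : G / 2 ≤ n + a ∧ G / 2 ≤ m + a := by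
    rcases hnm.lt_or_gt with h | h
    · have h1 : (n : ℝ) + 1 ≤ m := by exact_mod_cast h
      have h2 := half_le_of_log_sub_log_lt (hx n) (y := m + a) (by linarith) hG (by linarith)
      exact ⟨h2, by linarith⟩
    · have h1 : (m : ℝ) + 1 ≤ n := by exact_mod_cast h
      have h2 := half_le_of_log_sub_log_lt (hx m) (y := n + a) (by linarith) hG (by linarith)
      exact ⟨by linarith, h2⟩
  rw [tailTerm, tailTerm, if_pos hboth.1, if_pos hboth.2]
  have h1 : (1 : ℝ) ≤ n + a := by linarith [hboth.1]
  have h2 : (1 : ℝ) ≤ m + a := by linarith [hboth.2]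
  refine (mul_le_of_le_one_left ?_ (norm_le_one_of_smoothingKernel hη _)).trans ?_
  · exact mul_nonneg (Real.rpow_nonneg (hx n).le _) (Real.rpow_nonneg (hx m).le _)
  · exact mul_le_mul (Real.rpow_le_rpow_of_exponent_le h1 (by linarith))
      (Real.rpow_le_rpow_of_exponent_le h2 (by linarith)) (Real.rpow_nonneg (hx m).le _)
      (Real.rpow_nonneg (hx n).le _)

lemma ofReal_cpow_neg_add_mul_I {x : ℝ} (hx : 0 < x) (α t : ℝ) :
    (x : ℂ) ^ (-(α + t * I : ℂ)) = ((x ^ (-α) : ℝ) : ℂ) * cexp (-(t * Real.log x : ℝ) * I) := by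
  have hxc : (x : ℂ) ≠ 0 := by exact_mod_cast hx.ne'
  rw [neg_add, cpow_add _ _ hxc, ofReal_cpow hx.le, ofReal_neg]
  congr 1
  rw [cpow_def_of_ne_zero hxc, ← ofReal_log hx.le]
  congr 1
  push_cast
  ring

lemma hasSum_hzeta_line (ha : 0 < a) (ha1 : a ≤ 1) {α : ℝ} (hα : 1 < α) (t : ℝ) :
    HasSum (fun n : ℕ => (((n + a : ℝ) ^ (-α) : ℝ) : ℂ) *
      cexp (-(t * Real.log (n + a) : ℝ) * I)) (hzeta a (α + t * I)) := by
  have h := hasSum_hzeta ha ha1 (s := α + t * I) (by simpa using hα)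
  refine h.congr_fun fun n => ?_
  exact (ofReal_cpow_neg_add_mul_I (by positivity) α t).symm

lemma hasSum_conj_hzeta_line (ha : 0 < a) (ha1 : a ≤ 1) {α : ℝ} (hα : 1 < α) (t : ℝ) :
    HasSum (fun n : ℕ => (((n + a : ℝ) ^ (-α) : ℝ) : ℂ) *
      cexp ((t * Real.log (n + a) : ℝ) * I)) ((starRingEnd ℂ) (hzeta a (α + t * I))) := by
  refine ((hasSum_hzeta_line ha ha1 hα t).map (starRingEnd ℂ) continuous_conj).congr_fun
    fun n => ?_
  rw [Function.comp_apply, map_mul, conj_ofReal, ← Complex.exp_conj, map_mul, conj_I, map_neg,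
    conj_ofReal, neg_mul_neg]

lemma hasSum_hzeta_mul_conj (ha : 0 < a) (ha1 : a ≤ 1) {α β : ℝ} (hα : 1 < α) (hβ : 1 < β) (t : ℝ) :
    HasSum (fun p : ℕ × ℕ => ((((p.1 + a : ℝ) ^ (-α) * (p.2 + a : ℝ) ^ (-β) : ℝ)) : ℂ) *
      cexp (-(t * (Real.log (p.1 + a) - Real.log (p.2 + a)) : ℝ) * I))
      (hzeta a (α + t * I) * (starRingEnd ℂ) (hzeta a (β + t * I))) := by
  obtain ⟨f, hf⟩ : ∃ f : ℕ → ℂ, f = fun n : ℕ => (((n + a : ℝ) ^ (-α) : ℝ) : ℂ) *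
    cexp (-(t * Real.log (n + a) : ℝ) * I) := ⟨_, rfl⟩
  obtain ⟨g, hg⟩ : ∃ g : ℕ → ℂ, g = fun n : ℕ => (((n + a : ℝ) ^ (-β) : ℝ) : ℂ) *
    cexp ((t * Real.log (n + a) : ℝ) * I) := ⟨_, rfl⟩
  have h1 : HasSum f _ := hf ▸ hasSum_hzeta_line ha ha1 hα t
  have h2 : HasSum g _ := hg ▸ hasSum_conj_hzeta_line ha ha1 hβ t
  have hfn : Summable fun n => ‖f n‖ := by
    refine (summable_nat_add_rpow ha hα).congr fun n => ?_
    rw [hf, norm_mul, ← ofReal_neg, norm_exp_ofReal_mul_I, mul_one, norm_real,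
      Real.norm_of_nonneg (Real.rpow_nonneg (by positivity) _)]
  have hgn : Summable fun n => ‖g n‖ := by
    refine (summable_nat_add_rpow ha hβ).congr fun n => ?_
    rw [hg, norm_mul, norm_exp_ofReal_mul_I, mul_one, norm_real,
      Real.norm_of_nonneg (Real.rpow_nonneg (by positivity) _)]
  refine (h1.mul h2 (summable_mul_of_summable_norm hfn hgn)).congr_fun fun p => ?_
  simp only [hf, hg]
  rw [mul_mul_mul_comm, ← Complex.exp_add, ofReal_mul, ← add_mul]
  congr 3
  push_cast
  ring

lemma norm_integral_window_hzeta_mul_conj_sub_le (hη : SmoothingKernel η κ) (ha : 0 < a)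
    (ha1 : a ≤ 1) {G α β : ℝ} (hG : 4 ≤ G) (hα : 3 / 2 ≤ α) (hβ : 3 / 2 ≤ β) (τ : ℝ) :
    ‖(∫ t, (window κ G τ t : ℂ) * (hzeta a (α + t * I) *
      (starRingEnd ℂ) (hzeta a (β + t * I)))) - hzeta a (α + β : ℝ)‖ ≤ 32 / G := by
  have hG0 : 0 < G := by linarith
  have hx : ∀ n : ℕ, 0 < (n + a : ℝ) := fun n => by positivity
  obtain ⟨w, hw⟩ : ∃ w : ℕ × ℕ → ℝ, w = fun p => (p.1 + a : ℝ) ^ (-α) * (p.2 + a : ℝ) ^ (-β) :=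
    ⟨_, rfl⟩
  obtain ⟨u, hu⟩ : ∃ u : ℕ × ℕ → ℝ, u = fun p => Real.log (p.1 + a) - Real.log (p.2 + a) :=
    ⟨_, rfl⟩
  have hw0 : ∀ p, 0 ≤ w p := fun p => by
    rw [hw]
    exact mul_nonneg (Real.rpow_nonneg (hx _).le _) (Real.rpow_nonneg (hx _).le _)
  have hws : Summable w := by
    rw [hw]
    exact (summable_nat_add_rpow ha (σ := α) (by linarith)).mul_of_nonneg
      (summable_nat_add_rpow ha (σ := β) (by linarith))
      (fun n => Real.rpow_nonneg (hx _).le _) (fun n => Real.rpow_nonneg (hx _).le _)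
  have hprod : ∀ t : ℝ, HasSum (fun p => (w p : ℂ) * cexp (-(t * u p : ℝ) * I))
      (hzeta a (α + t * I) * (starRingEnd ℂ) (hzeta a (β + t * I))) := fun t => by
    rw [hw, hu]
    exact hasSum_hzeta_mul_conj ha ha1 (by linarith) (by linarith) t
  have hnorm : ∀ (p : ℕ × ℕ) (t : ℝ), ‖(window κ G τ t : ℂ) * ((w p : ℂ) *
      cexp (-(t * u p : ℝ) * I))‖ = w p * window κ G τ t := fun p t => by
    rw [norm_mul, norm_mul, ← ofReal_neg, norm_exp_ofReal_mul_I, norm_real, norm_real,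
      Real.norm_of_nonneg (hw0 p), Real.norm_of_nonneg (window_nonneg hη hG0 τ t)]
    ring
  have hInt : ∀ p, Integrable fun t : ℝ => (window κ G τ t : ℂ) * ((w p : ℂ) *
      cexp (-(t * u p : ℝ) * I)) := fun p => by
    refine integrable_window_mul hη hG0 τ (C := w p) (by fun_prop) fun t => ?_
    rw [norm_mul, ← ofReal_neg, norm_exp_ofReal_mul_I, mul_one, norm_real,
      Real.norm_of_nonneg (hw0 p)]
    exact le_mul_of_one_le_right (hw0 p) (one_le_pow₀ (by linarith [abs_nonneg t]))
  have h1 := hasSum_integral_of_summable_integral_norm hInt (by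
    simp only [hnorm, integral_const_mul, integral_window hη hG0, mul_one]
    exact hws)
  have e1 : ∀ p, ∫ t : ℝ, (window κ G τ t : ℂ) * ((w p : ℂ) * cexp (-(t * u p : ℝ) * I)) =
      (w p : ℂ) * (cexp (-(τ * u p : ℝ) * I) * η (G * u p)) := fun p => by
    rw [← integral_window_mul_exp hη hG0, ← integral_const_mul]
    congr 1
    ext t
    ring
  have e2 : ∀ t : ℝ, ∑' p, (window κ G τ t : ℂ) * ((w p : ℂ) * cexp (-(t * u p : ℝ) * I)) =
      (window κ G τ t : ℂ) * (hzeta a (α + t * I) * (starRingEnd ℂ) (hzeta a (β + t * I))) :=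
    fun t => by rw [tsum_mul_left, (hprod t).tsum_eq]
  simp only [e1, e2] at h1
  have hdiag : HasSum (fun p : ℕ × ℕ => if p.1 = p.2 then (w p : ℂ) else 0)
      (hzeta a (α + β : ℝ)) := by
    have hinj : Function.Injective fun n : ℕ => (n, n) := fun n m h => (Prod.mk.inj h).1
    refine (hinj.hasSum_iff fun p hp => if_neg fun h => hp ⟨p.1, Prod.ext rfl h⟩).1 ?_
    have h2 := hasSum_hzeta_line ha ha1 (α := α + β) (by linarith) 0
    simp only [ofReal_zero, zero_mul, add_zero, neg_zero, Complex.exp_zero, mul_one] at h2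
    refine h2.congr_fun fun n => ?_
    rw [Function.comp_apply, if_pos rfl, hw, neg_add, Real.rpow_add (hx n)]
  obtain ⟨hts, htt⟩ := tsum_tailTerm_le ha (Z := G / 2) (by linarith)
  have h0 := tailTerm_nonneg ha (G / 2)
  have hts2 := hts.mul_of_nonneg hts h0 h0
  rw [← (h1.sub hdiag).tsum_eq]
  refine (tsum_of_norm_bounded hts2.hasSum fun p => ?_).trans ?_
  · split_ifs with h
    · have hu0 : u p = 0 := by rw [hu]; simp only; rw [h, sub_self]
      rw [hu0]
      simp only [mul_zero, ofReal_zero, neg_zero, zero_mul, Complex.exp_zero, hη.map_zero, mul_one,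
        sub_self, norm_zero]
      exact mul_nonneg (h0 _) (h0 _)
    · rw [sub_zero, norm_mul, norm_mul, ← ofReal_neg, norm_exp_ofReal_mul_I, one_mul, norm_real,
        Real.norm_of_nonneg (hw0 p), mul_comm, hw, hu]
      exact norm_smoothing_log_mul_le hη ha hG hα hβ h
  · rw [← hts.tsum_mul_tsum hts hts2]
    have hnn : 0 ≤ ∑' n, tailTerm a (G / 2) n := tsum_nonneg h0
    calc _ ≤ (4 / √(G / 2)) * (4 / √(G / 2)) := by gcongr
      _ = 16 / (√(G / 2) * √(G / 2)) := by ring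
      _ = 32 / G := by
        rw [Real.mul_self_sqrt (by linarith)]
        field_simp
        norm_num

end

section

variable {η : ℝ → ℂ} {κ : ℝ → ℝ} {F : ℝ → ℝ}

lemma SmoothingKernel.integral_eq_one (hη : SmoothingKernel η κ) : ∫ y, κ y = 1 := by
  have h1 := integral_window hη one_pos 0
  simpa only [window, sub_zero, div_one] using h1

lemma SmoothingKernel.exists_mul_pow_le (hη : SmoothingKernel η κ) :
    ∃ D, 0 < D ∧ ∀ y, κ y * (1 + |y|) ^ 10 ≤ D * ((1 + |y|) ^ 2)⁻¹ := by
  obtain ⟨D, hD⟩ := hη.decay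
  refine ⟨|D| + 1, by positivity, fun y => ?_⟩
  have h0 : 0 < 1 + |y| := by positivity
  calc κ y * (1 + |y|) ^ 10 ≤ ((|D| + 1) * ((1 + |y|) ^ 12)⁻¹) * (1 + |y|) ^ 10 := by
        have h1 := hD y
        have h2 : D * ((1 + |y|) ^ 12)⁻¹ ≤ (|D| + 1) * ((1 + |y|) ^ 12)⁻¹ := by
          have := le_abs_self D
          gcongr
          linarith
        gcongr
        linarith
    _ = _ := by field_simp

lemma integral_window_mul_eq {G : ℝ} (hG : 0 < G) (τ : ℝ) :
    ∫ t, window κ G τ t * F t = ∫ y, κ y * F (τ + G * y) := by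
  have h1 := integral_add_right_eq_self (μ := volume) (fun t : ℝ => window κ G τ t * F t) τ
  have h2 := Measure.integral_comp_mul_left (fun s : ℝ => window κ G τ (s + τ) * F (s + τ)) G
  rw [h1, abs_of_pos (inv_pos.2 hG), smul_eq_mul] at h2
  have h3 : ∫ y, window κ G τ (G * y + τ) * F (G * y + τ) = G⁻¹ * ∫ y, κ y * F (τ + G * y) := by
    rw [← integral_const_mul]
    congr 1
    ext y
    rw [window, add_sub_cancel_right, mul_div_cancel_left₀ _ hG.ne', add_comm (G * y)]
    ring
  rw [h3] at h2
  exact (mul_left_cancel₀ (inv_pos.2 hG).ne' h2).symm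

lemma integral_integral_window_mul (hη : SmoothingKernel η κ) {G T : ℝ} (hG : 0 < G) (hT : 0 ≤ T)
    (hF : Continuous F) {A : ℝ} (hA : ∀ t, |F t| ≤ A * (1 + |t|) ^ 2) :
    ∫ τ in (0 : ℝ)..T, ∫ t, window κ G τ t * F t =
      ∫ y, κ y * ((∫ t in (0 : ℝ)..(T + G * y), F t) - ∫ t in (0 : ℝ)..(G * y), F t) := by
  simp only [integral_window_mul_eq hG]
  rw [intervalIntegral.integral_of_le hT, integral_integral_swap]
  · congr 1
    ext y
    rw [integral_const_mul, ← intervalIntegral.integral_of_le hT,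
      intervalIntegral.integral_comp_add_right, zero_add,
      intervalIntegral.integral_interval_sub_left (hF.intervalIntegrable _ _)
        (hF.intervalIntegrable _ _)]
  · obtain ⟨D, hD, h⟩ := hη.exists_mul_pow_le
    have hA0 : 0 ≤ A := by
      have := (abs_nonneg _).trans (hA 0)
      simpa using this
    have hi : Integrable (fun p : ℝ × ℝ => (A * (1 + T + G) ^ 2) * (D * ((1 + |p.2|) ^ 2)⁻¹))
        ((volume.restrict (Set.Ioc 0 T)).prod volume) :=
      Integrable.mul_prod (f := fun _ : ℝ => A * (1 + T + G) ^ 2)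
        (g := fun y : ℝ => D * ((1 + |y|) ^ 2)⁻¹) (integrable_const _)
        (integrable_inv_one_add_abs_sq.const_mul D)
    have hκ := hη.continuous
    refine hi.mono' (Continuous.aestronglyMeasurable (by fun_prop)) ?_
    have hae : ∀ᵐ p ∂((volume.restrict (Set.Ioc 0 T)).prod (volume : Measure ℝ)),
        p.1 ∈ Set.Ioc 0 T := by
      rw [← Measure.restrict_univ (μ := (volume : Measure ℝ)), Measure.prod_restrict,
        ae_restrict_iff' (measurableSet_Ioc.prod MeasurableSet.univ)]
      exact .of_forall fun p hp => hp.1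
    filter_upwards [hae] with p hp
    have h1 : 1 + |p.1 + G * p.2| ≤ (1 + T + G) * (1 + |p.2|) := by
      have := abs_add_le p.1 (G * p.2)
      rw [abs_mul, abs_of_pos hG, abs_of_pos hp.1] at this
      nlinarith [hp.1, hp.2, abs_nonneg p.2, mul_nonneg hT (abs_nonneg p.2)]
    have h2 := hη.nonneg p.2
    rw [Function.uncurry, norm_mul, Real.norm_of_nonneg h2, Real.norm_eq_abs]
    calc κ p.2 * |F (p.1 + G * p.2)| ≤ κ p.2 * (A * (1 + |p.1 + G * p.2|) ^ 2) := by
          gcongr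
          exact hA _
      _ ≤ κ p.2 * (A * ((1 + T + G) * (1 + |p.2|)) ^ 2) := by gcongr
      _ = (A * (1 + T + G) ^ 2) * (κ p.2 * (1 + |p.2|) ^ 2) := by ring
      _ ≤ (A * (1 + T + G) ^ 2) * (κ p.2 * (1 + |p.2|) ^ 10) := by
          gcongr
          · linarith [abs_nonneg p.2]
          · norm_num
      _ ≤ _ := by
          exact mul_le_mul_of_nonneg_left (h _) (by positivity)

lemma SmoothingKernel.exists_pos_le (hη : SmoothingKernel η κ) :
    ∃ c δ, 0 < c ∧ 0 < δ ∧ δ ≤ 1 ∧ ∀ y, |y| ≤ δ → c ≤ κ y := by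
  have h1 : ∀ᶠ y in nhds (0 : ℝ), κ 0 / 2 < κ y :=
    hη.continuous.continuousAt.eventually_const_lt (half_lt_self hη.pos)
  obtain ⟨ε, hε, h⟩ := Metric.eventually_nhds_iff.1 h1
  refine ⟨κ 0 / 2, min (ε / 2) 1, half_pos hη.pos, by positivity, min_le_right _ _, fun y hy => ?_⟩
  refine (h ?_).le
  rw [dist_zero_right, Real.norm_eq_abs]
  linarith [min_le_left (ε / 2) 1]

/-- A nonnegative function whose averages are bounded has small integrals over short intervals. -/
lemma integral_short_le (hη : SmoothingKernel η κ) (hF : Continuous F) (hF0 : ∀ t, 0 ≤ F t)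
    {A : ℝ} (hA : ∀ t, |F t| ≤ A * (1 + |t|) ^ 2) {c δ : ℝ} (hc : 0 < c) (hδ : 0 < δ)
    (hκ : ∀ y, |y| ≤ δ → c ≤ κ y) {G x : ℝ} (hG : 0 < G) :
    ∫ t in x..(x + δ * G), F t ≤ G / c * ∫ t, window κ G x t * F t := by
  have hInt : Integrable fun t => window κ G x t * F t := by
    have h1 := integrable_window_mul hη hG x (F := fun t => (F t : ℂ)) (C := |A|)
      (continuous_ofReal.comp hF).aestronglyMeasurable (fun t => by
        rw [norm_real, Real.norm_eq_abs]
        refine (hA t).trans ?_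
        have h0 : 1 ≤ 1 + |t| := by linarith [abs_nonneg t]
        have h2 := pow_le_pow_right₀ h0 (by norm_num : 2 ≤ 4)
        have h3 := le_abs_self A
        gcongr)
    have h2 := h1.re
    refine h2.congr (.of_forall fun t => ?_)
    simp only [← ofReal_mul]
    exact ofReal_re _
  have hxy : x ≤ x + δ * G := by linarith [mul_pos hδ hG]
  have hw0 := window_nonneg hη hG x
  rw [intervalIntegral.integral_of_le hxy]
  calc ∫ t in Set.Ioc x (x + δ * G), F t
      ≤ ∫ t in Set.Ioc x (x + δ * G), G / c * (window κ G x t * F t) := by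
        refine setIntegral_mono_on ?_ (hInt.integrableOn.const_mul _) measurableSet_Ioc
          fun t ht => ?_
        · exact (hF.integrableOn_Icc).mono_set Set.Ioc_subset_Icc_self
        · have h1 : |(t - x) / G| ≤ δ := by
            rw [abs_of_nonneg (div_nonneg (by linarith [ht.1]) hG.le), div_le_iff₀ hG]
            linarith [ht.2]
          have h2 := hκ _ h1
          have h3 : 1 ≤ G / c * window κ G x t := by
            rw [window, show G / c * (κ ((t - x) / G) / G) = κ ((t - x) / G) / c by field_simp,
              le_div_iff₀ hc]
            linarith
          have := mul_le_mul_of_nonneg_right h3 (hF0 t)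
          linarith
    _ = G / c * ∫ t in Set.Ioc x (x + δ * G), window κ G x t * F t := integral_const_mul _ _
    _ ≤ _ := by
        refine mul_le_mul_of_nonneg_left (setIntegral_le_integral hInt ?_) (by positivity)
        exact .of_forall fun t => mul_nonneg (hw0 t) (hF0 t)

lemma integral_le_mul_of_short (hF : Continuous F) (hF0 : ∀ t, 0 ≤ F t) {K d R : ℝ} (hd : 0 < d)
    (hK : ∀ x, |x| ≤ R → ∫ t in x..(x + d), F t ≤ K) (hK0 : 0 ≤ K) {x h : ℝ} (hx : -R ≤ x)
    (hh : 0 ≤ h) (hxh : x + h ≤ R) : ∫ t in x..(x + h), F t ≤ (h / d + 1) * K := by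
  have hi : ∀ u v, IntervalIntegrable F volume u v := fun u v => hF.intervalIntegrable u v
  have h1 : ∀ n : ℕ, x + (n - 1) * d ≤ R → ∫ t in x..(x + n * d), F t ≤ n * K := fun n => by
    induction n with
    | zero => simp
    | succ n ih =>
      intro hn
      push_cast at hn ⊢
      rw [add_sub_cancel_right] at hn
      have h2 := ih (by linarith)
      have h3 : (0 : ℝ) ≤ n * d := by positivity
      have h4 := hK (x + n * d) (abs_le.2 ⟨by linarith, hn⟩)
      rw [← intervalIntegral.integral_add_adjacent_intervals (hi x (x + n * d)) (hi _ _),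
        show x + ((n : ℝ) + 1) * d = x + n * d + d by ring]
      linarith
  set n := ⌈h / d⌉₊
  have h2 : h / d ≤ n := Nat.le_ceil _
  have h3 : (n : ℝ) < h / d + 1 := Nat.ceil_lt_add_one (by positivity)
  have h4 : h ≤ n * d := by rwa [div_le_iff₀ hd] at h2
  have h5 : ((n : ℝ) - 1) * d ≤ h := by
    rw [← le_div_iff₀ hd]
    linarith
  calc ∫ t in x..(x + h), F t ≤ ∫ t in x..(x + n * d), F t := by
        refine intervalIntegral.integral_mono_interval le_rfl (by linarith) (by linarith)
          (.of_forall hF0) (hi _ _)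
    _ ≤ n * K := h1 n (by linarith)
    _ ≤ _ := by gcongr

lemma exists_abs_integral_increment_le (hη : SmoothingKernel η κ) (hF : Continuous F)
    (hF0 : ∀ t, 0 ≤ F t) {A B : ℝ} (hA : ∀ t, |F t| ≤ A * (1 + |t|) ^ 2)
    (hB : ∀ G τ : ℝ, 4 ≤ G → |τ| ≤ 2 * G ^ 2 → ∫ t, window κ G τ t * F t ≤ B * Real.log G) :
    ∃ C, 0 < C ∧ ∀ G T y : ℝ, 4 ≤ G → 0 ≤ T → T ≤ G ^ 2 →
      |∫ t in T..(T + G * y), F t| ≤ C * (G * Real.log G) * (1 + |y|) ^ 10 := by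
  obtain ⟨c, δ, hc, hδ, -, hκ⟩ := hη.exists_pos_le
  refine ⟨(1 / δ + 1) * (|B| / c) + 4 * |A| + 1, by positivity, fun G T y hG hT hTG => ?_⟩
  have hG0 : 0 < G := by linarith
  have hlog := one_le_log_of_four_le hG
  have hy1 : 1 ≤ 1 + |y| := by linarith [abs_nonneg y]
  have hP : (1 + |y|) ≤ (1 + |y|) ^ 10 := le_self_pow₀ hy1 (by norm_num)
  have hP5 : (1 + |y|) ^ 5 ≤ (1 + |y|) ^ 10 := pow_le_pow_right₀ hy1 (by norm_num)
  have hGl : 0 < G * Real.log G := by positivity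
  rcases le_or_gt |y| G with hyG | hyG
  · have hK : ∀ x, |x| ≤ 2 * G ^ 2 → ∫ t in x..(x + δ * G), F t ≤ |B| / c * (G * Real.log G) :=
      fun x hx => by
        refine (integral_short_le hη hF hF0 hA hc hδ hκ hG0).trans ?_
        have h1 : ∫ t, window κ G x t * F t ≤ |B| * Real.log G :=
          (hB G x hG hx).trans (by gcongr; exact le_abs_self B)
        calc _ ≤ G / c * (|B| * Real.log G) := by gcongr
          _ = _ := by ring
    have hGy : |G * y| ≤ G ^ 2 := by
      rw [abs_mul, abs_of_pos hG0]
      nlinarith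
    have key : ∀ x, -(2 * G ^ 2) ≤ x → x + |G * y| ≤ 2 * G ^ 2 →
        ∫ t in x..(x + |G * y|), F t ≤
          ((1 / δ + 1) * (|B| / c) + 4 * |A| + 1) * (G * Real.log G) * (1 + |y|) ^ 10 :=
      fun x hx hxy => by
        refine (integral_le_mul_of_short hF hF0 (by positivity) hK (by positivity) hx
          (abs_nonneg _) hxy).trans ?_
        have h1 : |G * y| / (δ * G) + 1 ≤ (1 / δ + 1) * (1 + |y|) := by
          rw [abs_mul, abs_of_pos hG0, show G * |y| / (δ * G) = 1 / δ * |y| by field_simp]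
          have : 0 ≤ 1 / δ := by positivity
          linarith [abs_nonneg y]
        calc _ ≤ ((1 / δ + 1) * (1 + |y|) ^ 10) * (|B| / c * (G * Real.log G)) := by
              refine mul_le_mul_of_nonneg_right (h1.trans ?_) (by positivity)
              gcongr
          _ = (1 / δ + 1) * (|B| / c) * (G * Real.log G) * (1 + |y|) ^ 10 := by ring
          _ ≤ _ := by
              gcongr
              have := abs_nonneg A
              linarith
    rcases le_total 0 y with hy | hy
    · have h1 : |G * y| = G * y := abs_of_nonneg (by positivity)
      have h2 := key T (by nlinarith) (by linarith)
      rw [h1] at h2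
      rwa [abs_of_nonneg (intervalIntegral.integral_nonneg (by nlinarith) fun t _ => hF0 t)]
    · have h1 : |G * y| = -(G * y) := abs_of_nonpos (mul_nonpos_of_nonneg_of_nonpos hG0.le hy)
      have h2 := key (T + G * y) (by nlinarith) (by nlinarith)
      rw [h1, add_neg_cancel_right] at h2
      rwa [intervalIntegral.integral_symm, abs_neg,
        abs_of_nonneg (intervalIntegral.integral_nonneg (by nlinarith) fun t _ => hF0 t)]
  · have h1 : ∀ t ∈ Set.uIoc T (T + G * y), ‖F t‖ ≤ |A| * (4 * (1 + |y|) ^ 4) := fun t ht => by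
      have h2 := Set.abs_sub_left_of_mem_uIcc (Set.uIoc_subset_uIcc ht)
      rw [add_sub_cancel_left, abs_mul, abs_of_pos hG0] at h2
      have h3 : |t| ≤ 2 * |y| ^ 2 := by
        have h4 := abs_sub_abs_le_abs_sub t T
        rw [abs_of_nonneg hT] at h4
        nlinarith
      rw [Real.norm_eq_abs]
      calc |F t| ≤ A * (1 + |t|) ^ 2 := hA t
        _ ≤ |A| * (1 + |t|) ^ 2 := by gcongr; exact le_abs_self A
        _ ≤ |A| * (2 * (1 + |y|) ^ 2) ^ 2 := by
            gcongr
            nlinarith [abs_nonneg y]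
        _ = _ := by ring
    have h2 := intervalIntegral.norm_integral_le_of_norm_le_const h1
    rw [Real.norm_eq_abs, add_sub_cancel_left, abs_mul, abs_of_pos hG0] at h2
    refine h2.trans ?_
    calc |A| * (4 * (1 + |y|) ^ 4) * (G * |y|) ≤ |A| * (4 * (1 + |y|) ^ 4) * (G * (1 + |y|)) := by
          gcongr
          linarith
      _ = 4 * |A| * (G * 1) * (1 + |y|) ^ 5 := by ring
      _ ≤ 4 * |A| * (G * Real.log G) * (1 + |y|) ^ 10 := by gcongr
      _ ≤ _ := by
          gcongr
          have : 0 ≤ (1 / δ + 1) * (|B| / c) := by positivity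
          linarith

lemma exists_abs_integral_sub_integral_window_le (hη : SmoothingKernel η κ) (hF : Continuous F)
    (hF0 : ∀ t, 0 ≤ F t) {A B : ℝ} (hA : ∀ t, |F t| ≤ A * (1 + |t|) ^ 2)
    (hB : ∀ G τ : ℝ, 4 ≤ G → |τ| ≤ 2 * G ^ 2 → ∫ t, window κ G τ t * F t ≤ B * Real.log G) :
    ∃ C, 0 < C ∧ ∀ G : ℝ, 4 ≤ G → |(∫ t in (0 : ℝ)..(G ^ 2), F t) -
      ∫ τ in (0 : ℝ)..(G ^ 2), ∫ t, window κ G τ t * F t| ≤ C * (G * Real.log G) := by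
  obtain ⟨C, hC, hinc⟩ := exists_abs_integral_increment_le hη hF hF0 hA hB
  obtain ⟨D, hD, hdec⟩ := hη.exists_mul_pow_le
  have hI0 : 0 ≤ ∫ y : ℝ, ((1 + |y|) ^ 2)⁻¹ := integral_nonneg fun y => by positivity
  refine ⟨2 * C * D * (∫ y : ℝ, ((1 + |y|) ^ 2)⁻¹) + 1, by positivity, fun G hG => ?_⟩
  have hG0 : 0 < G := by linarith
  have hGl : 0 < G * Real.log G := by
    have := one_le_log_of_four_le hG
    positivity
  have hi : ∀ u v, IntervalIntegrable F volume u v := fun u v => hF.intervalIntegrable u v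
  obtain ⟨S, hS⟩ : ∃ S : ℝ → ℝ, S = fun y => (∫ t in (G ^ 2)..(G ^ 2 + G * y), F t) -
    ∫ t in (0 : ℝ)..(0 + G * y), F t := ⟨_, rfl⟩
  have hSb : ∀ y, |S y| ≤ 2 * (C * (G * Real.log G) * (1 + |y|) ^ 10) := fun y => by
    rw [hS]
    have h1 := hinc G (G ^ 2) y hG (by positivity) le_rfl
    have h2 := hinc G 0 y hG le_rfl (by positivity)
    exact (abs_sub _ _).trans (by linarith)
  have hb : ∀ y, ‖κ y * S y‖ ≤ 2 * C * (G * Real.log G) * D * ((1 + |y|) ^ 2)⁻¹ := fun y => by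
    rw [norm_mul, Real.norm_of_nonneg (hη.nonneg y), Real.norm_eq_abs]
    calc κ y * |S y| ≤ κ y * (2 * (C * (G * Real.log G) * (1 + |y|) ^ 10)) :=
          mul_le_mul_of_nonneg_left (hSb y) (hη.nonneg y)
      _ = 2 * C * (G * Real.log G) * (κ y * (1 + |y|) ^ 10) := by ring
      _ ≤ 2 * C * (G * Real.log G) * (D * ((1 + |y|) ^ 2)⁻¹) :=
          mul_le_mul_of_nonneg_left (hdec y) (by positivity)
      _ = _ := by ring
  have hSc : Continuous S := by
    have hp := intervalIntegral.continuous_primitive hi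
    have e : S = fun y => ((∫ t in (0 : ℝ)..(G ^ 2 + G * y), F t) - ∫ t in (0 : ℝ)..(G ^ 2), F t) -
        ∫ t in (0 : ℝ)..(0 + G * y), F t := by
      rw [hS]
      ext y
      rw [intervalIntegral.integral_interval_sub_left (hi _ _) (hi _ _)]
    rw [e]
    exact (((hp 0).comp (by fun_prop)).sub continuous_const).sub ((hp 0).comp (by fun_prop))
  have hκS : Integrable fun y => κ y * S y :=
    (integrable_inv_one_add_abs_sq.const_mul _).mono' (hη.continuous.mul hSc).aestronglyMeasurable
      (.of_forall hb)
  have hκ1 : Integrable κ := Integrable.of_integral_ne_zero (by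
    rw [hη.integral_eq_one]; norm_num)
  have e1 : ∫ τ in (0 : ℝ)..(G ^ 2), ∫ t, window κ G τ t * F t =
      (∫ y, κ y * S y) + ∫ t in (0 : ℝ)..(G ^ 2), F t := by
    rw [integral_integral_window_mul hη hG0 (by positivity) hF hA]
    have e2 : ∫ t in (0 : ℝ)..(G ^ 2), F t = ∫ y, κ y * ∫ t in (0 : ℝ)..(G ^ 2), F t := by
      rw [integral_mul_const, hη.integral_eq_one, one_mul]
    rw [e2, ← integral_add hκS (hκ1.mul_const _)]
    congr 1
    ext y
    rw [hS, ← mul_add]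
    simp only [zero_add]
    rw [← intervalIntegral.integral_add_adjacent_intervals (hi 0 (G ^ 2)) (hi _ (G ^ 2 + G * y))]
    ring
  rw [e1, sub_add_cancel_right, abs_neg, ← Real.norm_eq_abs]
  refine (norm_integral_le_of_norm_le (integrable_inv_one_add_abs_sq.const_mul _)
    (.of_forall hb)).trans ?_
  rw [integral_const_mul]
  linarith

end

section

variable {η : ℝ → ℂ} {κ : ℝ → ℝ} {a : ℝ}

/-- The smoothed product of `ζ_H(1/2 + i + it)` and the conjugate of `ζ_H(1/2 + j + it)`. -/
noncomputable def zetaPair (κ : ℝ → ℝ) (G a : ℝ) (i j : ℕ) (τ : ℝ) : ℂ :=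
  ∫ t, (window κ G τ t : ℂ) * (hzeta a (1 / 2 + i + t * I) *
    (starRingEnd ℂ) (hzeta a (1 / 2 + j + t * I)))

lemma zetaPair_zero (κ : ℝ → ℝ) (G a : ℝ) (j : ℕ) : zetaPair κ G a 0 j = zetaCorr κ G a j := by
  ext τ
  simp only [zetaPair, zetaCorr, Nat.cast_zero, add_zero]

lemma zetaPair_swap (κ : ℝ → ℝ) (G a : ℝ) (i j : ℕ) (τ : ℝ) :
    zetaPair κ G a i j τ = (starRingEnd ℂ) (zetaPair κ G a j i τ) := by
  unfold zetaPair
  rw [← integral_conj]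
  congr 1
  ext t
  simp only [map_mul, conj_ofReal, conj_conj]
  ring

lemma continuous_hzeta_half_add (a : ℝ) (j : ℕ) :
    Continuous fun t : ℝ => hzeta a (1 / 2 + j + t * I) := by
  have := continuous_hzeta_line (a := a) (σ := 1 / 2 + j) (fun h => by
    have h2 : (j : ℝ) * 2 = 1 := by linarith
    have h3 : j * 2 = 1 := by exact_mod_cast h2
    omega)
  simpa using this

lemma stronglyMeasurable_zetaPair (hη : SmoothingKernel η κ) (G a : ℝ) (i j : ℕ) :
    StronglyMeasurable (zetaPair κ G a i j) := by
  have h2 := hη.continuous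
  have h3 : Continuous fun p : ℝ × ℝ => (window κ G p.1 p.2 : ℂ) *
      (hzeta a (1 / 2 + i + p.2 * I) * (starRingEnd ℂ) (hzeta a (1 / 2 + j + p.2 * I))) := by
    refine Continuous.mul ?_ (Continuous.mul ?_ ?_)
    · unfold window
      fun_prop
    · exact (continuous_hzeta_half_add a i).comp continuous_snd
    · exact continuous_conj.comp ((continuous_hzeta_half_add a j).comp continuous_snd)
  exact h3.stronglyMeasurable.integral_prod_right'

lemma exists_norm_hzeta_half_add_le (ha : 0 < a) (ha1 : a ≤ 1) (j : ℕ) : ∃ C, 0 < C ∧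
    ∀ t : ℝ, ‖hzeta a (1 / 2 + j + t * I)‖ ≤ C * (1 + |t|) := by
  rcases j with _ | j
  · simpa using exists_norm_hzeta_le ha ha1
  have hσ : (1 : ℝ) < 3 / 2 + j := by linarith [Nat.cast_nonneg (α := ℝ) j]
  have hs := summable_nat_add_rpow ha hσ
  have hpos : ∀ n : ℕ, 0 ≤ (n + a : ℝ) ^ (-(3 / 2 + j) : ℝ) := fun n =>
    Real.rpow_nonneg (by positivity) _
  have h0 : 0 ≤ ∑' n : ℕ, (n + a : ℝ) ^ (-(3 / 2 + j) : ℝ) := tsum_nonneg hpos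
  refine ⟨∑' n : ℕ, (n + a : ℝ) ^ (-(3 / 2 + j) : ℝ) + 1, by linarith, fun t => ?_⟩
  have e : (1 / 2 + (j + 1 : ℕ) + t * I : ℂ) = ((3 / 2 + j : ℝ) : ℂ) + t * I := by
    push_cast
    ring
  rw [e, ← (hasSum_hzeta_line ha ha1 hσ t).tsum_eq]
  refine (tsum_of_norm_bounded hs.hasSum fun n => ?_).trans ?_
  · rw [norm_mul, ← ofReal_neg, norm_exp_ofReal_mul_I, mul_one, norm_real,
      Real.norm_of_nonneg (hpos n)]
  · nlinarith [abs_nonneg t, mul_nonneg h0 (abs_nonneg t)]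

lemma integrable_window_mul_pair (hη : SmoothingKernel η κ) {G : ℝ} (hG : 0 < G) (ha : 0 < a)
    (ha1 : a ≤ 1) (i j : ℕ) (τ : ℝ) :
    Integrable fun t => (window κ G τ t : ℂ) * (hzeta a (1 / 2 + i + t * I) *
      (starRingEnd ℂ) (hzeta a (1 / 2 + j + t * I))) := by
  obtain ⟨C, hC, h⟩ := exists_norm_hzeta_half_add_le ha ha1 i
  obtain ⟨D, hD, h'⟩ := exists_norm_hzeta_half_add_le ha ha1 j
  refine integrable_window_mul hη hG τ (C := C * D) (Continuous.aestronglyMeasurable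
    ((continuous_hzeta_half_add a i).mul (continuous_conj.comp (continuous_hzeta_half_add a j))))
    fun t => ?_
  rw [norm_mul, RCLike.norm_conj]
  have h0 : 1 ≤ 1 + |t| := by linarith [abs_nonneg t]
  calc _ ≤ (C * (1 + |t|)) * (D * (1 + |t|)) :=
        mul_le_mul (h t) (h' t) (norm_nonneg _) (by positivity)
    _ = C * D * (1 + |t|) ^ 2 := by ring
    _ ≤ _ := by
      gcongr
      norm_num

lemma norm_zetaPair_succ_sub_le (hη : SmoothingKernel η κ) (ha : 0 < a) (ha1 : a ≤ 1) {G : ℝ}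
    (hG : 4 ≤ G) (i j : ℕ) (τ : ℝ) :
    ‖zetaPair κ G a (i + 1) (j + 1) τ - hzeta a ((i + 1 + (j + 1) + 1 : ℕ) : ℂ)‖ ≤ 32 / G := by
  have hi := Nat.cast_nonneg (α := ℝ) i
  have hj := Nat.cast_nonneg (α := ℝ) j
  have h := norm_integral_window_hzeta_mul_conj_sub_le hη ha ha1 hG (α := 3 / 2 + i)
    (β := 3 / 2 + j) (by linarith) (by linarith) τ
  have e : ∀ (n : ℕ) (t : ℝ), (1 / 2 + (n + 1 : ℕ) + t * I : ℂ) = ((3 / 2 + n : ℝ) : ℂ) + t * I :=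
    fun n t => by
      push_cast
      ring
  have e2 : ((i + 1 + (j + 1) + 1 : ℕ) : ℂ) = ((3 / 2 + i + (3 / 2 + j) : ℝ) : ℂ) := by
    push_cast
    ring
  simp only [zetaPair, e, e2]
  exact h

lemma exists_norm_zetaPair_le (hη : SmoothingKernel η κ) (ha : 0 < a) (ha1 : a ≤ 1) (i j : ℕ) :
    ∃ C, 0 < C ∧ ∀ G τ : ℝ, 4 ≤ G → |τ| ≤ 2 * G ^ 2 →
      ‖zetaPair κ G a i j τ‖ ≤ C * Real.log G := by
  rcases i with _ | i
  · obtain ⟨C, hC, h⟩ := exists_zetaCorr_approx hη ha ha1 j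
    exact ⟨C, hC, fun G τ hG hτ => by rw [zetaPair_zero]; exact (h G τ hG hτ).2.2⟩
  rcases j with _ | j
  · obtain ⟨C, hC, h⟩ := exists_zetaCorr_approx hη ha ha1 (i + 1)
    refine ⟨C, hC, fun G τ hG hτ => ?_⟩
    rw [zetaPair_swap, RCLike.norm_conj, zetaPair_zero]
    exact (h G τ hG hτ).2.2
  · refine ⟨‖hzeta a ((i + 1 + (j + 1) + 1 : ℕ) : ℂ)‖ + 8, by positivity, fun G τ hG _ => ?_⟩
    have h1 := norm_zetaPair_succ_sub_le hη ha ha1 hG i j τ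
    have h2 := norm_le_insert' (zetaPair κ G a (i + 1) (j + 1) τ)
      (hzeta a ((i + 1 + (j + 1) + 1 : ℕ) : ℂ))
    have h3 : 32 / G ≤ 8 := by
      rw [div_le_iff₀ (by linarith)]
      linarith
    refine le_trans ?_ (le_mul_of_one_le_right (by positivity) (one_le_log_of_four_le hG))
    linarith

lemma intervalIntegrable_zetaPair (hη : SmoothingKernel η κ) (ha : 0 < a) (ha1 : a ≤ 1) (i j : ℕ)
    {G : ℝ} (hG : 4 ≤ G) : IntervalIntegrable (zetaPair κ G a i j) volume 0 (G ^ 2) := by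
  obtain ⟨C, hC, h⟩ := exists_norm_zetaPair_le hη ha ha1 i j
  refine (intervalIntegrable_const (c := C * Real.log G)).mono_fun
    (stronglyMeasurable_zetaPair hη G a i j).aestronglyMeasurable ?_
  rw [Filter.EventuallyLE, ae_restrict_iff' measurableSet_uIoc]
  refine .of_forall fun τ hτ => (h G τ hG ?_).trans (le_abs_self _)
  rw [Set.uIoc_of_le (by positivity)] at hτ
  rw [abs_of_pos hτ.1]
  linarith [hτ.2, sq_nonneg G]

/-- The main term of the integral of `zetaPair` over `[0, T]`. -/
noncomputable def pairMain (a : ℝ) (i j : ℕ) (T : ℝ) : ℂ :=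
  if i = 0 ∧ j = 0 then
    ((T * Real.log T + (gammaGen a + Real.eulerMascheroniConstant - 1 -
      Real.log (2 * Real.pi)) * T : ℝ) : ℂ)
  else T * hzeta a ((i + j + 1 : ℕ) : ℂ)

lemma norm_integral_zetaCorr_zero_sub_le (hη : SmoothingKernel η κ) (ha : 0 < a) (ha1 : a ≤ 1) :
    ∃ C, 0 < C ∧ ∀ G : ℝ, 4 ≤ G →
      ‖(∫ τ in (0 : ℝ)..(G ^ 2), zetaCorr κ G a 0 τ) - pairMain a 0 0 (G ^ 2)‖ ≤
        C * (G * Real.log G) := by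
  obtain ⟨C, hC, h⟩ := exists_integral_zetaCorr_approx hη ha ha1 0
  obtain ⟨D, hD, h'⟩ := exists_abs_latticeCount_zero_sub_le ha ha1
  refine ⟨C + 2 * Real.pi * D, by have := Real.pi_pos; positivity, fun G hG => ?_⟩
  have hlog := one_le_log_of_four_le hG
  have hpi := Real.pi_pos
  have hs : 0 < √(2 * Real.pi) := Real.sqrt_pos.2 (by positivity)
  have hs2 := Real.sq_sqrt (by positivity : 0 ≤ 2 * Real.pi)
  have hs1 : 1 ≤ √(2 * Real.pi) := by
    rw [Real.one_le_sqrt]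
    linarith [Real.pi_gt_three]
  have hs4 : √(2 * Real.pi) ≤ 4 := by
    rw [Real.sqrt_le_left (by norm_num)]
    linarith [Real.pi_lt_four]
  have h1 := h G (G ^ 2) hG (by positivity) (by linarith [sq_nonneg G])
  have h2 := h' (G / √(2 * Real.pi)) (by rw [le_div_iff₀ hs]; linarith)
  rw [Real.log_div (by linarith) hs.ne', div_pow, hs2, mul_div_cancel₀ _ (by positivity),
    Real.log_sqrt (by positivity)] at h2
  have h3 : ‖((2 * Real.pi * latticeCount a 0 (G ^ 2) : ℝ) : ℂ) - pairMain a 0 0 (G ^ 2)‖ ≤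
      2 * Real.pi * D * (G * Real.log G) := by
    rw [pairMain, if_pos ⟨rfl, rfl⟩, ← ofReal_sub, norm_real, Real.norm_eq_abs, Real.log_pow]
    have e : 2 * Real.pi * latticeCount a 0 (G ^ 2) - (G ^ 2 * ((2 : ℕ) * Real.log G) +
        (gammaGen a + Real.eulerMascheroniConstant - 1 - Real.log (2 * Real.pi)) * G ^ 2) =
        2 * Real.pi * (latticeCount a 0 (G ^ 2) - G ^ 2 / (2 * Real.pi) *
          (2 * (Real.log G - Real.log (2 * Real.pi) / 2) + gammaGen a +
            Real.eulerMascheroniConstant - 1)) := by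
      field_simp
      push_cast
      ring
    rw [e, abs_mul, abs_of_pos (by positivity)]
    calc _ ≤ 2 * Real.pi * (D * (G / √(2 * Real.pi))) := by gcongr
      _ ≤ 2 * Real.pi * (D * (G * Real.log G)) := by
        gcongr
        exact (div_le_self (by linarith) hs1).trans (le_mul_of_one_le_right (by linarith) hlog)
      _ = _ := by ring
  refine (norm_sub_le_norm_sub_add_norm_sub _ _ _).trans ((add_le_add h1 h3).trans_eq ?_)
  ring

lemma norm_integral_zetaCorr_succ_sub_le (hη : SmoothingKernel η κ) (ha : 0 < a) (ha1 : a ≤ 1)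
    (j : ℕ) : ∃ C, 0 < C ∧ ∀ G : ℝ, 4 ≤ G →
      ‖(∫ τ in (0 : ℝ)..(G ^ 2), zetaCorr κ G a (j + 1) τ) - pairMain a 0 (j + 1) (G ^ 2)‖ ≤
        C * (G * Real.log G) := by
  obtain ⟨C, hC, h⟩ := exists_integral_zetaCorr_approx hη ha ha1 (j + 1)
  obtain ⟨D, hD, h'⟩ := exists_norm_latticeCount_succ_sub_le ha ha1 j
  refine ⟨C + 2 * Real.pi * (3 * D), by have := Real.pi_pos; positivity, fun G hG => ?_⟩
  have hlog := one_le_log_of_four_le hG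
  have hpi := Real.pi_pos
  have hX : 1 ≤ G ^ 2 / (2 * Real.pi) := by
    rw [le_div_iff₀ (by positivity)]
    nlinarith [Real.pi_lt_four]
  have h1 := h G (G ^ 2) hG (by positivity) (by linarith [sq_nonneg G])
  have h2 := h' (G ^ 2 / (2 * Real.pi)) hX
  rw [mul_div_cancel₀ _ (by positivity)] at h2
  have h4 : 1 + Real.log (G ^ 2 / (2 * Real.pi)) ≤ 3 * (G * Real.log G) := by
    have h5 : Real.log (G ^ 2 / (2 * Real.pi)) ≤ Real.log (G ^ 2) := by
      refine Real.log_le_log (by linarith) (div_le_self (by positivity) ?_)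
      linarith [Real.pi_gt_three]
    rw [Real.log_pow] at h5
    push_cast at h5
    nlinarith
  have h3 : ‖((2 * Real.pi * latticeCount a (j + 1) (G ^ 2) : ℝ) : ℂ) -
      pairMain a 0 (j + 1) (G ^ 2)‖ ≤ 2 * Real.pi * (3 * D) * (G * Real.log G) := by
    rw [pairMain, if_neg (by omega)]
    have e : ((2 * Real.pi * latticeCount a (j + 1) (G ^ 2) : ℝ) : ℂ) -
        ((G ^ 2 : ℝ) : ℂ) * hzeta a ((0 + (j + 1) + 1 : ℕ) : ℂ) = ((2 * Real.pi : ℝ) : ℂ) *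
        ((latticeCount a (j + 1) (G ^ 2) : ℂ) - ((G ^ 2 / (2 * Real.pi) : ℝ) : ℂ) *
          hzeta a ((j + 2 : ℕ) : ℂ)) := by
      have : (Real.pi : ℂ) ≠ 0 := by exact_mod_cast hpi.ne'
      rw [show 0 + (j + 1) + 1 = j + 2 by ring]
      push_cast
      field_simp
    rw [e, norm_mul, norm_real, Real.norm_of_nonneg (by positivity)]
    calc _ ≤ 2 * Real.pi * (D * (3 * (G * Real.log G))) := by
          gcongr
          exact h2.trans (by gcongr)
      _ = _ := by ring
  refine (norm_sub_le_norm_sub_add_norm_sub _ _ _).trans ((add_le_add h1 h3).trans_eq ?_)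
  ring

lemma conj_hzeta_nat (ha : 0 < a) (ha1 : a ≤ 1) (j : ℕ) :
    (starRingEnd ℂ) (hzeta a ((j + 2 : ℕ) : ℂ)) = hzeta a ((j + 2 : ℕ) : ℂ) := by
  rw [← (hasSum_hzeta_nat ha ha1 j).tsum_eq, ← ofReal_tsum, conj_ofReal]

lemma exists_norm_integral_zetaPair_sub_le (hη : SmoothingKernel η κ) (ha : 0 < a) (ha1 : a ≤ 1)
    (i j : ℕ) : ∃ C, 0 < C ∧ ∀ G : ℝ, 4 ≤ G →
      ‖(∫ τ in (0 : ℝ)..(G ^ 2), zetaPair κ G a i j τ) - pairMain a i j (G ^ 2)‖ ≤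
        C * (G * Real.log G) := by
  rcases i with _ | i
  · simp only [zetaPair_zero]
    rcases j with _ | j
    · exact norm_integral_zetaCorr_zero_sub_le hη ha ha1
    · exact norm_integral_zetaCorr_succ_sub_le hη ha ha1 j
  rcases j with _ | j
  · obtain ⟨C, hC, h⟩ := norm_integral_zetaCorr_succ_sub_le hη ha ha1 i
    refine ⟨C, hC, fun G hG => ?_⟩
    have e1 : ∫ τ in (0 : ℝ)..(G ^ 2), zetaPair κ G a (i + 1) 0 τ =
        (starRingEnd ℂ) (∫ τ in (0 : ℝ)..(G ^ 2), zetaCorr κ G a (i + 1) τ) := by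
      simp only [zetaPair_swap κ G a (i + 1) 0, zetaPair_zero]
      rw [intervalIntegral.integral_of_le (by positivity),
        intervalIntegral.integral_of_le (by positivity), integral_conj]
    have e2 : pairMain a (i + 1) 0 (G ^ 2) =
        (starRingEnd ℂ) (pairMain a 0 (i + 1) (G ^ 2)) := by
      rw [pairMain, pairMain, if_neg (by omega), if_neg (by omega), map_mul, conj_ofReal,
        show 0 + (i + 1) + 1 = i + 2 by ring, show i + 1 + 0 + 1 = i + 2 by ring,
        conj_hzeta_nat ha ha1]
    rw [e1, e2, ← map_sub, RCLike.norm_conj]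
    exact h G hG
  · refine ⟨32, by norm_num, fun G hG => ?_⟩
    have hG0 : 0 < G := by linarith
    have hlog := one_le_log_of_four_le hG
    rw [pairMain, if_neg (by omega)]
    have e : ((G ^ 2 : ℝ) : ℂ) * hzeta a ((i + 1 + (j + 1) + 1 : ℕ) : ℂ) =
        ∫ τ in (0 : ℝ)..(G ^ 2), hzeta a ((i + 1 + (j + 1) + 1 : ℕ) : ℂ) := by
      rw [intervalIntegral.integral_const, sub_zero, real_smul]
    rw [e, ← intervalIntegral.integral_sub (intervalIntegrable_zetaPair hη ha ha1 _ _ hG)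
      intervalIntegrable_const]
    refine (intervalIntegral.norm_integral_le_of_norm_le_const (C := 32 / G)
      fun τ _ => norm_zetaPair_succ_sub_le hη ha ha1 hG i j τ).trans ?_
    rw [sub_zero, abs_of_nonneg (by positivity), sq, ← mul_assoc, div_mul_cancel₀ _ hG0.ne']
    gcongr
    exact le_mul_of_one_le_right hG0.le hlog

end

section

variable {r : ℕ} {a : ℝ}

lemma pCoeff_pred (r : ℕ) (a : ℝ) : pCoeff r a (r - 1) = (Nat.factorial (r - 1) : ℝ)⁻¹ := by
  have h : (∏ i ∈ Finset.range (r - 1),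
      (Polynomial.X + Polynomial.C ((i : ℝ) + 1 - a))).coeff (r - 1) = 1 := by
    have hm := Polynomial.monic_prod_of_monic (Finset.range (r - 1))
      (fun i : ℕ => Polynomial.X + Polynomial.C ((i : ℝ) + 1 - a))
      fun i _ => Polynomial.monic_X_add_C _
    have hd : (∏ i ∈ Finset.range (r - 1),
        (Polynomial.X + Polynomial.C ((i : ℝ) + 1 - a))).natDegree = r - 1 := by
      rw [Polynomial.natDegree_prod_of_monic _ _ fun i _ => Polynomial.monic_X_add_C _]
      simp only [Polynomial.natDegree_X_add_C, sum_const, card_range, smul_eq_mul, mul_one]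
    have h1 := hm.coeff_natDegree
    rwa [hd] at h1
  rw [pCoeff, Polynomial.coeff_smul, h, smul_eq_mul, mul_one]

lemma zetaR_half_line (r : ℕ) (a t : ℝ) :
    zetaR r a (((r : ℝ) - 1 / 2 : ℝ) + t * I) =
      ∑ k ∈ range r, (pCoeff r a k : ℂ) * hzeta a (1 / 2 + (r - 1 - k : ℕ) + t * I) := by
  refine Finset.sum_congr rfl fun k hk => ?_
  have hk := mem_range.1 hk
  rw [show r - 1 - k = r - (k + 1) by omega, Nat.cast_sub (by omega : k + 1 ≤ r)]
  congr 2
  push_cast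
  ring

lemma continuous_zetaR_half_line (r : ℕ) (a : ℝ) :
    Continuous fun t : ℝ => zetaR r a (((r : ℝ) - 1 / 2 : ℝ) + t * I) := by
  simp only [zetaR_half_line]
  exact continuous_finsetSum _ fun k _ => continuous_const.mul (continuous_hzeta_half_add a _)

lemma exists_norm_zetaR_half_line_le (ha : 0 < a) (ha1 : a ≤ 1) (r : ℕ) :
    ∃ C, 0 < C ∧ ∀ t : ℝ, ‖zetaR r a (((r : ℝ) - 1 / 2 : ℝ) + t * I)‖ ≤ C * (1 + |t|) := by
  choose C hC h using fun j => exists_norm_hzeta_half_add_le ha ha1 j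
  refine ⟨∑ k ∈ range r, |pCoeff r a k| * C (r - 1 - k) + 1, ?_, fun t => ?_⟩
  · have : 0 ≤ ∑ k ∈ range r, |pCoeff r a k| * C (r - 1 - k) :=
      sum_nonneg fun k _ => mul_nonneg (abs_nonneg _) (hC _).le
    linarith
  rw [zetaR_half_line, add_mul, sum_mul]
  refine (norm_sum_le_of_le _ fun k _ => ?_).trans (le_add_of_nonneg_right (by positivity))
  rw [norm_mul, norm_real, Real.norm_eq_abs, mul_assoc]
  exact mul_le_mul_of_nonneg_left (h _ t) (abs_nonneg _)

lemma normSq_zetaR_half_line (r : ℕ) (a t : ℝ) :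
    ((‖zetaR r a (((r : ℝ) - 1 / 2 : ℝ) + t * I)‖ ^ 2 : ℝ) : ℂ) =
      ∑ k ∈ range r, ∑ l ∈ range r, (pCoeff r a k : ℂ) * (pCoeff r a l : ℂ) *
        (hzeta a (1 / 2 + (r - 1 - k : ℕ) + t * I) *
          (starRingEnd ℂ) (hzeta a (1 / 2 + (r - 1 - l : ℕ) + t * I))) := by
  rw [ofReal_pow, ← mul_conj', zetaR_half_line, map_sum, sum_mul_sum]
  refine sum_congr rfl fun k _ => sum_congr rfl fun l _ => ?_
  rw [map_mul, conj_ofReal]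
  ring

variable {η : ℝ → ℂ} {κ : ℝ → ℝ}

lemma integral_window_normSq_zetaR (hη : SmoothingKernel η κ) (ha : 0 < a) (ha1 : a ≤ 1) (r : ℕ)
    {G : ℝ} (hG : 0 < G) (τ : ℝ) :
    ((∫ t, window κ G τ t * ‖zetaR r a (((r : ℝ) - 1 / 2 : ℝ) + t * I)‖ ^ 2 : ℝ) : ℂ) =
      ∑ k ∈ range r, ∑ l ∈ range r, (pCoeff r a k : ℂ) * (pCoeff r a l : ℂ) *
        zetaPair κ G a (r - 1 - k) (r - 1 - l) τ := by
  have hInt := fun i j => integrable_window_mul_pair hη hG ha ha1 i j τ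
  rw [← integral_complex_ofReal]
  simp only [zetaPair, ← integral_const_mul]
  simp_rw [← integral_finsetSum _ fun l _ => (hInt _ _).const_mul _]
  rw [← integral_finsetSum _ fun k _ =>
    integrable_finsetSum _ fun l _ => (hInt _ _).const_mul _]
  congr 1
  ext t
  rw [ofReal_mul, normSq_zetaR_half_line, mul_sum]
  refine sum_congr rfl fun k _ => ?_
  rw [mul_sum]
  exact sum_congr rfl fun l _ => by ring

lemma exists_integral_window_normSq_zetaR_le (hη : SmoothingKernel η κ) (ha : 0 < a)
    (ha1 : a ≤ 1) (r : ℕ) : ∃ B, ∀ G τ : ℝ, 4 ≤ G → |τ| ≤ 2 * G ^ 2 →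
      ∫ t, window κ G τ t * ‖zetaR r a (((r : ℝ) - 1 / 2 : ℝ) + t * I)‖ ^ 2 ≤
        B * Real.log G := by
  choose C hC h using fun i j => exists_norm_zetaPair_le hη ha ha1 i j
  refine ⟨∑ k ∈ range r, ∑ l ∈ range r, |pCoeff r a k| * |pCoeff r a l| *
    C (r - 1 - k) (r - 1 - l), fun G τ hG hτ => ?_⟩
  refine (le_abs_self _).trans ?_
  rw [← Real.norm_eq_abs, ← norm_real,
    integral_window_normSq_zetaR hη ha ha1 r (by linarith : 0 < G) τ, sum_mul]
  refine norm_sum_le_of_le _ fun k _ => ?_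
  rw [sum_mul]
  refine norm_sum_le_of_le _ fun l _ => ?_
  rw [norm_mul, norm_mul, norm_real, norm_real, Real.norm_eq_abs, Real.norm_eq_abs,
    mul_assoc _ (C _ _)]
  gcongr
  exact h _ _ G τ hG hτ

lemma exists_norm_integral_normSq_zetaR_sub_le (ha : 0 < a) (ha1 : a ≤ 1) (r : ℕ) :
    ∃ C, 0 < C ∧ ∀ G : ℝ, 4 ≤ G →
      ‖((∫ t in (0 : ℝ)..(G ^ 2), ‖zetaR r a (((r : ℝ) - 1 / 2 : ℝ) + t * I)‖ ^ 2 : ℝ) : ℂ) -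
        ∑ k ∈ range r, ∑ l ∈ range r, (pCoeff r a k : ℂ) * (pCoeff r a l : ℂ) *
          pairMain a (r - 1 - k) (r - 1 - l) (G ^ 2)‖ ≤ C * (G * Real.log G) := by
  obtain ⟨η, κ, hη⟩ := exists_smoothingKernel
  obtain ⟨A, hA, hA'⟩ := exists_norm_zetaR_half_line_le ha ha1 r
  obtain ⟨B, hB⟩ := exists_integral_window_normSq_zetaR_le hη ha ha1 r
  obtain ⟨C, hC, h⟩ := exists_abs_integral_sub_integral_window_le hη
    (F := fun t => ‖zetaR r a (((r : ℝ) - 1 / 2 : ℝ) + t * I)‖ ^ 2)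
    ((continuous_zetaR_half_line r a).norm.pow 2) (fun t => by positivity) (A := A ^ 2)
    (fun t => by
      rw [abs_of_nonneg (by positivity), ← mul_pow]
      exact pow_le_pow_left₀ (norm_nonneg _) (hA' t) 2) hB
  choose D hD h' using fun i j => exists_norm_integral_zetaPair_sub_le hη ha ha1 i j
  refine ⟨C + ∑ k ∈ range r, ∑ l ∈ range r, |pCoeff r a k| * |pCoeff r a l| *
    D (r - 1 - k) (r - 1 - l), ?_, fun G hG => ?_⟩
  · have : 0 ≤ ∑ k ∈ range r, ∑ l ∈ range r, |pCoeff r a k| * |pCoeff r a l| *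
        D (r - 1 - k) (r - 1 - l) :=
      sum_nonneg fun k _ => sum_nonneg fun l _ => mul_nonneg (by positivity) (hD _ _).le
    linarith
  have hG0 : 0 < G := by linarith
  have hInt := fun i j => intervalIntegrable_zetaPair hη ha ha1 i j hG
  have e : ((∫ τ in (0 : ℝ)..(G ^ 2), ∫ t, window κ G τ t *
      ‖zetaR r a (((r : ℝ) - 1 / 2 : ℝ) + t * I)‖ ^ 2 : ℝ) : ℂ) =
      ∑ k ∈ range r, ∑ l ∈ range r, (pCoeff r a k : ℂ) * (pCoeff r a l : ℂ) *
        ∫ τ in (0 : ℝ)..(G ^ 2), zetaPair κ G a (r - 1 - k) (r - 1 - l) τ := by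
    rw [← intervalIntegral.integral_ofReal]
    simp_rw [integral_window_normSq_zetaR hη ha ha1 r hG0]
    have hk : ∀ k ∈ range r, IntervalIntegrable (fun τ => ∑ l ∈ range r,
        (pCoeff r a k : ℂ) * (pCoeff r a l : ℂ) * zetaPair κ G a (r - 1 - k) (r - 1 - l) τ)
        volume 0 (G ^ 2) := fun k _ => by
      have h1 := IntervalIntegrable.sum (range r) (f := fun l τ => (pCoeff r a k : ℂ) *
        (pCoeff r a l : ℂ) * zetaPair κ G a (r - 1 - k) (r - 1 - l) τ)
        fun l _ => (hInt (r - 1 - k) (r - 1 - l)).const_mul _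
      simpa only [Finset.sum_fn] using h1
    rw [intervalIntegral.integral_finsetSum hk]
    refine sum_congr rfl fun k _ => ?_
    rw [intervalIntegral.integral_finsetSum fun l _ => (hInt _ _).const_mul _]
    exact sum_congr rfl fun l _ => intervalIntegral.integral_const_mul _ _
  refine (norm_sub_le_norm_sub_add_norm_sub _ ((∫ τ in (0 : ℝ)..(G ^ 2), ∫ t, window κ G τ t *
      ‖zetaR r a (((r : ℝ) - 1 / 2 : ℝ) + t * I)‖ ^ 2 : ℝ) : ℂ) _).trans ?_
  rw [add_mul]
  refine add_le_add ?_ ?_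
  · rw [← ofReal_sub, norm_real, Real.norm_eq_abs]
    exact h G hG
  · rw [e, ← sum_sub_distrib, sum_mul]
    refine norm_sum_le_of_le _ fun k _ => ?_
    rw [← sum_sub_distrib, sum_mul]
    refine norm_sum_le_of_le _ fun l _ => ?_
    rw [← mul_sub, norm_mul, norm_mul, norm_real, norm_real, Real.norm_eq_abs, Real.norm_eq_abs,
      mul_assoc _ (D _ _)]
    gcongr
    exact h' _ _ G hG

lemma sum_pCoeff_mul_pairMain (hr : 1 ≤ r) (a T : ℝ) :
    ∑ k ∈ range r, ∑ l ∈ range r, (pCoeff r a k : ℂ) * (pCoeff r a l : ℂ) *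
        pairMain a (r - 1 - k) (r - 1 - l) T =
      ((Nat.factorial (r - 1) : ℂ) ^ 2)⁻¹ * (T : ℂ) * (Real.log T : ℂ) +
      ((∑ k ∈ range r, ∑ l ∈ range r,
          if (k, l) ≠ (r - 1, r - 1) then
            (pCoeff r a k : ℂ) * (pCoeff r a l : ℂ) * hzeta a ((2 * r - 1 - k - l : ℝ) : ℂ)
          else 0) +
        ((gammaGen a + Real.eulerMascheroniConstant - 1 - Real.log (2 * Real.pi) : ℝ) : ℂ) /
          (Nat.factorial (r - 1) : ℂ) ^ 2) * (T : ℂ) := by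
  obtain ⟨M, hM⟩ : ∃ M : ℂ, M = ((T * Real.log T + (gammaGen a + Real.eulerMascheroniConstant -
    1 - Real.log (2 * Real.pi)) * T : ℝ) : ℂ) := ⟨_, rfl⟩
  have h1 : ∀ k ∈ range r, ∀ l ∈ range r, (pCoeff r a k : ℂ) * (pCoeff r a l : ℂ) *
      pairMain a (r - 1 - k) (r - 1 - l) T =
      (if (k, l) ≠ (r - 1, r - 1) then
        (pCoeff r a k : ℂ) * (pCoeff r a l : ℂ) * hzeta a ((2 * r - 1 - k - l : ℝ) : ℂ)
        else 0) * T +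
      if k = r - 1 then if l = r - 1 then ((Nat.factorial (r - 1) : ℂ) ^ 2)⁻¹ * M else 0
        else 0 := by
    intro k hk l hl
    have hk := mem_range.1 hk
    have hl := mem_range.1 hl
    by_cases hkl : k = r - 1 ∧ l = r - 1
    · obtain ⟨rfl, rfl⟩ := hkl
      rw [pairMain, if_pos (by omega), if_neg (by simp), if_pos rfl, if_pos rfl, pCoeff_pred, hM]
      push_cast
      ring
    · have e : ((r - 1 - k + (r - 1 - l) + 1 : ℕ) : ℂ) = ((2 * r - 1 - k - l : ℝ) : ℂ) := by
        rw [show r - 1 - k + (r - 1 - l) + 1 = 2 * r - (1 + k + l) by omega,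
          Nat.cast_sub (by omega)]
        push_cast
        ring
      rw [pairMain, if_neg (by omega), if_pos (by simpa using hkl), e]
      have h0 : (if k = r - 1 then if l = r - 1 then ((Nat.factorial (r - 1) : ℂ) ^ 2)⁻¹ * M
          else 0 else 0) = 0 := by
        split_ifs <;> tauto
      rw [h0]
      ring
  have hmem : r - 1 ∈ range r := mem_range.2 (by omega)
  rw [sum_congr rfl fun k hk => sum_congr rfl (h1 k hk)]
  simp only [sum_add_distrib, ← sum_mul]
  have h2 : (∑ k ∈ range r, ∑ l ∈ range r, if k = r - 1 then if l = r - 1 then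
      ((Nat.factorial (r - 1) : ℂ) ^ 2)⁻¹ * M else 0 else 0) =
      ((Nat.factorial (r - 1) : ℂ) ^ 2)⁻¹ * M := by
    rw [sum_eq_single_of_mem _ hmem fun k _ hk => sum_eq_zero fun l _ => if_neg hk,
      sum_eq_single_of_mem _ hmem fun l _ hl => by rw [if_pos rfl, if_neg hl], if_pos rfl,
      if_pos rfl]
  rw [h2, hM]
  push_cast
  ring

end

theorem stmt2 (r : ℕ) (hr : 1 ≤ r) (a : ℝ) (ha : 0 < a) (ha1 : a ≤ 1) :
    (fun T : ℝ =>
        ((∫ t in (1 : ℝ)..T, ‖zetaR r a (((r : ℝ) - 1 / 2 : ℝ) + t * I)‖ ^ 2 : ℝ) : ℂ)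
        - ((Nat.factorial (r - 1) : ℂ) ^ 2)⁻¹ * (T : ℂ) * (Real.log T : ℂ)
        - ((∑ k ∈ Finset.range r, ∑ l ∈ Finset.range r,
              if (k, l) ≠ (r - 1, r - 1) then
                (pCoeff r a k : ℂ) * (pCoeff r a l : ℂ) *
                  hzeta a ((2 * r - 1 - k - l : ℝ) : ℂ)
              else 0)
            + ((gammaGen a + Real.eulerMascheroniConstant - 1
                - Real.log (2 * Real.pi) : ℝ) : ℂ) / (Nat.factorial (r - 1) : ℂ) ^ 2) * (T : ℂ))
      =O[atTop] fun T : ℝ => T ^ ((1 : ℝ) / 2) * Real.log T := by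
  obtain ⟨C, hC, h⟩ := exists_norm_integral_normSq_zetaR_sub_le ha ha1 r
  obtain ⟨J, hJ⟩ : ∃ J : ℝ, J = ∫ t in (0 : ℝ)..1,
    ‖zetaR r a (((r : ℝ) - 1 / 2 : ℝ) + t * I)‖ ^ 2 := ⟨_, rfl⟩
  refine Asymptotics.IsBigO.of_bound (C + |J|) ?_
  filter_upwards [eventually_ge_atTop 16] with T hT
  have hT0 : 0 ≤ T := by linarith
  have hG : 4 ≤ √T := Real.le_sqrt_of_sq_le (by linarith)
  have h1 := h (√T) hG
  have hlog := one_le_log_of_four_le hG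
  rw [Real.sq_sqrt hT0, sum_pCoeff_mul_pairMain hr] at h1
  have hc : Continuous fun t : ℝ => ‖zetaR r a (((r : ℝ) - 1 / 2 : ℝ) + t * I)‖ ^ 2 :=
    (continuous_zetaR_half_line r a).norm.pow 2
  have h2 := intervalIntegral.integral_add_adjacent_intervals (hc.intervalIntegrable 0 1)
    (hc.intervalIntegrable 1 T) (μ := volume)
  rw [← hJ] at h2
  rw [← h2, ofReal_add] at h1
  have hls : √T * Real.log √T ≤ √T * Real.log T := by
    rw [Real.log_sqrt hT0] at hlog ⊢
    gcongr
    linarith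
  have hb : 1 ≤ √T * Real.log √T := by nlinarith
  rw [← Real.sqrt_eq_rpow, Real.norm_of_nonneg (by linarith)]
  have hsub : ∀ x y z : ℂ, x - y - z = (J + x - (y + z)) - J := fun x y z => by ring
  rw [hsub]
  calc _ ≤ C * (√T * Real.log √T) + |J| := by
        refine (norm_sub_le _ _).trans (add_le_add h1 ?_)
        rw [norm_real, Real.norm_eq_abs]
    _ ≤ (C + |J|) * (√T * Real.log √T) := by nlinarith [abs_nonneg J]
    _ ≤ _ := by gcongr
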